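/- arXiv:1701.03987 — 7 statements merged into one kernel-verified Lean document; each statement's English description precedes it below -/
import Mathlib

section
/- Let n ≥ 1 be an integer, μ ≥ 2 a real number, and w(x) = (1+|x|²)^μ. Let s ≥ 1 be an integer and p ∈ [1, ∞) with sp < n, and set q = np/(n − sp). Then there is a constant C, depending only on n, s, p and μ, such that for every u ∈ C_c^∞(ℝⁿ): (∫_{ℝⁿ} |u|^q w dx)^{1/q} ≤ C Σ_{|α| ≤ s} (∫_{ℝⁿ} |∂^α u|^p w dx)^{1/p}, where the sum runs over all multi-indices α with |α| ≤ s. -/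
open MeasureTheory Finset

open Module
open scoped NNReal ENNReal

section JapaneseBracketPower

variable {E : Type*} [NormedAddCommGroup E] [InnerProductSpace ℝ E]

lemma contDiff_one_add_norm_sq_rpow (a : ℝ) {k : WithTop ℕ∞} :
    ContDiff ℝ k fun x : E ↦ (1 + ‖x‖ ^ 2) ^ a :=
  (contDiff_const.add (contDiff_norm_sq ℝ)).rpow_const_of_ne fun x ↦ by positivity

lemma norm_fderiv_one_add_norm_sq_rpow_le {a : ℝ} (ha : 0 ≤ a) (x : E) :
    ‖fderiv ℝ (fun y : E ↦ (1 + ‖y‖ ^ 2) ^ a) x‖ ≤ a * (1 + ‖x‖ ^ 2) ^ a := by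
  have hpos : 0 < 1 + ‖x‖ ^ 2 := by positivity
  have h := (((hasFDerivAt_id x).norm_sq.const_add 1).rpow_const (p := a) (Or.inl hpos.ne')).fderiv
  simp only [id] at h
  rw [h, norm_smul, Real.norm_of_nonneg (by positivity), Real.rpow_sub_one hpos.ne', mul_assoc]
  refine mul_le_mul_of_nonneg_left ?_ ha
  have h2 : ‖(2 • (innerSL ℝ x).comp (.id ℝ E) : E →L[ℝ] ℝ)‖ ≤ 1 + ‖x‖ ^ 2 := by
    have : ‖(2 • (innerSL ℝ x).comp (.id ℝ E) : E →L[ℝ] ℝ)‖ ≤ 2 * ‖x‖ := by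
      refine (norm_nsmul_le).trans ?_
      simp
    nlinarith [sq_nonneg (1 - ‖x‖)]
  calc _ ≤ (1 + ‖x‖ ^ 2) ^ a / (1 + ‖x‖ ^ 2) * (1 + ‖x‖ ^ 2) := by gcongr
    _ = _ := div_mul_cancel₀ _ hpos.ne'

end JapaneseBracketPower

instance ContinuousMultilinearMap.finiteDimensional {ι E F : Type*} [Finite ι]
    [NormedAddCommGroup E] [NormedSpace ℝ E] [FiniteDimensional ℝ E]
    [NormedAddCommGroup F] [NormedSpace ℝ F] [FiniteDimensional ℝ F] :
    FiniteDimensional ℝ (ContinuousMultilinearMap ℝ (fun _ : ι ↦ E) F) :=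
  FiniteDimensional.of_injective
    (ContinuousMultilinearMap.toMultilinearMapLinear :
      ContinuousMultilinearMap ℝ (fun _ : ι ↦ E) F →ₗ[ℝ] MultilinearMap ℝ (fun _ : ι ↦ E) F)
    ContinuousMultilinearMap.toMultilinearMap_injective

section WeightedNorm

variable {E : Type*} [NormedAddCommGroup E] [MeasurableSpace E]
  {F : Type*} [NormedAddCommGroup F]

/-- The `Lᵖ` norm of `f` with respect to the weight `(1 + ‖x‖ ^ 2) ^ μ`. -/
noncomputable def weightedLpNorm (ν : Measure E) (μ : ℝ) (p : ℝ≥0) (f : E → F) : ℝ≥0∞ :=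
  eLpNorm (fun x ↦ (1 + ‖x‖ ^ 2) ^ (μ / p) * ‖f x‖) p ν

lemma weightedLpNorm_congr_norm {G : Type*} [NormedAddCommGroup G] (ν : Measure E) (μ : ℝ)
    (p : ℝ≥0) {f : E → F} {g : E → G} (h : ∀ x, ‖f x‖ = ‖g x‖) :
    weightedLpNorm ν μ p f = weightedLpNorm ν μ p g := by
  simp only [weightedLpNorm, h]

variable [InnerProductSpace ℝ E] [BorelSpace E]

lemma weightedLpNorm_eq_ofReal_integral (ν : Measure E) [IsFiniteMeasureOnCompacts ν] (μ : ℝ)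
    {p : ℝ≥0} (hp : 0 < p) {f : E → F} (hf : Continuous f) (hf' : HasCompactSupport f) :
    weightedLpNorm ν μ p f
      = ENNReal.ofReal ((∫ x, ‖f x‖ ^ (p : ℝ) * (1 + ‖x‖ ^ 2) ^ μ ∂ν) ^ (1 / (p : ℝ))) := by
  have hcont : Continuous fun x ↦ (1 + ‖x‖ ^ 2) ^ (μ / p) * ‖f x‖ :=
    (contDiff_one_add_norm_sq_rpow (μ / p) (k := 0)).continuous.mul hf.norm
  have hmem : MemLp (fun x ↦ (1 + ‖x‖ ^ 2) ^ (μ / p) * ‖f x‖) p ν :=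
    hcont.memLp_of_hasCompactSupport hf'.norm.mul_left
  rw [weightedLpNorm,
    hmem.eLpNorm_eq_integral_rpow_norm (by exact_mod_cast hp.ne') ENNReal.coe_ne_top, one_div]
  congr 3 with x
  have hp' : (p : ℝ) ≠ 0 := by exact_mod_cast hp.ne'
  have hw : 0 ≤ 1 + ‖x‖ ^ 2 := by positivity
  rw [ENNReal.coe_toReal, Real.norm_of_nonneg (by positivity),
    Real.mul_rpow (by positivity) (norm_nonneg _), ← Real.rpow_mul hw, div_mul_cancel₀ _ hp',
    mul_comm]

variable [FiniteDimensional ℝ E] [NormedSpace ℝ F] [FiniteDimensional ℝ F]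

theorem weightedLpNorm_le_of_inv_eq (ν : Measure E) [ν.IsAddHaarMeasure] {μ : ℝ} (hμ : 0 ≤ μ)
    {p q : ℝ≥0} (hp : 1 ≤ p) (hn : 0 < finrank ℝ E) (hpq : p ≤ q)
    (hq : (q : ℝ)⁻¹ = (p : ℝ)⁻¹ - (finrank ℝ E : ℝ)⁻¹) :
    ∃ C : ℝ≥0, ∀ f : E → F, ContDiff ℝ 1 f → HasCompactSupport f →
      weightedLpNorm ν μ q f
        ≤ C * (weightedLpNorm ν μ p (fderiv ℝ f) + weightedLpNorm ν μ p f) := by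
  obtain ⟨a, ha⟩ : ∃ a : ℝ≥0, (a : ℝ) = μ / q := ⟨⟨μ / q, by positivity⟩, rfl⟩
  refine ⟨SNormLESNormFDerivOfEqConst F ν p * (1 + a), fun f hf hf' ↦ ?_⟩
  have hp0 : (0 : ℝ) < p := by exact_mod_cast zero_lt_one.trans_le hp
  have hw : ContDiff ℝ 1 fun x : E ↦ (1 + ‖x‖ ^ 2) ^ (a : ℝ) := contDiff_one_add_norm_sq_rpow _
  have hwp : Continuous fun x : E ↦ (1 + ‖x‖ ^ 2) ^ (μ / p) :=
    (contDiff_one_add_norm_sq_rpow (μ / p) (k := 0)).continuous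
  have hap : (a : ℝ) ≤ μ / p := ha.trans_le <| div_le_div_of_nonneg_left hμ hp0 (by exact_mod_cast hpq)
  have hderiv (x : E) : ‖fderiv ℝ (fun x ↦ (1 + ‖x‖ ^ 2) ^ (a : ℝ) • f x) x‖ ≤
      (1 + ‖x‖ ^ 2) ^ (μ / p) * ‖fderiv ℝ f x‖
        + a * ((1 + ‖x‖ ^ 2) ^ (μ / p) * ‖f x‖) := by
    have hmono : (1 + ‖x‖ ^ 2) ^ (a : ℝ) ≤ (1 + ‖x‖ ^ 2) ^ (μ / p) :=
      Real.rpow_le_rpow_of_exponent_le (by nlinarith [sq_nonneg ‖x‖]) hap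
    rw [fderiv_fun_smul (hw.differentiable one_ne_zero x) (hf.differentiable one_ne_zero x)]
    refine (norm_add_le _ _).trans (add_le_add ?_ ?_)
    · rw [norm_smul, Real.norm_of_nonneg (by positivity)]
      gcongr
    · rw [ContinuousLinearMap.norm_smulRight_apply, ← mul_assoc]
      gcongr
      exact (norm_fderiv_one_add_norm_sq_rpow_le a.coe_nonneg x).trans
        (mul_le_mul_of_nonneg_left hmono a.coe_nonneg)
  have hsum : eLpNorm (fderiv ℝ fun x ↦ (1 + ‖x‖ ^ 2) ^ (a : ℝ) • f x) p ν
      ≤ weightedLpNorm ν μ p (fderiv ℝ f) + a * weightedLpNorm ν μ p f := by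
    let g₁ : E → ℝ := fun x ↦ (1 + ‖x‖ ^ 2) ^ (μ / p) * ‖fderiv ℝ f x‖
    let g₂ : E → ℝ := fun x ↦ (1 + ‖x‖ ^ 2) ^ (μ / p) * ‖f x‖
    have hg₁ : Continuous g₁ := hwp.mul (hf.continuous_fderiv one_ne_zero).norm
    have hg₂ : Continuous g₂ := hwp.mul hf.continuous.norm
    calc eLpNorm (fderiv ℝ fun x ↦ (1 + ‖x‖ ^ 2) ^ (a : ℝ) • f x) p ν
        ≤ eLpNorm (g₁ + (a : ℝ) • g₂) p ν := eLpNorm_mono_real hderiv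
      _ ≤ eLpNorm g₁ p ν + eLpNorm ((a : ℝ) • g₂) p ν :=
          eLpNorm_add_le hg₁.aestronglyMeasurable
            (hg₂.const_smul (a : ℝ)).aestronglyMeasurable (by exact_mod_cast hp)
      _ = eLpNorm g₁ p ν + a * eLpNorm g₂ p ν := by
          rw [eLpNorm_const_smul, Real.enorm_of_nonneg a.coe_nonneg, ENNReal.ofReal_coe_nnreal]
  have hfac (A B : ℝ≥0∞) : A + a * B ≤ (1 + a) * (A + B) := by
    rw [mul_add, add_mul, add_mul, one_mul, one_mul]
    exact add_le_add le_self_add le_add_self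
  have heq : weightedLpNorm ν μ q f = eLpNorm (fun x ↦ (1 + ‖x‖ ^ 2) ^ (a : ℝ) • f x) q ν := by
    refine eLpNorm_congr_norm_ae (.of_forall fun x ↦ ?_)
    rw [norm_mul, norm_norm, norm_smul, ha]
  have hsob := eLpNorm_le_eLpNorm_fderiv_of_eq ν (hw.smul hf) hf'.smul_left hp hn hq
  rw [heq, ENNReal.coe_mul, mul_assoc]
  refine hsob.trans (mul_le_mul_right (hsum.trans ?_) _)
  rw [ENNReal.coe_add, ENNReal.coe_one]
  exact hfac _ _

theorem weightedLpNorm_le_sum_iteratedFDeriv (ν : Measure E) [ν.IsAddHaarMeasure] {μ : ℝ}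
    (hμ : 0 ≤ μ) (hn : 0 < finrank ℝ E) (s : ℕ) {p q : ℝ≥0} (hp : 1 ≤ p)
    (hsp : s / (finrank ℝ E : ℝ) < (p : ℝ)⁻¹)
    (hq : (q : ℝ)⁻¹ = (p : ℝ)⁻¹ - s / (finrank ℝ E : ℝ)) :
    ∃ C : ℝ≥0, ∀ f : E → F, ContDiff ℝ (⊤ : ℕ∞) f → HasCompactSupport f →
      weightedLpNorm ν μ q f
        ≤ C * ∑ i ∈ range (s + 1), weightedLpNorm ν μ p (iteratedFDeriv ℝ i f) := by
  induction s generalizing p with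
  | zero =>
    refine ⟨1, fun f _ _ ↦ ?_⟩
    obtain rfl : q = p := by
      have : (q : ℝ) = p := inv_injective (by simpa using hq)
      exact_mod_cast this
    simpa using (weightedLpNorm_congr_norm ν μ q fun x ↦ (norm_iteratedFDeriv_zero).symm).le
  | succ s ih =>
    have hp0 : (0 : ℝ) < p := by exact_mod_cast zero_lt_one.trans_le hp
    have hn' : (0 : ℝ) < (finrank ℝ E : ℝ)⁻¹ := by positivity
    have hsplit : ((s + 1 : ℕ) : ℝ) / (finrank ℝ E : ℝ)
        = s / (finrank ℝ E : ℝ) + (finrank ℝ E : ℝ)⁻¹ := by push_cast; ring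
    have hs0 : (0 : ℝ) ≤ s / (finrank ℝ E : ℝ) := by positivity
    rw [hsplit] at hsp hq
    have hpos : 0 < (p : ℝ)⁻¹ - (finrank ℝ E : ℝ)⁻¹ := by linarith
    let r : ℝ≥0 := ⟨((p : ℝ)⁻¹ - (finrank ℝ E : ℝ)⁻¹)⁻¹, by positivity⟩
    have hr : (r : ℝ)⁻¹ = (p : ℝ)⁻¹ - (finrank ℝ E : ℝ)⁻¹ := inv_inv _
    have hpr : p ≤ r := by
      rw [← NNReal.coe_le_coe]
      exact (inv_le_inv₀ (inv_pos.1 (hr ▸ hpos)) hp0).1 (by linarith)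
    obtain ⟨C, hC⟩ := ih (hp.trans hpr) (by linarith) (by linarith)
    choose D hD using fun i : ℕ ↦
      weightedLpNorm_le_of_inv_eq (F := E [×i]→L[ℝ] F) ν hμ hp hn hpr hr
    refine ⟨C * ∑ i ∈ range (s + 1), D i * 2, fun f hf hf' ↦ (hC f hf hf').trans ?_⟩
    rw [ENNReal.coe_mul, mul_assoc, ENNReal.ofNNReal_finsetSum, sum_mul]
    gcongr with i hi
    refine (hD i _ (hf.iteratedFDeriv_right (by exact_mod_cast le_top))
      (hf'.iteratedFDeriv i)).trans ?_
    rw [weightedLpNorm_congr_norm ν μ p (g := iteratedFDeriv ℝ (i + 1) f)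
      fun x ↦ norm_fderiv_iteratedFDeriv, ENNReal.coe_mul, mul_assoc]
    have hi' := mem_range.1 hi
    have hle (j : ℕ) (hj : j < s + 1 + 1) : weightedLpNorm ν μ p (iteratedFDeriv ℝ j f)
        ≤ ∑ i ∈ range (s + 1 + 1), weightedLpNorm ν μ p (iteratedFDeriv ℝ i f) :=
      single_le_sum (f := fun i ↦ weightedLpNorm ν μ p (iteratedFDeriv ℝ i f))
        (fun _ _ ↦ zero_le) (mem_range.2 hj)
    gcongr
    rw [ENNReal.coe_ofNat, two_mul]
    exact add_le_add (hle _ (by lia)) (hle _ (by lia))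

end WeightedNorm

theorem stmt1 (n : ℕ) (hn : 1 ≤ n) (μ : ℝ) (hμ : 2 ≤ μ)
    (s : ℕ) (hs : 1 ≤ s) (p : ℝ) (hp : 1 ≤ p)
    (hsp : (s : ℝ) * p < n) (q : ℝ) (hq : q = (n : ℝ) * p / ((n : ℝ) - (s : ℝ) * p)) :
    ∃ C > 0, ∀ u : EuclideanSpace ℝ (Fin n) → ℝ,
      ContDiff ℝ (⊤ : ℕ∞) u → HasCompactSupport u →
      (∫ x, |u x| ^ q * (1 + ‖x‖ ^ 2) ^ μ) ^ (1 / q) ≤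
        C * ∑ i ∈ Finset.range (s + 1),
          (∫ x, ‖iteratedFDeriv ℝ i u x‖ ^ p * (1 + ‖x‖ ^ 2) ^ μ) ^ (1 / p) := by
  have hn0 : (0 : ℝ) < n := by exact_mod_cast hn
  have hp0 : 0 < p := by linarith
  have hd : 0 < (n : ℝ) - s * p := by linarith
  have hq0 : 0 < q := by rw [hq]; positivity
  lift p to ℝ≥0 using hp0.le
  lift q to ℝ≥0 using hq0.le
  obtain ⟨C, hC⟩ := weightedLpNorm_le_sum_iteratedFDeriv (E := EuclideanSpace ℝ (Fin n)) (F := ℝ)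
    volume (μ := μ) (by linarith) (by rw [finrank_euclideanSpace_fin]; lia) s (p := p) (q := q) (by exact_mod_cast hp)
    (by rw [finrank_euclideanSpace_fin, ← one_div, div_lt_div_iff₀ hn0 hp0]; linarith)
    (by rw [finrank_euclideanSpace_fin, hq]; field_simp)
  refine ⟨C + 1, by positivity, fun u hu hu' ↦ ?_⟩
  have hnonneg (i : ℕ) : 0 ≤ (∫ x, ‖iteratedFDeriv ℝ i u x‖ ^ (p : ℝ) * (1 + ‖x‖ ^ 2) ^ μ)
      ^ (1 / (p : ℝ)) := by positivity
  have h := hC u hu hu'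
  rw [weightedLpNorm_eq_ofReal_integral _ _ (by exact_mod_cast hq0) hu.continuous hu',
    sum_congr rfl fun i _ ↦ weightedLpNorm_eq_ofReal_integral _ μ (by exact_mod_cast hp0)
      (hu.continuous_iteratedFDeriv (by exact_mod_cast le_top)) (hu'.iteratedFDeriv i),
    ← ENNReal.ofReal_sum_of_nonneg fun i _ ↦ hnonneg i, ← ENNReal.ofReal_coe_nnreal,
    ← ENNReal.ofReal_mul C.coe_nonneg,
    ENNReal.ofReal_le_ofReal_iff (mul_nonneg C.coe_nonneg (sum_nonneg fun i _ ↦ hnonneg i))] at h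
  refine h.trans ?_
  exact mul_le_mul_of_nonneg_right (by linarith) (sum_nonneg fun i _ ↦ hnonneg i)
end

section
/- Let Ω ⊆ ℝ³ be an open set, μ ≥ 2 a real number, and w(x) = (1+|x|²)^μ. Let (u_m) be a sequence of continuously differentiable functions on ℝ³, each with compact support contained in Ω, satisfying ∫_Ω (|u_m|² + |∇u_m|²) w dx ≤ 1 for all m. Then for every real number q with 1 ≤ q < 6 there is a subsequence of (u_m) that converges in L^q(Ω). -/
open MeasureTheory Filter
open scoped ENNReal Topology

theorem enorm_translate_sub_le {E : Type*} [NormedAddCommGroup E] [NormedSpace ℝ E] {u : E → ℝ}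
    (hu : ContDiff ℝ 1 u) (x h : E) :
    ‖u (x + h) - u x‖ₑ ≤ ‖h‖ₑ * ∫⁻ t in Set.Ioc (0 : ℝ) 1, ‖fderiv ℝ u (x + t • h)‖ₑ := by
  have hd : ∀ t : ℝ, HasDerivAt (fun t : ℝ => u (x + t • h)) (fderiv ℝ u (x + t • h) h) t := by
    intro t
    have h1 : HasDerivAt (fun t : ℝ => x + t • h) h t := by
      simpa using ((hasDerivAt_id t).smul_const h).const_add x
    exact ((hu.differentiable one_ne_zero _).hasFDerivAt).comp_hasDerivAt t h1
  have hc : Continuous (fun t : ℝ => fderiv ℝ u (x + t • h) h) := by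
    have := hu.continuous_fderiv one_ne_zero
    fun_prop
  have key := intervalIntegral.integral_eq_sub_of_hasDerivAt (fun t _ => hd t)
    (hc.intervalIntegrable 0 1)
  simp only [one_smul, zero_smul, add_zero] at key
  rw [← key, intervalIntegral.integral_of_le zero_le_one]
  refine (enorm_integral_le_lintegral_enorm _).trans ?_
  rw [← lintegral_const_mul' _ _ enorm_ne_top]
  refine lintegral_mono fun t => ?_
  rw [mul_comm]
  exact ContinuousLinearMap.le_opENorm _ _

section
variable {E : Type*} [NormedAddCommGroup E] [NormedSpace ℝ E] [FiniteDimensional ℝ E]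
  [MeasurableSpace E] [BorelSpace E] (ν : Measure E) [ν.IsAddHaarMeasure]

theorem lintegral_enorm_translate_sub_le {u : E → ℝ} (hu : ContDiff ℝ 1 u) (h : E) :
    ∫⁻ x, ‖u (x + h) - u x‖ₑ ∂ν ≤ ‖h‖ₑ * ∫⁻ x, ‖fderiv ℝ u x‖ₑ ∂ν := by
  have hc := hu.continuous_fderiv one_ne_zero
  calc ∫⁻ x, ‖u (x + h) - u x‖ₑ ∂ν
      ≤ ∫⁻ x, ‖h‖ₑ * (∫⁻ t in Set.Ioc (0 : ℝ) 1, ‖fderiv ℝ u (x + t • h)‖ₑ) ∂ν :=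
        lintegral_mono fun x => enorm_translate_sub_le hu x h
    _ = ‖h‖ₑ * ∫⁻ t in Set.Ioc (0 : ℝ) 1, (∫⁻ x, ‖fderiv ℝ u (x + t • h)‖ₑ ∂ν) := by
        have hm : Continuous fun p : E × ℝ => ‖fderiv ℝ u (p.1 + p.2 • h)‖ₑ := by fun_prop
        rw [lintegral_const_mul' _ _ enorm_ne_top]
        exact congrArg _ (lintegral_lintegral_swap hm.aemeasurable)
    _ = ‖h‖ₑ * ∫⁻ x, ‖fderiv ℝ u x‖ₑ ∂ν := by
        congr 1
        simp_rw [fun t : ℝ => lintegral_add_right_eq_self (μ := ν)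
          (fun x => ‖fderiv ℝ u x‖ₑ) (t • h)]
        simp

/-- Averaging over balls of radius `r` moves a `C¹` function by at most `r ‖∇u‖₁` in `L¹`. -/
theorem lintegral_enorm_sub_ballAverage_le {u : E → ℝ} (hu : ContDiff ℝ 1 u) {r : ℝ} (hr : 0 < r) :
    ∫⁻ x, ‖u x - ⨍ h in Metric.ball 0 r, u (x + h) ∂ν‖ₑ ∂ν
      ≤ ENNReal.ofReal r * ∫⁻ x, ‖fderiv ℝ u x‖ₑ ∂ν := by
  have hc := hu.continuous
  have h0 : ν (Metric.ball 0 r) ≠ 0 := (Metric.measure_ball_pos ν 0 hr).ne'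
  have ht : ν (Metric.ball 0 r) ≠ ∞ := measure_ball_lt_top.ne
  have hpt : ∀ x, ‖u x - ⨍ h in Metric.ball 0 r, u (x + h) ∂ν‖ₑ
      ≤ (ν (Metric.ball 0 r))⁻¹ * ∫⁻ h in Metric.ball 0 r, ‖u (x + h) - u x‖ₑ ∂ν := by
    intro x
    have hi : IntegrableOn (fun h => u (x + h)) (Metric.ball 0 r) ν :=
      ((Continuous.continuousOn (by fun_prop)).integrableOn_compact
        (isCompact_closedBall (0 : E) r)).mono_set Metric.ball_subset_closedBall
    have e : u x - ⨍ h in Metric.ball 0 r, u (x + h) ∂ν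
        = - ⨍ h in Metric.ball 0 r, (u (x + h) - u x) ∂ν := by
      have hm : ν.real (Metric.ball 0 r) ≠ 0 := by
        simp [Measure.real, ENNReal.toReal_eq_zero_iff, h0, ht]
      rw [setAverage_eq, setAverage_eq,
        integral_sub hi (integrableOn_const ht)]
      simp
      field_simp
      ring
    rw [e, enorm_neg, setAverage_eq, enorm_smul]
    gcongr
    · rw [enorm_inv (by simp [Measure.real, ENNReal.toReal_eq_zero_iff, h0, ht]),
        Measure.real, Real.enorm_of_nonneg ENNReal.toReal_nonneg, ENNReal.ofReal_toReal ht]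
    · exact enorm_integral_le_lintegral_enorm _
  calc _ ≤ ∫⁻ x, (ν (Metric.ball 0 r))⁻¹ *
          ∫⁻ h in Metric.ball 0 r, ‖u (x + h) - u x‖ₑ ∂ν ∂ν := lintegral_mono hpt
    _ = (ν (Metric.ball 0 r))⁻¹ *
          ∫⁻ h in Metric.ball 0 r, ∫⁻ x, ‖u (x + h) - u x‖ₑ ∂ν ∂ν := by
        have hm : Continuous fun p : E × E => ‖u (p.1 + p.2) - u p.1‖ₑ := by fun_prop
        rw [lintegral_const_mul' _ _ (by simp [h0])]
        exact congrArg _ (lintegral_lintegral_swap hm.aemeasurable)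
    _ ≤ (ν (Metric.ball 0 r))⁻¹ *
          ∫⁻ h in Metric.ball 0 r, ENNReal.ofReal r * ∫⁻ x, ‖fderiv ℝ u x‖ₑ ∂ν ∂ν := by
        gcongr (ν (Metric.ball 0 r))⁻¹ * ?_
        refine setLIntegral_mono' (measurableSet_ball (x := (0 : E)) (ε := r)) fun h hh => ?_
        refine (lintegral_enorm_translate_sub_le ν hu h).trans ?_
        gcongr
        rw [← ofReal_norm]
        exact ENNReal.ofReal_le_ofReal (mem_ball_zero_iff.1 hh).le
    _ = _ := by
        rw [setLIntegral_const, mul_comm, mul_assoc, ENNReal.mul_inv_cancel h0 ht, mul_one]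
end

section
variable {α : Type*} [MeasurableSpace α] {ν : Measure α}

/-- Interpolation of the `L^q` norm between `L¹` and `L^r`. -/
theorem lintegral_rpow_le_of_interpolation {f : α → ℝ≥0∞} (hf : AEMeasurable f ν)
    {q r : ℝ} (hq : 1 ≤ q) (hqr : q ≤ r) (hr : 1 < r) :
    ∫⁻ x, f x ^ q ∂ν ≤
      (∫⁻ x, f x ∂ν) ^ ((r - q) / (r - 1)) * (∫⁻ x, f x ^ r ∂ν) ^ ((q - 1) / (r - 1)) := by
  have hr' : 0 < r - 1 := by linarith
  have ha : 0 ≤ (r - q) / (r - 1) := div_nonneg (by linarith) hr'.le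
  have hb : 0 ≤ (q - 1) / (r - 1) := div_nonneg (by linarith) hr'.le
  refine le_trans (le_of_eq ?_) (ENNReal.lintegral_mul_norm_pow_le hf (hf.pow_const r)
    ha hb (by field_simp; ring))
  refine lintegral_congr fun x => ?_
  rw [← ENNReal.rpow_mul, ← ENNReal.rpow_add_of_nonneg _ _ ha (by positivity)]
  congr 1
  field_simp
  ring

theorem setLIntegral_le_of_weight {f W : α → ℝ≥0∞} (hf : AEMeasurable f ν) (hW : AEMeasurable W ν)
    (h0 : ∀ x, W x ≠ 0) (ht : ∀ x, W x ≠ ∞) (s : Set α) :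
    ∫⁻ x in s, f x ∂ν ≤
      (∫⁻ x, f x ^ 2 * W x ∂ν) ^ (1 / 2 : ℝ) * (∫⁻ x in s, (W x)⁻¹ ∂ν) ^ (1 / 2 : ℝ) := by
  calc ∫⁻ x in s, f x ∂ν
      = ∫⁻ x in s, (f x ^ 2 * W x) ^ (1 / 2 : ℝ) * ((W x)⁻¹) ^ (1 / 2 : ℝ) ∂ν := by
        refine lintegral_congr fun x => ?_
        rw [← ENNReal.mul_rpow_of_nonneg _ _ (by norm_num), mul_assoc,
          ENNReal.mul_inv_cancel (h0 x) (ht x), mul_one, ← ENNReal.rpow_natCast,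
          ← ENNReal.rpow_mul]
        norm_num
    _ ≤ (∫⁻ x in s, f x ^ 2 * W x ∂ν) ^ (1 / 2 : ℝ) * (∫⁻ x in s, (W x)⁻¹ ∂ν) ^ (1 / 2 : ℝ) :=
        ENNReal.lintegral_mul_norm_pow_le (((hf.pow_const 2).mul hW).restrict)
          hW.inv.restrict (by norm_num) (by norm_num) (by norm_num)
    _ ≤ _ := by
        gcongr
        exact Measure.restrict_le_self
end

section
variable {α : Type*} [MeasurableSpace α] {ν : Measure α} [IsSeparable ν]

/-- Weak sequential compactness of balls of `L²`, tested against indicators. -/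
theorem exists_subseq_tendsto_setIntegral {u : ℕ → α → ℝ} (hu : ∀ m, MemLp (u m) 2 ν) (C : ℝ)
    (hC : ∀ m, eLpNorm (u m) 2 ν ≤ ENNReal.ofReal C) :
    ∃ φ : ℕ → ℕ, StrictMono φ ∧ ∀ s, MeasurableSet s → ν s ≠ ∞ →
      ∃ l, Tendsto (fun m => ∫ x in s, u (φ m) x ∂ν) atTop (𝓝 l) := by
  have : Fact ((2 : ℝ≥0∞) ≠ ∞) := ⟨ENNReal.ofNat_ne_top⟩
  have hC0 : ∀ m, ‖(hu m).toLp‖ ≤ max C 0 := fun m => by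
    rw [Lp.norm_toLp]
    refine ENNReal.toReal_le_of_le_ofReal (le_max_right _ _) ((hC m).trans ?_)
    exact ENNReal.ofReal_le_ofReal (le_max_left _ _)
  let T : ℕ → WeakDual ℝ (Lp ℝ 2 ν) := fun m =>
    StrongDual.toWeakDual (InnerProductSpace.toDual ℝ (Lp ℝ 2 ν) (hu m).toLp)
  obtain ⟨a, -, φ, hφ, hlim⟩ := WeakDual.isSeqCompact_closedBall ℝ (Lp ℝ 2 ν) 0 (max C 0)
    (x := T) (fun m => by
      simp only [Set.mem_preimage, mem_closedBall_zero_iff]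
      simpa [T] using hC0 m)
  refine ⟨φ, hφ, fun s hs hνs => ⟨a (indicatorConstLp 2 hs hνs 1), ?_⟩⟩
  have := ((WeakDual.eval_continuous (indicatorConstLp 2 hs hνs (1 : ℝ))).tendsto a).comp hlim
  refine this.congr fun m => ?_
  have e : T (φ m) (indicatorConstLp 2 hs hνs (1 : ℝ))
      = inner ℝ (indicatorConstLp 2 hs hνs (1 : ℝ)) (hu (φ m)).toLp := by
    rw [real_inner_comm]; rfl
  refine e.trans ?_
  rw [L2.inner_indicatorConstLp_one]
  exact setIntegral_congr_ae hs ((hu (φ m)).coeFn_toLp.mono fun x hx _ => hx)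
end

theorem setIntegral_ball_translate {E : Type*} [NormedAddCommGroup E] [MeasurableSpace E]
    [BorelSpace E] (ν : Measure E) [ν.IsAddLeftInvariant] (u : E → ℝ) (x : E)
    (r : ℝ) : ∫ h in Metric.ball 0 r, u (x + h) ∂ν = ∫ y in Metric.ball x r, u y ∂ν := by
  have := (measurePreserving_add_left ν x).setIntegral_preimage_emb
    (MeasurableEquiv.addLeft x).measurableEmbedding u (Metric.ball x r)
  rw [← this]
  simp

section
variable {E : Type*} [NormedAddCommGroup E] [NormedSpace ℝ E] [FiniteDimensional ℝ E]
  [MeasurableSpace E] [BorelSpace E] (ν : Measure E) [ν.IsAddHaarMeasure]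

/-- A tight sequence of `C¹` functions, bounded in `L²` and with values and gradients bounded in
`L¹`, has a subsequence that is Cauchy in `L¹`. -/
theorem exists_subseq_cauchy_lintegral {u : ℕ → E → ℝ} (hu : ∀ m, ContDiff ℝ 1 (u m))
    (hu2 : ∀ m, MemLp (u m) 2 ν) (C : ℝ) (hC : ∀ m, eLpNorm (u m) 2 ν ≤ ENNReal.ofReal C)
    {K : ℝ≥0∞} (hK : K ≠ ∞) (h1 : ∀ m, ∫⁻ x, ‖u m x‖ₑ ∂ν ≤ K)
    (hD : ∀ m, ∫⁻ x, ‖fderiv ℝ (u m) x‖ₑ ∂ν ≤ K)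
    (htight : ∀ ε : ℝ≥0∞, 0 < ε → ∃ R : ℝ, ∀ m, ∫⁻ x in (Metric.ball 0 R)ᶜ, ‖u m x‖ₑ ∂ν ≤ ε) :
    ∃ φ : ℕ → ℕ, StrictMono φ ∧
      Tendsto (fun n : ℕ × ℕ => ∫⁻ x, ‖u (φ n.1) x - u (φ n.2) x‖ₑ ∂ν) atTop (𝓝 0) := by
  obtain ⟨φ, hφ, hlim⟩ := exists_subseq_tendsto_setIntegral hu2 C hC
  refine ⟨φ, hφ, ENNReal.tendsto_nhds_zero.2 fun ε hε => ?_⟩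
  have hδ : 0 < ε / 6 := ENNReal.div_pos hε.ne' (by simp)
  obtain ⟨R, hR⟩ := htight _ hδ
  obtain ⟨r, hr, hrK⟩ : ∃ r : ℝ, 0 < r ∧ ENNReal.ofReal r * K ≤ ε / 6 := by
    obtain ⟨t, ht, htK⟩ := ENNReal.exists_nnreal_pos_mul_lt hK hδ.ne'
    exact ⟨t, by exact_mod_cast ht, by simpa using htK.le⟩
  set A : ℕ → E → ℝ := fun m x => ⨍ h in Metric.ball 0 r, u (φ m) (x + h) ∂ν with hA
  have hAeq : ∀ m x, A m x
      = (ν.real (Metric.ball 0 r))⁻¹ * ∫ y in Metric.ball x r, u (φ m) y ∂ν := fun m x => by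
    simp only [hA, setAverage_eq, setIntegral_ball_translate, smul_eq_mul]
  have hAm : ∀ m, Measurable (A m) := fun m => by
    have hc := (hu (φ m)).continuous
    have hm : Continuous fun p : E × E => u (φ m) (p.1 + p.2) := by fun_prop
    have := (hm.stronglyMeasurable.integral_prod_right'
      (ν := ν.restrict (Metric.ball 0 r))).measurable
    simp only [hA, setAverage_eq, smul_eq_mul]
    exact this.const_mul _
  have hAb : ∀ m x, ‖A m x‖ ≤ (ν.real (Metric.ball 0 r))⁻¹ * K.toReal := fun m x => by
    rw [hAeq, norm_mul, Real.norm_of_nonneg (by positivity)]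
    gcongr
    rw [← toReal_enorm]
    refine ENNReal.toReal_mono hK ((enorm_integral_le_lintegral_enorm _).trans ?_)
    exact (setLIntegral_le_lintegral _ _).trans (h1 _)
  choose l hl using fun x : E =>
    hlim (Metric.ball x r) measurableSet_ball measure_ball_lt_top.ne
  set a : E → ℝ := fun x => (ν.real (Metric.ball 0 r))⁻¹ * l x
  have hAlim : ∀ x, Tendsto (fun m => A m x) atTop (𝓝 (a x)) := fun x => by
    simp only [hAeq]
    exact (hl x).const_mul _
  have ham : Measurable a := measurable_of_tendsto_metrizable hAm (tendsto_pi_nhds.2 hAlim)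
  have hdom := tendsto_lintegral_norm_of_dominated_convergence
    (μ := ν.restrict (Metric.ball 0 R)) (F := A) (f := a)
    (bound := fun _ => (ν.real (Metric.ball 0 r))⁻¹ * K.toReal)
    (fun m => (hAm m).aestronglyMeasurable)
    (integrableOn_const measure_ball_lt_top.ne).hasFiniteIntegral
    (fun m => .of_forall (hAb m)) (.of_forall hAlim)
  simp only [ofReal_norm] at hdom
  have hN := ENNReal.tendsto_nhds_zero.1 hdom _ hδ
  have havg : ∀ m, ∫⁻ x in Metric.ball 0 R, ‖u (φ m) x - A m x‖ₑ ∂ν ≤ ε / 6 := fun m =>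
    (setLIntegral_le_lintegral _ _).trans <|
      (lintegral_enorm_sub_ballAverage_le ν (hu (φ m)) hr).trans <|
        (mul_le_mul_right (hD _) _).trans hrK
  have hum : ∀ m, Measurable (u (φ m)) := fun m => (hu _).continuous.measurable
  have hin : ∀ m, ∫⁻ x in Metric.ball 0 R, ‖A m x - a x‖ₑ ∂ν ≤ ε / 6 →
      ∫⁻ x in Metric.ball 0 R, ‖u (φ m) x - a x‖ₑ ∂ν ≤ ε / 6 + ε / 6 := fun m hm => by
    calc ∫⁻ x in Metric.ball 0 R, ‖u (φ m) x - a x‖ₑ ∂ν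
        ≤ ∫⁻ x in Metric.ball 0 R, (‖u (φ m) x - A m x‖ₑ + ‖A m x - a x‖ₑ) ∂ν := by
          refine lintegral_mono fun x => ?_
          rw [← sub_add_sub_cancel (u (φ m) x) (A m x) (a x)]
          exact enorm_add_le _ _
      _ ≤ _ := by
          have h' : Measurable fun x => ‖u (φ m) x - A m x‖ₑ := ((hum m).sub (hAm m)).enorm
          rw [lintegral_add_left h']
          exact add_le_add (havg m) hm
  have hmono : ∀ s : Set E, ∀ b : E → ℝ, Measurable b → ∀ m n,
      ∫⁻ x in s, ‖u (φ m) x - u (φ n) x‖ₑ ∂ν ≤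
        ∫⁻ x in s, ‖u (φ m) x - b x‖ₑ ∂ν + ∫⁻ x in s, ‖u (φ n) x - b x‖ₑ ∂ν := by
    intro s b hb m n
    have h' : Measurable fun x => ‖u (φ m) x - b x‖ₑ := ((hum m).sub hb).enorm
    rw [← lintegral_add_left h']
    refine lintegral_mono fun x => ?_
    rw [← sub_sub_sub_cancel_right (u (φ m) x) (u (φ n) x) (b x)]
    exact enorm_sub_le
  rw [← prod_atTop_atTop_eq]
  filter_upwards [hN.prod_mk hN] with ⟨m, n⟩ ⟨hm, hn⟩
  rw [← lintegral_add_compl _ (measurableSet_ball (x := (0 : E)) (ε := R))]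
  calc _ ≤ ((ε / 6 + ε / 6) + (ε / 6 + ε / 6)) + (ε / 6 + ε / 6) := by
        refine add_le_add ((hmono _ a ham m n).trans (add_le_add (hin m hm) (hin n hn))) ?_
        refine (hmono _ 0 measurable_const m n).trans ?_
        simpa using add_le_add (hR (φ m)) (hR (φ n))
    _ = 6 * (ε / 6) := by ring
    _ = ε := ENNReal.mul_div_cancel (by simp) (by simp)

end

section
variable {α : Type*} [MeasurableSpace α] {ν : Measure α}

theorem exists_tendsto_eLpNorm_of_cauchy {p : ℝ≥0∞} (hp : 1 ≤ p) {v : ℕ → α → ℝ}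
    (hv : ∀ m, MemLp (v m) p ν)
    (hc : Tendsto (fun n : ℕ × ℕ => eLpNorm (v n.1 - v n.2) p ν) atTop (𝓝 0)) :
    ∃ f : α → ℝ, Tendsto (fun m => eLpNorm (v m - f) p ν) atTop (𝓝 0) := by
  have : Fact (1 ≤ p) := ⟨hp⟩
  have hcauchy : CauchySeq fun m => (hv m).toLp := by
    rw [Lp.cauchySeq_Lp_iff_cauchySeq_eLpNorm]
    refine hc.congr fun n => eLpNorm_congr_ae ?_
    exact ((hv n.1).coeFn_toLp.sub (hv n.2).coeFn_toLp).symm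
  obtain ⟨f, hf⟩ := cauchySeq_tendsto_of_complete hcauchy
  refine ⟨f, ((Lp.tendsto_Lp_iff_tendsto_eLpNorm' _ _).1 hf).congr fun m => ?_⟩
  exact eLpNorm_congr_ae ((hv m).coeFn_toLp.sub EventuallyEq.rfl)

theorem tendsto_eLpNorm_of_tendsto_lintegral {ι : Type*} {l : Filter ι} {v : ι → α → ℝ}
    (hv : ∀ i, AEStronglyMeasurable (v i) ν) {q r : ℝ} (hq : 1 ≤ q) (hqr : q < r)
    {M : ℝ≥0∞} (hM : M ≠ ∞) (hvM : ∀ i, eLpNorm (v i) (ENNReal.ofReal r) ν ≤ M)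
    (h : Tendsto (fun i => ∫⁻ x, ‖v i x‖ₑ ∂ν) l (𝓝 0)) :
    Tendsto (fun i => eLpNorm (v i) (ENNReal.ofReal q) ν) l (𝓝 0) := by
  have hq0 : 0 < q := by linarith
  have hr0 : 0 < r := by linarith
  have ha : 0 < (r - q) / (r - 1) := div_pos (by linarith) (by linarith)
  have hb : 0 ≤ (q - 1) / (r - 1) := div_nonneg (by linarith) (by linarith)
  have key : ∀ i, eLpNorm (v i) (ENNReal.ofReal q) ν ≤
      ((∫⁻ x, ‖v i x‖ₑ ∂ν) ^ ((r - q) / (r - 1)) * (M ^ r) ^ ((q - 1) / (r - 1))) ^ (1 / q) := by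
    intro i
    rw [eLpNorm_eq_lintegral_rpow_enorm_toReal (by simpa using hq0) ENNReal.ofReal_ne_top,
      ENNReal.toReal_ofReal hq0.le]
    gcongr
    refine (lintegral_rpow_le_of_interpolation (hv i).enorm hq hqr.le (by linarith)).trans ?_
    gcongr
    have := hvM i
    rw [eLpNorm_eq_lintegral_rpow_enorm_toReal (by simpa using hr0) ENNReal.ofReal_ne_top,
      ENNReal.toReal_ofReal hr0.le] at this
    rwa [one_div, ENNReal.rpow_inv_le_iff hr0] at this
  refine tendsto_of_tendsto_of_tendsto_of_le_of_le tendsto_const_nhds ?_ (fun _ => zero_le) key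
  have h1 := h.ennrpow_const ((r - q) / (r - 1))
  rw [ENNReal.zero_rpow_of_pos ha] at h1
  have h2 := ENNReal.Tendsto.mul_const (b := (M ^ r) ^ ((q - 1) / (r - 1))) h1
    (Or.inr (ENNReal.rpow_ne_top_of_nonneg hb (ENNReal.rpow_ne_top_of_nonneg hr0.le hM)))
  rw [zero_mul] at h2
  have h3 := h2.ennrpow_const (1 / q)
  rwa [ENNReal.zero_rpow_of_pos (by positivity)] at h3

end

theorem exists_setLIntegral_compl_ball_le {E : Type*} [NormedAddCommGroup E] [MeasurableSpace E]
    [BorelSpace E] (ν : Measure E) {g : E → ℝ≥0∞} (hg : Measurable g)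
    (hg' : ∫⁻ x, g x ∂ν ≠ ∞) {ε : ℝ≥0∞} (hε : 0 < ε) :
    ∃ R : ℝ, ∫⁻ x in (Metric.ball 0 R)ᶜ, g x ∂ν ≤ ε := by
  have h := tendsto_lintegral_of_dominated_convergence (μ := ν)
    (F := fun n : ℕ => (Metric.ball (0 : E) n)ᶜ.indicator g) (f := fun _ => 0) g
    (fun n => hg.indicator measurableSet_ball.compl)
    (fun n => .of_forall fun x => Set.indicator_le_self _ _ x) hg'
    (.of_forall fun x => by
      refine tendsto_const_nhds.congr' ?_
      obtain ⟨N, hN⟩ := exists_nat_gt ‖x‖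
      filter_upwards [eventually_ge_atTop N] with n hn
      have : ‖x‖ < n := hN.trans_le (by exact_mod_cast hn)
      simp [this])
  rw [lintegral_zero] at h
  obtain ⟨n, hn⟩ := (ENNReal.tendsto_nhds_zero.1 h ε hε).exists
  exact ⟨n, by rwa [lintegral_indicator measurableSet_ball.compl] at hn⟩

theorem lintegral_inv_weight_lt_top {E : Type*} [NormedAddCommGroup E] [NormedSpace ℝ E]
    [FiniteDimensional ℝ E] [MeasurableSpace E] [BorelSpace E] (ν : Measure E)
    [ν.IsAddHaarMeasure] {s : ℝ}
    (hs : (Module.finrank ℝ E : ℝ) < 2 * s) :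
    ∫⁻ x : E, (ENNReal.ofReal ((1 + ‖x‖ ^ 2) ^ s))⁻¹ ∂ν < ∞ := by
  have h := (integrable_rpow_neg_one_add_norm_sq (μ := ν) hs).lintegral_lt_top
  refine lt_of_le_of_lt (le_of_eq (lintegral_congr fun x => ?_)) h
  rw [← ENNReal.ofReal_inv_of_pos (by positivity), ← Real.rpow_neg (by positivity)]
  congr 2
  ring

theorem lintegral_weighted_le_of_setIntegral_le {E : Type*} [NormedAddCommGroup E]
    [NormedSpace ℝ E] [MeasurableSpace E] [BorelSpace E] (ν : Measure E)
    [IsFiniteMeasureOnCompacts ν]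
    {Ω : Set E} {u : E → ℝ} (hu : ContDiff ℝ 1 u) (hc : HasCompactSupport u) (hΩ : tsupport u ⊆ Ω)
    {μ : ℝ} {B : ℝ}
    (h : ∫ x in Ω, (|u x| ^ 2 + ‖fderiv ℝ u x‖ ^ 2) * (1 + ‖x‖ ^ 2) ^ μ ∂ν ≤ B) :
    ∫⁻ x, (‖u x‖ₑ ^ 2 + ‖fderiv ℝ u x‖ₑ ^ 2) * ENNReal.ofReal ((1 + ‖x‖ ^ 2) ^ μ) ∂ν
      ≤ ENNReal.ofReal B := by
  set g : E → ℝ := fun x => (|u x| ^ 2 + ‖fderiv ℝ u x‖ ^ 2) * (1 + ‖x‖ ^ 2) ^ μ with hg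
  have hzero : ∀ x, x ∉ tsupport u → g x = 0 := fun x hx => by
    have h1 : u x = 0 := image_eq_zero_of_notMem_tsupport hx
    have h2 : fderiv ℝ u x = 0 := by
      by_contra hne
      exact hx (support_fderiv_subset ℝ (Function.mem_support.2 hne))
    simp [hg, h1, h2]
  have hgc : Continuous g := by
    have h1 := hu.continuous
    have h2 := hu.continuous_fderiv one_ne_zero
    have h3 : Continuous fun x : E => (1 + ‖x‖ ^ 2 : ℝ) ^ μ :=
      Continuous.rpow_const (by fun_prop) fun x => Or.inl (by positivity)
    fun_prop
  have hgi : Integrable g ν := hgc.integrable_of_hasCompactSupport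
    (HasCompactSupport.intro hc hzero)
  rw [setIntegral_eq_integral_of_forall_compl_eq_zero
    (fun x hx => hzero x fun hx' => hx (hΩ hx'))] at h
  refine le_trans (le_of_eq ?_) (ENNReal.ofReal_le_ofReal h)
  rw [ofReal_integral_eq_lintegral_ofReal hgi (.of_forall fun x => by positivity)]
  refine lintegral_congr fun x => ?_
  rw [hg, ENNReal.ofReal_mul (by positivity), ENNReal.ofReal_add (by positivity) (by positivity),
    ENNReal.ofReal_pow (abs_nonneg _), ENNReal.ofReal_pow (norm_nonneg _), ofReal_norm,
    ← Real.norm_eq_abs, ofReal_norm]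

theorem eLpNorm_two_le_one_of_lintegral_weight_le {α F : Type*} [MeasurableSpace α]
    [NormedAddCommGroup F] {ν : Measure α} {f : α → F} {W : α → ℝ≥0∞} (hW : ∀ x, 1 ≤ W x)
    (h : ∫⁻ x, ‖f x‖ₑ ^ 2 * W x ∂ν ≤ 1) : eLpNorm f 2 ν ≤ 1 := by
  rw [eLpNorm_eq_lintegral_rpow_enorm_toReal two_ne_zero ENNReal.ofNat_ne_top]
  refine ENNReal.rpow_le_one (le_trans (lintegral_mono fun x => ?_) h) (by norm_num)
  simpa using mul_le_mul_right (hW x) (‖f x‖ₑ ^ 2)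

theorem stmt2 (Ω : Set (EuclideanSpace ℝ (Fin 3))) (hΩ : IsOpen Ω)
    (μ : ℝ) (hμ : 2 ≤ μ)
    (u : ℕ → EuclideanSpace ℝ (Fin 3) → ℝ)
    (hC1 : ∀ m, ContDiff ℝ 1 (u m))
    (hsupp : ∀ m, HasCompactSupport (u m))
    (hsuppΩ : ∀ m, tsupport (u m) ⊆ Ω)
    (hbd : ∀ m, ∫ x in Ω, (|u m x| ^ 2 + ‖fderiv ℝ (u m) x‖ ^ 2) * (1 + ‖x‖ ^ 2) ^ μ ≤ 1) :
    ∀ q : ℝ, 1 ≤ q → q < 6 →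
      ∃ φ : ℕ → ℕ, StrictMono φ ∧
        ∃ f : EuclideanSpace ℝ (Fin 3) → ℝ,
          Tendsto (fun m => eLpNorm (u (φ m) - f) (ENNReal.ofReal q) (volume.restrict Ω))
            atTop (nhds 0) := by
  intro q hq1 hq6
  set W : EuclideanSpace ℝ (Fin 3) → ℝ≥0∞ := fun x => ENNReal.ofReal ((1 + ‖x‖ ^ 2) ^ μ)
  have hWm : Measurable W := by fun_prop
  have hW1 : ∀ x, 1 ≤ W x := fun x =>
    ENNReal.one_le_ofReal.2 (Real.one_le_rpow (by nlinarith [norm_nonneg x]) (by linarith))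
  have hW0 : ∀ x, W x ≠ 0 := fun x => (one_pos.trans_le (hW1 x)).ne'
  have hWt : ∀ x, W x ≠ ∞ := fun x => ENNReal.ofReal_ne_top
  have hbd' : ∀ m, ∫⁻ x, (‖u m x‖ₑ ^ 2 + ‖fderiv ℝ (u m) x‖ₑ ^ 2) * W x ≤ 1 := fun m => by
    simpa using lintegral_weighted_le_of_setIntegral_le volume (hC1 m) (hsupp m) (hsuppΩ m) (hbd m)
  have hbu : ∀ m, ∫⁻ x, ‖u m x‖ₑ ^ 2 * W x ≤ 1 := fun m =>
    le_trans (lintegral_mono fun x => by gcongr; exact le_self_add) (hbd' m)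
  have hbD : ∀ m, ∫⁻ x, ‖fderiv ℝ (u m) x‖ₑ ^ 2 * W x ≤ 1 := fun m =>
    le_trans (lintegral_mono fun x => by gcongr; exact le_add_self) (hbd' m)
  have hJ : ∫⁻ x, (W x)⁻¹ ≠ ∞ :=
    (lintegral_inv_weight_lt_top volume (by rw [finrank_euclideanSpace_fin]; push_cast; linarith)).ne
  have hum : ∀ m, Measurable fun x => ‖u m x‖ₑ := fun m => (hC1 m).continuous.measurable.enorm
  have hDm : ∀ m, Measurable fun x => ‖fderiv ℝ (u m) x‖ₑ := fun m =>
    ((hC1 m).continuous_fderiv one_ne_zero).measurable.enorm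
  have hCS : ∀ f : EuclideanSpace ℝ (Fin 3) → ℝ≥0∞, Measurable f → ∫⁻ x, f x ^ 2 * W x ≤ 1 →
      ∀ s, ∫⁻ x in s, f x ≤ (∫⁻ x in s, (W x)⁻¹) ^ (1 / 2 : ℝ) := fun f hf hf1 s =>
    (setLIntegral_le_of_weight hf.aemeasurable hWm.aemeasurable hW0 hWt s).trans <|
      mul_le_of_le_one_left zero_le (ENNReal.rpow_le_one hf1 (by norm_num))
  have hu2 : ∀ m, eLpNorm (u m) 2 volume ≤ ENNReal.ofReal 1 := fun m => by
    simpa using eLpNorm_two_le_one_of_lintegral_weight_le hW1 (hbu m)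
  have hD2 : ∀ m, eLpNorm (fderiv ℝ (u m)) 2 volume ≤ 1 := fun m =>
    eLpNorm_two_le_one_of_lintegral_weight_le hW1 (hbD m)
  have hmem : ∀ p : ℝ≥0∞, ∀ m, MemLp (u m) p volume := fun p m =>
    (hC1 m).continuous.memLp_of_hasCompactSupport (hsupp m)
  obtain ⟨φ, hφ, hL1⟩ := exists_subseq_cauchy_lintegral volume hC1 (hmem 2) 1 hu2
    (ENNReal.rpow_ne_top_of_nonneg (by norm_num : (0 : ℝ) ≤ 1 / 2) hJ)
    (fun m => by simpa using hCS _ (hum m) (hbu m) Set.univ)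
    (fun m => by simpa using hCS _ (hDm m) (hbD m) Set.univ)
    (fun ε hε => by
      obtain ⟨R, hR⟩ := exists_setLIntegral_compl_ball_le volume hWm.inv hJ
        (ε := ε ^ (2 : ℝ)) (by
          rw [pos_iff_ne_zero, Ne, ENNReal.rpow_eq_zero_iff_of_pos two_pos]
          exact hε.ne')
      refine ⟨R, fun m => (hCS _ (hum m) (hbu m) _).trans ?_⟩
      rw [one_div, ENNReal.rpow_inv_le_iff two_pos]
      exact hR)
  set S := SNormLESNormFDerivOfEqConst ℝ (volume : Measure (EuclideanSpace ℝ (Fin 3))) 2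
  have h6 : ∀ m, eLpNorm (u m) (ENNReal.ofReal 6) volume ≤ S := fun m => by
    have h := eLpNorm_le_eLpNorm_fderiv_of_eq volume (hC1 m) (hsupp m) (p := 2) (p' := 6)
      (by norm_num) (by simp) (by simp; norm_num)
    have e : ENNReal.ofReal 6 = ((6 : NNReal) : ℝ≥0∞) := by simp
    rw [e]
    exact h.trans (mul_le_of_le_one_right zero_le (hD2 m))
  have hLq := tendsto_eLpNorm_of_tendsto_lintegral (ν := volume)
    (v := fun n : ℕ × ℕ => u (φ n.1) - u (φ n.2)) (q := q) (r := 6) (M := S + S)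
    (fun n => ((hmem 1 _).sub (hmem 1 _)).1) hq1 hq6 (by simp)
    (fun n => (eLpNorm_sub_le (hmem 1 _).1 (hmem 1 _).1 (by simp)).trans
      (add_le_add (h6 _) (h6 _))) hL1
  obtain ⟨f, hf⟩ := exists_tendsto_eLpNorm_of_cauchy (by simpa using hq1)
    (fun m => hmem (ENNReal.ofReal q) (φ m)) hLq
  exact ⟨φ, hφ, f, tendsto_of_tendsto_of_tendsto_of_le_of_le tendsto_const_nhds hf
    (fun _ => zero_le) fun m => eLpNorm_mono_measure _ Measure.restrict_le_self⟩
end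

section
/- Let n ≥ 2 be an integer, μ ≥ 2 a real number, w(x) = (1+|x|²)^μ, and let H = {x ∈ ℝⁿ : xₙ < 0} be the lower half-space. There is a constant C depending only on n and μ such that for every u ∈ C_c^∞(ℝⁿ): ∫_{ℝ^{n-1}} |u(x',0)|² w(x',0) dx' ≤ C (∫_H |u|² w dx + ∫_H |∇u|² w dx). -/
open MeasureTheory

theorem isClosedEmbedding_prodMk_left {X Y : Type*} [MetricSpace X] [MetricSpace Y]
    [CompleteSpace Y] (x : X) :
    Topology.IsClosedEmbedding (fun y : Y => (x, y)) :=
  (Isometry.of_dist_eq (f := fun y : Y => (x, y)) fun a b => by simp [Prod.dist_eq]).isClosedEmbedding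

theorem isClosedEmbedding_prodMk_right {X Y : Type*} [MetricSpace X] [MetricSpace Y]
    [CompleteSpace X] (y : Y) :
    Topology.IsClosedEmbedding (fun x : X => (x, y)) :=
  (Isometry.of_dist_eq (f := fun x : X => (x, y)) fun a b => by simp [Prod.dist_eq]).isClosedEmbedding

/-- A compactly supported function on the line is controlled at the origin by its weighted `H¹`
norm on the negative half-line, for the weight `(a + t ^ 2) ^ μ`, which decreases there. -/
theorem sq_mul_rpow_le_setIntegral_Iio {v v' G : ℝ → ℝ} {a μ : ℝ} (ha : 0 < a) (hμ : 0 ≤ μ)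
    (hv : ∀ t, HasDerivAt v (v' t) t) (hv' : Continuous v') (hs : HasCompactSupport v)
    (hG : IntegrableOn G (Set.Iio 0))
    (hle : ∀ t, (v t ^ 2 + v' t ^ 2) * (a + t ^ 2) ^ μ ≤ G t) :
    v 0 ^ 2 * a ^ μ ≤ ∫ t in Set.Iio 0, G t := by
  have hpos : ∀ t : ℝ, 0 < a + t ^ 2 := fun t => by positivity
  have hvc : Continuous v := continuous_iff_continuousAt.2 fun t => (hv t).continuousAt
  have hd : ∀ t, HasDerivAt (fun t => v t ^ 2 * (a + t ^ 2) ^ μ)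
      (2 * v t * v' t * (a + t ^ 2) ^ μ + v t ^ 2 * (2 * t * μ * (a + t ^ 2) ^ (μ - 1))) t := by
    intro t
    have hw : HasDerivAt (fun t : ℝ => (a + t ^ 2) ^ μ)
        (2 * t * μ * (a + t ^ 2) ^ (μ - 1)) t := by
      have h := ((hasDerivAt_pow 2 t).const_add a).rpow_const (p := μ) (Or.inl (hpos t).ne')
      simpa using h
    exact (((hv t).pow 2).mul hw).congr_deriv (by simp)
  have hwc : ∀ s : ℝ, Continuous fun t : ℝ => (a + t ^ 2) ^ s := fun s =>
    (by fun_prop : Continuous fun t : ℝ => a + t ^ 2).rpow_const fun t => Or.inl (hpos t).ne'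
  have hC1 : ContDiff ℝ 1 (fun t => v t ^ 2 * (a + t ^ 2) ^ μ) := by
    rw [contDiff_one_iff_deriv]
    refine ⟨fun t => (hd t).differentiableAt, ?_⟩
    rw [funext fun t => (hd t).deriv]
    have := hwc μ
    have := hwc (μ - 1)
    fun_prop
  have hsupp : HasCompactSupport (fun t => v t ^ 2 * (a + t ^ 2) ^ μ) :=
    hs.mono (Function.support_subset_iff'.2 fun t ht => by simp [Function.notMem_support.1 ht])
  have hFTC := hsupp.integral_Iic_deriv_eq hC1 0
  have hint : Integrable (deriv (fun t => v t ^ 2 * (a + t ^ 2) ^ μ)) :=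
    (hC1.continuous_deriv le_rfl).integrable_of_hasCompactSupport hsupp.deriv
  rw [setIntegral_congr_set Iio_ae_eq_Iic.symm] at hFTC
  have h0 : v 0 ^ 2 * a ^ μ = v 0 ^ 2 * (a + 0 ^ 2) ^ μ := by simp
  rw [h0, ← hFTC]
  refine setIntegral_mono_on hint.integrableOn hG measurableSet_Iio fun t ht => ?_
  rw [(hd t).deriv]
  refine le_trans ?_ (hle t)
  have h1 : 0 < (a + t ^ 2) ^ μ := Real.rpow_pos_of_pos (hpos t) _
  have h2 : 0 < (a + t ^ 2) ^ (μ - 1) := Real.rpow_pos_of_pos (hpos t) _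
  have h3 : v t ^ 2 * (2 * t * μ * (a + t ^ 2) ^ (μ - 1)) ≤ 0 := by
    have ht' : t ≤ 0 := (Set.mem_Iio.1 ht).le
    exact mul_nonpos_of_nonneg_of_nonpos (sq_nonneg _)
      (mul_nonpos_of_nonpos_of_nonneg (by nlinarith) h2.le)
  nlinarith [mul_nonneg (sq_nonneg (v t - v' t)) h1.le]

/-- Weighted trace inequality on the half-space `{p : E × ℝ | p.2 < 0}`, with constant `1`. -/
theorem integral_trace_le {E : Type*} [NormedAddCommGroup E] [NormedSpace ℝ E]
    [FiniteDimensional ℝ E] [MeasureSpace E] [BorelSpace E]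
    [(volume : Measure E).IsAddHaarMeasure] {μ : ℝ} (hμ : 0 ≤ μ) {u : E × ℝ → ℝ}
    (hu : ContDiff ℝ 1 u) (hs : HasCompactSupport u) :
    (∫ x' : E, |u (x', 0)| ^ 2 * (1 + ‖x'‖ ^ 2) ^ μ) ≤
      (∫ p in {p : E × ℝ | p.2 < 0}, |u p| ^ 2 * (1 + ‖p.1‖ ^ 2 + p.2 ^ 2) ^ μ) +
        ∫ p in {p : E × ℝ | p.2 < 0}, ‖fderiv ℝ u p‖ ^ 2 * (1 + ‖p.1‖ ^ 2 + p.2 ^ 2) ^ μ := by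
  have : ProperSpace E := FiniteDimensional.proper ℝ E
  have hu' : Continuous (fderiv ℝ u) := hu.continuous_fderiv (by simp)
  have huc : Continuous u := hu.continuous
  have hW : Continuous fun p : E × ℝ => (1 + ‖p.1‖ ^ 2 + p.2 ^ 2) ^ μ :=
    (by fun_prop : Continuous fun p : E × ℝ => 1 + ‖p.1‖ ^ 2 + p.2 ^ 2).rpow_const
      fun p => Or.inl (by positivity)
  have hs₀ : HasCompactSupport fun p : E × ℝ => |u p| ^ 2 * (1 + ‖p.1‖ ^ 2 + p.2 ^ 2) ^ μ :=
    hs.mono (Function.support_subset_iff'.2 fun p hp => by simp [Function.notMem_support.1 hp])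
  have hs₁ : HasCompactSupport fun p : E × ℝ =>
      ‖fderiv ℝ u p‖ ^ 2 * (1 + ‖p.1‖ ^ 2 + p.2 ^ 2) ^ μ :=
    (hs.fderiv ℝ).mono
      (Function.support_subset_iff'.2 fun p hp => by simp [Function.notMem_support.1 hp])
  have hint₀ : Integrable fun p : E × ℝ => |u p| ^ 2 * (1 + ‖p.1‖ ^ 2 + p.2 ^ 2) ^ μ :=
    Continuous.integrable_of_hasCompactSupport (by fun_prop) hs₀
  have hint₁ : Integrable fun p : E × ℝ =>
      ‖fderiv ℝ u p‖ ^ 2 * (1 + ‖p.1‖ ^ 2 + p.2 ^ 2) ^ μ :=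
    Continuous.integrable_of_hasCompactSupport (by fun_prop) hs₁
  rw [← integral_add hint₀.integrableOn hint₁.integrableOn]
  set G : E × ℝ → ℝ := fun p => |u p| ^ 2 * (1 + ‖p.1‖ ^ 2 + p.2 ^ 2) ^ μ +
    ‖fderiv ℝ u p‖ ^ 2 * (1 + ‖p.1‖ ^ 2 + p.2 ^ 2) ^ μ with hGdef
  have hG : Integrable G := hint₀.add hint₁
  have hGc : Continuous G := by fun_prop
  have hGs : HasCompactSupport G := hs₀.add hs₁
  have hset : {p : E × ℝ | p.2 < 0} = Set.univ ×ˢ Set.Iio 0 := by ext; simp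
  have hGi : Integrable G ((volume : Measure E).prod (volume.restrict (Set.Iio (0 : ℝ)))) := by
    have := hG.integrableOn (s := Set.univ ×ˢ Set.Iio (0 : ℝ))
    rwa [IntegrableOn, Measure.volume_eq_prod, ← Measure.prod_restrict,
      Measure.restrict_univ] at this
  have hFub : ∫ p in {p : E × ℝ | p.2 < 0}, G p = ∫ x', ∫ t in Set.Iio 0, G (x', t) := by
    rw [hset, Measure.volume_eq_prod, ← Measure.prod_restrict, Measure.restrict_univ,
      integral_prod _ hGi]
  rw [hFub]
  have hbase : Integrable fun x' : E => |u (x', 0)| ^ 2 * (1 + ‖x'‖ ^ 2) ^ μ := by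
    have hc : Continuous fun x' : E => |u (x', 0)| ^ 2 * (1 + ‖x'‖ ^ 2) ^ μ := by
      have : Continuous fun x' : E => (1 + ‖x'‖ ^ 2) ^ μ :=
        (by fun_prop : Continuous fun x' : E => 1 + ‖x'‖ ^ 2).rpow_const
          fun p => Or.inl (by positivity)
      fun_prop
    exact hc.integrable_of_hasCompactSupport
      ((hs.comp_isClosedEmbedding (isClosedEmbedding_prodMk_right (0 : ℝ))).mono
        (Function.support_subset_iff'.2 fun x hx => by
          have h0 : u (x, 0) = 0 := Function.notMem_support.1 hx
          simp [h0]))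
  refine integral_mono hbase hGi.integral_prod_left fun x' => ?_
  have hemb := isClosedEmbedding_prodMk_left (Y := ℝ) x'
  have hslice : ∀ t, HasDerivAt (fun t => u (x', t)) (fderiv ℝ u (x', t) (0, 1)) t := fun t =>
    ((hu.differentiable (by simp)) (x', t)).hasFDerivAt.comp_hasDerivAt t
      ((hasDerivAt_const t x').prodMk (hasDerivAt_id t))
  simp only [sq_abs]
  refine sq_mul_rpow_le_setIntegral_Iio (v := fun t => u (x', t)) (by positivity)
    hμ hslice (by fun_prop) (hs.comp_isClosedEmbedding hemb)
    ((hGc.comp hemb.continuous).integrable_of_hasCompactSupport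
      (hGs.comp_isClosedEmbedding hemb)).integrableOn fun t => ?_
  have hn1 : |fderiv ℝ u (x', t) (0, 1)| ≤ ‖fderiv ℝ u (x', t)‖ := by
    simpa using (fderiv ℝ u (x', t)).le_opNorm (0, 1)
  have hn2 : fderiv ℝ u (x', t) (0, 1) ^ 2 ≤ ‖fderiv ℝ u (x', t)‖ ^ 2 := by
    rw [← sq_abs]; gcongr
  simp only [hGdef, sq_abs, ← add_mul]
  gcongr

theorem stmt5 (n : ℕ) (hn : 2 ≤ n) (μ : ℝ) (hμ : 2 ≤ μ) :
    ∃ C > 0, ∀ u : (EuclideanSpace ℝ (Fin (n - 1)) × ℝ) → ℝ,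
      ContDiff ℝ (⊤ : ℕ∞) u → HasCompactSupport u →
      (∫ x' : EuclideanSpace ℝ (Fin (n - 1)), |u (x', 0)| ^ 2 * (1 + ‖x'‖ ^ 2) ^ μ) ≤
        C * ((∫ p in {p : EuclideanSpace ℝ (Fin (n - 1)) × ℝ | p.2 < 0},
                |u p| ^ 2 * (1 + ‖p.1‖ ^ 2 + p.2 ^ 2) ^ μ) +
             (∫ p in {p : EuclideanSpace ℝ (Fin (n - 1)) × ℝ | p.2 < 0},
                ‖fderiv ℝ u p‖ ^ 2 * (1 + ‖p.1‖ ^ 2 + p.2 ^ 2) ^ μ)) := by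
  refine ⟨1, one_pos, fun u hu hs => ?_⟩
  rw [one_mul]
  exact integral_trace_le (by linarith) (hu.of_le (by exact_mod_cast le_top)) hs
end

section
/- Let n ≥ 1 and let 0 ≤ l ≤ r be integers with r ≥ 1, and let p, q, s ∈ [1, ∞) be real numbers satisfying r/s = l/p + (r−l)/q. Then there is a constant C depending only on n, r, p and q such that for every u ∈ C_c^∞(ℝⁿ): Σ_{j=0}^{l} ‖∇^j u‖_{L^s(ℝⁿ)} ≤ C ‖u‖_{L^q(ℝⁿ)}^{1−l/r} (Σ_{i=0}^{r} ‖∇^i u‖_{L^p(ℝⁿ)})^{l/r}. -/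
open MeasureTheory Finset

section Line

variable {F : Type*} [NormedAddCommGroup F] [NormedSpace ℝ F]

/-- On an interval of radius `h`, the first derivative is controlled by the mean of the function
and by the integral of the second derivative. -/
theorem norm_deriv_le_integral_add_integral [CompleteSpace F] {f f' f'' : ℝ → F}
    (hf : ∀ x, HasDerivAt f (f' x) x) (hf' : ∀ x, HasDerivAt f' (f'' x) x)
    (hc : Continuous f'') {x h y : ℝ} (hh : 0 < h) (hy : y ∈ Set.Icc (x - h) (x + h)) :
    ‖f' y‖ ≤ 4 / h ^ 2 * (∫ t in (x - h)..(x + h), ‖f t‖) +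
      ∫ t in (x - h)..(x + h), ‖f'' t‖ := by
  have cf : Continuous f := continuous_iff_continuousAt.2 fun x => (hf x).continuousAt
  set G := ∫ t in (x - h)..(x + h), ‖f'' t‖
  set S := ∫ t in (x - h)..(x + h), ‖f t‖
  have exists_small : ∀ a b : ℝ, x - h ≤ a → b ≤ x + h → b - a = h / 2 →
      ∃ c ∈ Set.Ioc a b, ‖f c‖ ≤ 2 / h * S := by
    intro a b ha hb hab
    have hlt : a < b := by linarith
    obtain ⟨c, hc1, hc2⟩ := exists_le_setAverage (μ := volume) (s := Set.Ioc a b)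
      (f := fun t => ‖f t‖) (by simp [hlt]) (by simp)
      ((cf.norm.integrableOn_Icc).mono_set Set.Ioc_subset_Icc_self)
    refine ⟨c, hc1, hc2.trans ?_⟩
    rw [setAverage_eq, Measure.real, Real.volume_Ioc, ENNReal.toReal_ofReal (by linarith), hab,
      smul_eq_mul, ← intervalIntegral.integral_of_le hlt.le]
    have e : (h / 2)⁻¹ = 2 / h := by rw [inv_div]
    rw [e]
    refine mul_le_mul_of_nonneg_left ?_ (by positivity)
    exact intervalIntegral.integral_mono_interval ha hlt.le hb
      (Filter.Eventually.of_forall fun t => norm_nonneg _) (cf.norm.intervalIntegrable _ _)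
  obtain ⟨a, ha, hfa⟩ := exists_small (x - h) (x - h / 2) le_rfl (by linarith) (by ring)
  obtain ⟨b, hb, hfb⟩ := exists_small (x + h / 2) (x + h) (by linarith) le_rfl (by ring)
  obtain ⟨ha1, ha2⟩ := ha
  obtain ⟨hb1, hb2⟩ := hb
  have osc : ∀ t ∈ Set.Icc (x - h) (x + h), ‖f' t - f' y‖ ≤ G := by
    intro t ht
    have key : ∀ u v : ℝ, x - h ≤ u → u ≤ v → v ≤ x + h → ‖f' v - f' u‖ ≤ G := by
      intro u v hu huv hv
      rw [← intervalIntegral.integral_eq_sub_of_hasDerivAt (fun z _ => hf' z)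
        (hc.intervalIntegrable _ _)]
      refine (intervalIntegral.norm_integral_le_integral_norm huv).trans ?_
      exact intervalIntegral.integral_mono_interval hu huv hv
        (Filter.Eventually.of_forall fun t => norm_nonneg _) (hc.norm.intervalIntegrable _ _)
    rcases le_total y t with hyt | hyt
    · exact key y t hy.1 hyt ht.2
    · rw [norm_sub_rev]; exact key t y ht.1 hyt hy.2
  have hmv := (convex_Icc (x - h) (x + h)).norm_image_sub_le_of_norm_hasDerivWithin_le
    (f := fun t => f t - t • f' y) (f' := fun t => f' t - f' y) (x := a) (y := b)
    (fun t _ => by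
      have := ((hf t).fun_sub ((hasDerivAt_id' t).smul_const (f' y))).hasDerivWithinAt
        (s := Set.Icc (x - h) (x + h))
      simpa using this) osc ⟨by linarith, by linarith⟩ ⟨by linarith, by linarith⟩
  have hba : h ≤ b - a := by linarith
  have hpos : 0 < b - a := by linarith
  rw [Real.norm_of_nonneg hpos.le] at hmv
  have e : (b - a) • f' y = f b - f a - (f b - b • f' y - (f a - a • f' y)) := by
    rw [sub_smul]; abel
  have h1 : (b - a) * ‖f' y‖ ≤ ‖f b‖ + ‖f a‖ + G * (b - a) := by
    calc (b - a) * ‖f' y‖ = ‖(b - a) • f' y‖ := by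
          rw [norm_smul, Real.norm_of_nonneg hpos.le]
      _ ≤ ‖f b - f a‖ + ‖f b - b • f' y - (f a - a • f' y)‖ := by rw [e]; exact norm_sub_le _ _
      _ ≤ _ := add_le_add (norm_sub_le _ _) hmv
  have hS : 0 ≤ S := intervalIntegral.integral_nonneg (by linarith) fun t _ => norm_nonneg _
  have h2 : (b - a) * (‖f' y‖ - G) ≤ 4 / h * S := by
    have : 4 / h * S = 2 / h * S + 2 / h * S := by ring
    linarith
  have h3 : h * (‖f' y‖ - G) ≤ 4 / h * S := by
    rcases le_total 0 (‖f' y‖ - G) with h0 | h0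
    · exact (mul_le_mul_of_nonneg_right hba h0).trans h2
    · exact (mul_nonpos_of_nonneg_of_nonpos hh.le h0).trans (by positivity)
  have h4 : ‖f' y‖ - G ≤ 4 / h * S / h := by rw [le_div_iff₀ hh]; linarith
  have : 4 / h * S / h = 4 / h ^ 2 * S := by field_simp
  linarith

theorem intervalIntegral_le_rpow_mul_integral_rpow {φ : ℝ → ℝ} (hφ : Continuous φ)
    (hφ0 : ∀ t, 0 ≤ φ t) {q : ℝ} (hq : 1 ≤ q) {a b : ℝ} (hab : a ≤ b) :
    ∫ t in a..b, φ t ≤ (b - a) ^ (1 - 1 / q) * (∫ t in a..b, φ t ^ q) ^ (1 / q) := by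
  rcases hq.eq_or_lt with rfl | hq
  · simp
  have hc := (Real.HolderConjugate.conjExponent hq)
  rw [intervalIntegral.integral_of_le hab, intervalIntegral.integral_of_le hab]
  have hm : MemLp φ (ENNReal.ofReal q) (volume.restrict (Set.Ioc a b)) := by
    have hb : ∃ C, ∀ t ∈ Set.Icc a b, ‖φ t‖ ≤ C := isCompact_Icc.exists_bound_of_continuousOn hφ.continuousOn
    obtain ⟨C, hC⟩ := hb
    refine MemLp.of_bound hφ.aestronglyMeasurable C ?_
    filter_upwards [ae_restrict_mem measurableSet_Ioc] with t ht using hC t ⟨ht.1.le, ht.2⟩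
  have := integral_mul_le_Lp_mul_Lq_of_nonneg hc (μ := volume.restrict (Set.Ioc a b))
    (f := φ) (g := fun _ => 1) (Filter.Eventually.of_forall hφ0)
    (Filter.Eventually.of_forall fun _ => zero_le_one) hm (memLp_const _)
  simp only [mul_one, Real.one_rpow, integral_const, smul_eq_mul, measureReal_restrict_apply_univ,
    Real.volume_real_Ioc_of_le hab] at this
  rw [mul_comm]
  convert this using 3
  have := hc.inv_add_inv_eq_one
  rw [one_div, one_div]; linarith

theorem norm_deriv_le_rpow_integral [CompleteSpace F] {f f' f'' : ℝ → F}
    (hf : ∀ x, HasDerivAt f (f' x) x) (hf' : ∀ x, HasDerivAt f' (f'' x) x)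
    (hc : Continuous f'') {p q : ℝ} (hp : 1 ≤ p) (hq : 1 ≤ q)
    {x h y : ℝ} (hh : 0 < h) (hy : y ∈ Set.Icc (x - h) (x + h)) :
    ‖f' y‖ ≤ 8 * (h ^ (-(1 + 1 / q)) * (∫ t in (x - h)..(x + h), ‖f t‖ ^ q) ^ (1 / q) +
      h ^ (1 - 1 / p) * (∫ t in (x - h)..(x + h), ‖f'' t‖ ^ p) ^ (1 / p)) := by
  have cf : Continuous f := continuous_iff_continuousAt.2 fun x => (hf x).continuousAt
  have hmain := norm_deriv_le_integral_add_integral hf hf' hc hh hy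
  have h1 := intervalIntegral_le_rpow_mul_integral_rpow cf.norm (fun _ => norm_nonneg _) hq
    (show x - h ≤ x + h by linarith)
  have h2 := intervalIntegral_le_rpow_mul_integral_rpow hc.norm (fun _ => norm_nonneg _) hp
    (show x - h ≤ x + h by linarith)
  have hX : 0 ≤ (∫ t in (x - h)..(x + h), ‖f t‖ ^ q) ^ (1 / q) :=
    Real.rpow_nonneg (intervalIntegral.integral_nonneg (by linarith) fun t _ => by positivity) _
  have hY : 0 ≤ (∫ t in (x - h)..(x + h), ‖f'' t‖ ^ p) ^ (1 / p) :=
    Real.rpow_nonneg (intervalIntegral.integral_nonneg (by linarith) fun t _ => by positivity) _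
  set X := (∫ t in (x - h)..(x + h), ‖f t‖ ^ q) ^ (1 / q)
  set Y := (∫ t in (x - h)..(x + h), ‖f'' t‖ ^ p) ^ (1 / p)
  have e : x + h - (x - h) = 2 * h := by ring
  rw [e] at h1 h2
  have two : ∀ a : ℝ, 1 ≤ a → (2 * h) ^ (1 - 1 / a) ≤ 2 * h ^ (1 - 1 / a) := by
    intro a ha
    rw [Real.mul_rpow (by norm_num) hh.le]
    refine mul_le_mul_of_nonneg_right ?_ (by positivity)
    calc (2 : ℝ) ^ (1 - 1 / a) ≤ 2 ^ (1 : ℝ) :=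
          Real.rpow_le_rpow_of_exponent_le (by norm_num) (by
            have : 0 ≤ 1 / a := by positivity
            linarith)
      _ = 2 := Real.rpow_one 2
  have e2 : h ^ (-(1 + 1 / q)) = h ^ (1 - 1 / q) / h ^ 2 := by
    rw [← Real.rpow_natCast h 2, ← Real.rpow_sub hh]
    congr 1; push_cast; ring
  calc ‖f' y‖ ≤ 4 / h ^ 2 * (2 * h ^ (1 - 1 / q) * X) + 2 * h ^ (1 - 1 / p) * Y := by
        refine hmain.trans (add_le_add (mul_le_mul_of_nonneg_left ?_ (by positivity)) ?_)
        · exact h1.trans (mul_le_mul_of_nonneg_right (two q hq) hX)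
        · exact h2.trans (mul_le_mul_of_nonneg_right (two p hp) hY)
    _ = 8 * (h ^ (-(1 + 1 / q)) * X) + 2 * (h ^ (1 - 1 / p) * Y) := by rw [e2]; ring
    _ ≤ _ := by
        have : 0 ≤ h ^ (1 - 1 / p) * Y := by positivity
        linarith

theorem continuous_intervalIntegral_radius {φ : ℝ → ℝ} (hφ : Continuous φ) (x : ℝ) :
    Continuous fun h : ℝ => ∫ t in (x - h)..(x + h), φ t := by
  have hi : ∀ a b : ℝ, IntervalIntegrable φ volume a b := fun a b => hφ.intervalIntegrable a b
  have := intervalIntegral.continuous_primitive hi 0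
  have e : (fun h : ℝ => ∫ t in (x - h)..(x + h), φ t) =
      fun h => (∫ t in (0 : ℝ)..(x + h), φ t) - ∫ t in (0 : ℝ)..(x - h), φ t := by
    ext h
    rw [intervalIntegral.integral_interval_sub_left (hi _ _) (hi _ _)]
  rw [e]
  exact (this.comp (by fun_prop)).sub (this.comp (by fun_prop))

/-- Around every point where the derivative does not vanish there is an interval, of radius
bounded uniformly, on which the two terms of `norm_deriv_le_rpow_integral` are equal. -/
theorem exists_balanced_radius [CompleteSpace F] {f f' f'' : ℝ → F}
    (hf : ∀ x, HasDerivAt f (f' x) x) (hf' : ∀ x, HasDerivAt f' (f'' x) x)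
    (hc : Continuous f'') (hsupp : HasCompactSupport f) {p q : ℝ} (hp : 1 ≤ p) (hq : 1 ≤ q) :
    ∃ H : ℝ, ∀ x, f' x ≠ 0 → ∃ h, 0 < h ∧ h ≤ H ∧
      h ^ (2 + 1 / q - 1 / p) * (∫ t in (x - h)..(x + h), ‖f'' t‖ ^ p) ^ (1 / p) =
        (∫ t in (x - h)..(x + h), ‖f t‖ ^ q) ^ (1 / q) := by
  have hp0 : 0 < p := by linarith
  have hq0 : 0 < q := by linarith
  have cf : Continuous f := continuous_iff_continuousAt.2 fun x => (hf x).continuousAt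
  have ef : deriv f = f' := funext fun x => (hf x).deriv
  have ef' : deriv f' = f'' := funext fun x => (hf' x).deriv
  have hsupp' : HasCompactSupport f' := ef ▸ hsupp.deriv
  have hsupp'' : HasCompactSupport f'' := ef' ▸ hsupp'.deriv
  have c0 : Continuous fun t => ‖f t‖ ^ q := cf.norm.rpow_const fun _ => Or.inr hq0.le
  have c2 : Continuous fun t => ‖f'' t‖ ^ p := hc.norm.rpow_const fun _ => Or.inr hp0.le
  have i0 : Integrable fun t => ‖f t‖ ^ q :=
    c0.integrable_of_hasCompactSupport
      (hsupp.comp_left (g := fun z => ‖z‖ ^ q) (by simp [hq0.ne']))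
  have i2 : Integrable fun t => ‖f'' t‖ ^ p :=
    c2.integrable_of_hasCompactSupport
      (hsupp''.comp_left (g := fun z => ‖z‖ ^ p) (by simp [hp0.ne']))
  have le_total : ∀ φ : ℝ → ℝ, (∀ t, 0 ≤ φ t) → Integrable φ → ∀ x h : ℝ, 0 < h →
      ∫ t in (x - h)..(x + h), φ t ≤ ∫ t, φ t := by
    intro φ h0 hi x h hh
    rw [intervalIntegral.integral_of_le (by linarith)]
    exact setIntegral_le_integral hi (Filter.Eventually.of_forall h0)
  have nn : ∀ φ : ℝ → ℝ, (∀ t, 0 ≤ φ t) → ∀ x h : ℝ, 0 < h →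
      0 ≤ ∫ t in (x - h)..(x + h), φ t := fun φ h0 x h hh =>
    intervalIntegral.integral_nonneg (by linarith) fun t _ => h0 t
  have n0 : ∀ t, 0 ≤ ‖f t‖ ^ q := fun t => by positivity
  have n2 : ∀ t, 0 ≤ ‖f'' t‖ ^ p := fun t => by positivity
  set A := ∫ t, ‖f t‖ ^ q with hA
  set B := ∫ t, ‖f'' t‖ ^ p with hB
  have A0 : 0 ≤ A := integral_nonneg n0
  have B0 : 0 ≤ B := integral_nonneg n2
  rcases B0.eq_or_lt with hB0 | hBpos
  · refine ⟨1, fun x hx => absurd ?_ hx⟩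
    have bd : ∀ h : ℝ, 0 < h → ‖f' x‖ ≤ 8 * A ^ (1 / q) * h ^ (-(1 + 1 / q)) := by
      intro h hh
      have h1 := norm_deriv_le_rpow_integral hf hf' hc hp hq hh
        (show x ∈ Set.Icc (x - h) (x + h) from ⟨by linarith, by linarith⟩)
      have h2 : ∫ t in (x - h)..(x + h), ‖f'' t‖ ^ p = 0 :=
        le_antisymm (hB0 ▸ le_total _ n2 i2 x h hh) (nn _ n2 x h hh)
      rw [h2, Real.zero_rpow (by positivity), mul_zero, add_zero] at h1
      refine h1.trans ?_
      have h3 : (∫ t in (x - h)..(x + h), ‖f t‖ ^ q) ^ (1 / q) ≤ A ^ (1 / q) :=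
        Real.rpow_le_rpow (nn _ n0 x h hh) (le_total _ n0 i0 x h hh) (by positivity)
      have h4 := mul_le_mul_of_nonneg_left h3 (show 0 ≤ h ^ (-(1 + 1 / q)) by positivity)
      linarith
    have lim := (tendsto_rpow_neg_atTop (show 0 < 1 + 1 / q by positivity)).const_mul
      (8 * A ^ (1 / q))
    rw [mul_zero] at lim
    have := ge_of_tendsto lim ((Filter.eventually_gt_atTop 0).mono bd)
    exact norm_le_zero_iff.1 this
  · obtain ⟨R, hR⟩ := hsupp'.isCompact.isBounded.subset_closedBall 0
    have hβ : 0 < 2 + 1 / q - 1 / p := by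
      have : 1 / p ≤ 1 := by rw [div_le_one hp0]; exact hp
      have : 0 < 1 / q := by positivity
      linarith
    obtain ⟨M, hM⟩ := c2.bounded_above_of_compact_support
      (hsupp''.comp_left (g := fun z => ‖z‖ ^ p) (by simp [hp0.ne']))
    have hM0 : 0 ≤ M := (norm_nonneg _).trans (hM 0)
    have lim := (tendsto_rpow_atTop hβ).atTop_mul_const (show 0 < B ^ (1 / p) by positivity)
    obtain ⟨H, hH1, hH2, hH3⟩ := ((lim.eventually_ge_atTop (A ^ (1 / q))).and
      ((Filter.eventually_gt_atTop 0).and (Filter.eventually_gt_atTop (2 * R)))).exists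
    refine ⟨H, fun x hx => ?_⟩
    have hxR : |x| ≤ R := by
      simpa using hR (subset_tsupport _ (Function.mem_support.2 hx))
    have hBH : ∫ t in (x - H)..(x + H), ‖f'' t‖ ^ p = B := by
      refine intervalIntegral.integral_eq_integral_of_support_subset ?_
      intro t ht
      have ht' : f'' t ≠ 0 := by
        rintro h0
        simp [h0, hp0.ne'] at ht
      rw [← ef'] at ht'
      have := hR (support_deriv_subset (Function.mem_support.2 ht'))
      rw [mem_closedBall_zero_iff, Real.norm_eq_abs] at this
      rw [abs_le] at this hxR
      constructor <;> linarith
    set D : ℝ → ℝ := fun h =>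
      h ^ (2 + 1 / q - 1 / p) * (∫ t in (x - h)..(x + h), ‖f'' t‖ ^ p) ^ (1 / p) -
        (∫ t in (x - h)..(x + h), ‖f t‖ ^ q) ^ (1 / q) with hD
    have cD : Continuous D := by
      refine ((Real.continuous_rpow_const hβ.le).mul ?_).sub ?_
      · exact (continuous_intervalIntegral_radius c2 x).rpow_const fun _ => Or.inr (by positivity)
      · exact (continuous_intervalIntegral_radius c0 x).rpow_const fun _ => Or.inr (by positivity)
    have DH : 0 ≤ D H := by
      simp only [hD, hBH, sub_nonneg]
      refine le_trans ?_ hH1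
      exact Real.rpow_le_rpow (nn _ n0 x H hH2) (le_total _ n0 i0 x H hH2) (by positivity)
    obtain ⟨h0, hh0, hh0H, hDh0⟩ : ∃ h, 0 < h ∧ h ≤ H ∧ D h ≤ 0 := by
      by_contra! hcon
      refine hx (norm_le_zero_iff.1 ?_)
      have bd : ∀ h : ℝ, 0 < h → h ≤ H → ‖f' x‖ ≤ 16 * (2 * M) ^ (1 / p) * h := by
        intro h hh hhH
        have h1 := norm_deriv_le_rpow_integral hf hf' hc hp hq hh
          (show x ∈ Set.Icc (x - h) (x + h) from ⟨by linarith, by linarith⟩)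
        have h2 := (hcon h hh hhH).le
        simp only [hD, sub_nonneg] at h2
        set X := (∫ t in (x - h)..(x + h), ‖f t‖ ^ q) ^ (1 / q)
        have hY : (∫ t in (x - h)..(x + h), ‖f'' t‖ ^ p) ^ (1 / p) ≤
            (2 * M) ^ (1 / p) * h ^ (1 / p) := by
          rw [← Real.mul_rpow (by positivity) hh.le]
          refine Real.rpow_le_rpow (nn _ n2 x h hh) ?_ (by positivity)
          have := intervalIntegral.integral_mono_on (show x - h ≤ x + h by linarith)
            (c2.intervalIntegrable _ _) (continuous_const.intervalIntegrable (μ := volume) _ _)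
            (fun t _ => (le_abs_self _).trans (hM t))
          refine this.trans (le_of_eq ?_)
          rw [intervalIntegral.integral_const, smul_eq_mul]; ring
        set Y := (∫ t in (x - h)..(x + h), ‖f'' t‖ ^ p) ^ (1 / p)
        have h3 : h ^ (-(1 + 1 / q)) * X ≤ h ^ (1 - 1 / p) * Y := by
          calc h ^ (-(1 + 1 / q)) * X ≤ h ^ (-(1 + 1 / q)) * (h ^ (2 + 1 / q - 1 / p) * Y) :=
                mul_le_mul_of_nonneg_left h2 (by positivity)
            _ = h ^ (1 - 1 / p) * Y := by
                rw [← mul_assoc, ← Real.rpow_add hh]; congr 2; ring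
        have h4 : h ^ (1 - 1 / p) * Y ≤ (2 * M) ^ (1 / p) * h := by
          calc h ^ (1 - 1 / p) * Y ≤ h ^ (1 - 1 / p) * ((2 * M) ^ (1 / p) * h ^ (1 / p)) :=
                mul_le_mul_of_nonneg_left hY (by positivity)
            _ = (2 * M) ^ (1 / p) * (h ^ (1 - 1 / p) * h ^ (1 / p)) := by ring
            _ = _ := by rw [← Real.rpow_add hh]; simp
        linarith
      have lim : Filter.Tendsto (fun h : ℝ => 16 * (2 * M) ^ (1 / p) * h)
          (nhdsWithin 0 (Set.Ioi 0)) (nhds (16 * (2 * M) ^ (1 / p) * 0)) :=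
        ((continuous_const.mul continuous_id).tendsto 0).mono_left nhdsWithin_le_nhds
      rw [mul_zero] at lim
      refine ge_of_tendsto lim ?_
      filter_upwards [Ioc_mem_nhdsGT hH2] with h hh using bd h hh.1 hh.2
    obtain ⟨h, hh, hDh⟩ := intermediate_value_Icc hh0H cD.continuousOn ⟨hDh0, DH⟩
    exact ⟨h, hh0.trans_le hh.1, hh.2, sub_eq_zero.1 hDh⟩

end Line

theorem ENNReal.tsum_rpow_mul_rpow_le {ι : Type*} (a b : ι → ENNReal) {c d : ℝ}
    (hc : 0 ≤ c) (hd : 0 ≤ d) (hcd : c + d = 1) :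
    ∑' i, a i ^ c * b i ^ d ≤ (∑' i, a i) ^ c * (∑' i, b i) ^ d := by
  let _ : MeasurableSpace ι := ⊤
  have := ENNReal.lintegral_mul_norm_pow_le (μ := Measure.count) (f := a) (g := b)
    (measurable_from_top).aemeasurable (measurable_from_top).aemeasurable hc hd hcd
  simpa only [lintegral_count] using this

theorem setLIntegral_enorm_rpow_eq_ofReal {F : Type*} [NormedAddCommGroup F] {f : ℝ → F} (hf : Continuous f) {q : ℝ} (hq : 0 ≤ q)
    {x h : ℝ} (hh : 0 ≤ h) :
    ∫⁻ t in Metric.closedBall x h, ‖f t‖ₑ ^ q =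
      ENNReal.ofReal (∫ t in (x - h)..(x + h), ‖f t‖ ^ q) := by
  have c0 : Continuous fun t => ‖f t‖ ^ q := hf.norm.rpow_const fun _ => Or.inr hq
  rw [intervalIntegral.integral_of_le (by linarith), ← integral_Icc_eq_integral_Ioc,
    ofReal_integral_eq_lintegral_ofReal c0.integrableOn_Icc
      (Filter.Eventually.of_forall fun t => by positivity), Real.closedBall_eq_Icc]
  refine lintegral_congr fun t => ?_
  rw [← ofReal_norm, ENNReal.ofReal_rpow_of_nonneg (norm_nonneg _) hq]

theorem setLIntegral_deriv_rpow_le_of_balanced {F : Type*} [NormedAddCommGroup F]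
    [NormedSpace ℝ F] [CompleteSpace F] {f f' f'' : ℝ → F}
    (hf : ∀ x, HasDerivAt f (f' x) x) (hf' : ∀ x, HasDerivAt f' (f'' x) x)
    (hc : Continuous f'') {p q s : ℝ} (hp : 1 ≤ p) (hq : 1 ≤ q) (hs : 1 ≤ s)
    (hrel : 2 / s = 1 / p + 1 / q) {x h : ℝ} (hh : 0 < h)
    (hbal : h ^ (2 + 1 / q - 1 / p) * (∫ t in (x - h)..(x + h), ‖f'' t‖ ^ p) ^ (1 / p) =
        (∫ t in (x - h)..(x + h), ‖f t‖ ^ q) ^ (1 / q)) :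
    ∫⁻ t in Metric.closedBall x h, ‖f' t‖ₑ ^ s ≤ ENNReal.ofReal (2 * 16 ^ s) *
      ((∫⁻ t in Metric.closedBall x h, ‖f t‖ₑ ^ q) ^ (s / (2 * q)) *
        (∫⁻ t in Metric.closedBall x h, ‖f'' t‖ₑ ^ p) ^ (s / (2 * p))) := by
  have hp0 : 0 < p := by linarith
  have hq0 : 0 < q := by linarith
  have hs0 : 0 < s := by linarith
  have cf : Continuous f := continuous_iff_continuousAt.2 fun x => (hf x).continuousAt
  have cf' : Continuous f' := continuous_iff_continuousAt.2 fun x => (hf' x).continuousAt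
  rw [setLIntegral_enorm_rpow_eq_ofReal cf hq0.le hh.le,
    setLIntegral_enorm_rpow_eq_ofReal hc hp0.le hh.le,
    setLIntegral_enorm_rpow_eq_ofReal cf' hs0.le hh.le]
  have hpt := fun y => norm_deriv_le_rpow_integral (x := x) (y := y) hf hf' hc hp hq hh
  have hA : 0 ≤ ∫ t in (x - h)..(x + h), ‖f t‖ ^ q :=
    intervalIntegral.integral_nonneg (by linarith) fun t _ => by positivity
  have hB : 0 ≤ ∫ t in (x - h)..(x + h), ‖f'' t‖ ^ p :=
    intervalIntegral.integral_nonneg (by linarith) fun t _ => by positivity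
  set A := ∫ t in (x - h)..(x + h), ‖f t‖ ^ q
  set B := ∫ t in (x - h)..(x + h), ‖f'' t‖ ^ p
  rw [ENNReal.ofReal_rpow_of_nonneg hA (by positivity),
    ENNReal.ofReal_rpow_of_nonneg hB (by positivity), ← ENNReal.ofReal_mul (by positivity),
    ← ENNReal.ofReal_mul (by positivity)]
  refine ENNReal.ofReal_le_ofReal ?_
  set Z := h ^ (1 - 1 / p) * B ^ (1 / p) with hZ
  have hZ0 : 0 ≤ Z := by positivity
  have eZ : h ^ (-(1 + 1 / q)) * A ^ (1 / q) = Z := by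
    rw [← hbal, ← mul_assoc, ← Real.rpow_add hh, hZ]; congr 2; ring
  have eZs : Z ^ s = h⁻¹ * (A ^ (s / (2 * q)) * B ^ (s / (2 * p))) := by
    have h1 : Z ^ s = Z ^ (s / 2) * Z ^ (s / 2) := by
      rw [← Real.rpow_add_of_nonneg hZ0 (by positivity) (by positivity)]; congr 1; ring
    have h2 : Z ^ (s / 2) = h ^ ((1 - 1 / p) * (s / 2)) * B ^ (s / (2 * p)) := by
      rw [hZ, Real.mul_rpow (by positivity) (by positivity), ← Real.rpow_mul hh.le,
        ← Real.rpow_mul hB]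
      congr 2; field_simp
    have h3 : Z ^ (s / 2) = h ^ (-(1 + 1 / q) * (s / 2)) * A ^ (s / (2 * q)) := by
      rw [← eZ, Real.mul_rpow (by positivity) (by positivity), ← Real.rpow_mul hh.le,
        ← Real.rpow_mul hA]
      congr 2; field_simp
    have h4 : h ^ ((1 - 1 / p) * (s / 2)) * h ^ (-(1 + 1 / q) * (s / 2)) = h⁻¹ := by
      rw [← Real.rpow_add hh, ← Real.rpow_neg_one]
      congr 1
      have : (1 / p + 1 / q) * (s / 2) = 1 := by rw [← hrel]; field_simp
      linarith
    rw [h1]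
    nth_rewrite 1 [h2]
    rw [h3, ← h4]; ring
  have bd : ∀ y ∈ Set.Icc (x - h) (x + h), ‖f' y‖ ^ s ≤ 16 ^ s * Z ^ s := by
    intro y hy
    rw [← Real.mul_rpow (by norm_num) hZ0]
    refine Real.rpow_le_rpow (norm_nonneg _) ?_ hs0.le
    have := hpt y hy
    rw [eZ] at this
    linarith
  have := intervalIntegral.integral_mono_on (show x - h ≤ x + h by linarith)
    ((cf'.norm.rpow_const fun _ => Or.inr hs0.le).intervalIntegrable _ _)
    (continuous_const.intervalIntegrable (μ := volume) _ _) bd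
  refine this.trans (le_of_eq ?_)
  rw [intervalIntegral.integral_const, smul_eq_mul, eZs]
  field_simp
  ring

/-- Nirenberg's one-dimensional interpolation inequality for the first derivative. -/
theorem exists_lintegral_deriv_rpow_le {p q s : ℝ} (hp : 1 ≤ p) (hq : 1 ≤ q) (hs : 1 ≤ s)
    (hrel : 2 / s = 1 / p + 1 / q) :
    ∃ K : NNReal, ∀ (F : Type*) [NormedAddCommGroup F] [NormedSpace ℝ F] [CompleteSpace F]
      (f f' f'' : ℝ → F), (∀ x, HasDerivAt f (f' x) x) → (∀ x, HasDerivAt f' (f'' x) x) →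
      Continuous f'' → HasCompactSupport f →
      ∫⁻ t, ‖f' t‖ₑ ^ s ≤ K * ((∫⁻ t, ‖f t‖ₑ ^ q) ^ (s / (2 * q)) *
        (∫⁻ t, ‖f'' t‖ₑ ^ p) ^ (s / (2 * p))) := by
  obtain ⟨N, τ, hτ, hN⟩ := HasBesicovitchCovering.no_satelliteConfig (α := ℝ)
  refine ⟨N * (2 * 16 ^ s : ℝ).toNNReal, fun F _ _ _ f f' f'' hf hf' hc hsupp => ?_⟩
  have hp0 : 0 < p := by linarith
  have hq0 : 0 < q := by linarith
  have hs0 : 0 < s := by linarith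
  obtain ⟨H, hH⟩ := exists_balanced_radius hf hf' hc hsupp hp hq
  choose! ρ hρ0 hρH hρ using hH
  let P : Besicovitch.BallPackage {x // f' x ≠ 0} ℝ :=
    { c := fun x => x
      r := fun x => ρ x
      rpos := fun x => hρ0 x x.2
      r_bound := H
      r_le := fun x => hρH x x.2 }
  obtain ⟨S, hS, hcov⟩ := Besicovitch.exist_disjoint_covering_families hτ hN P
  have S_count : ∀ i, (S i).Countable := fun i =>
    (hS i).countable_of_nonempty_interior fun j _ =>
      (Metric.nonempty_ball.2 (P.rpos j)).mono Metric.ball_subset_interior_closedBall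
  set T : Fin N → Set ℝ := fun i => ⋃ j ∈ S i, Metric.closedBall (P.c j) (P.r j) with hT
  have over_union : ∀ (i : Fin N) (φ : ℝ → ENNReal), ∫⁻ t in T i, φ t =
      ∑' j : S i, ∫⁻ t in Metric.closedBall (P.c j) (P.r j), φ t := fun i φ =>
    lintegral_biUnion (S_count i) (fun _ _ => measurableSet_closedBall) (hS i) φ
  have hexp : s / (2 * q) + s / (2 * p) = 1 := by
    have : (1 / p + 1 / q) * (s / 2) = 1 := by rw [← hrel]; field_simp
    rw [← this]; field_simp; ring
  have piece : ∀ i, ∫⁻ t in T i, ‖f' t‖ₑ ^ s ≤ ENNReal.ofReal (2 * 16 ^ s) *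
      ((∫⁻ t, ‖f t‖ₑ ^ q) ^ (s / (2 * q)) * (∫⁻ t, ‖f'' t‖ₑ ^ p) ^ (s / (2 * p))) := by
    intro i
    rw [over_union]
    calc ∑' j : S i, ∫⁻ t in Metric.closedBall (P.c j) (P.r j), ‖f' t‖ₑ ^ s
        ≤ ∑' j : S i, ENNReal.ofReal (2 * 16 ^ s) *
          ((∫⁻ t in Metric.closedBall (P.c j) (P.r j), ‖f t‖ₑ ^ q) ^ (s / (2 * q)) *
          (∫⁻ t in Metric.closedBall (P.c j) (P.r j), ‖f'' t‖ₑ ^ p) ^ (s / (2 * p))) :=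
          ENNReal.tsum_le_tsum fun j => setLIntegral_deriv_rpow_le_of_balanced hf hf' hc hp hq hs
            hrel (P.rpos j) (hρ _ j.1.2)
      _ ≤ ENNReal.ofReal (2 * 16 ^ s) *
          ((∫⁻ t in T i, ‖f t‖ₑ ^ q) ^ (s / (2 * q)) *
          (∫⁻ t in T i, ‖f'' t‖ₑ ^ p) ^ (s / (2 * p))) := by
          rw [ENNReal.tsum_mul_left, over_union, over_union]
          gcongr
          exact ENNReal.tsum_rpow_mul_rpow_le _ _ (by positivity) (by positivity) hexp
      _ ≤ _ := by
          gcongr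
          · exact Measure.restrict_le_self
          · exact Measure.restrict_le_self
  have cover : Function.support (fun t => ‖f' t‖ₑ ^ s) ⊆ ⋃ i, T i := by
    intro t ht
    have ht' : f' t ≠ 0 := by
      intro h0
      simp [h0, hs0] at ht
    have := hcov ⟨⟨t, ht'⟩, rfl⟩
    simp only [Set.mem_iUnion, hT] at this ⊢
    obtain ⟨i, j, hj, hm⟩ := this
    exact ⟨i, j, hj, Metric.ball_subset_closedBall hm⟩
  calc ∫⁻ t, ‖f' t‖ₑ ^ s = ∫⁻ t in ⋃ i, T i, ‖f' t‖ₑ ^ s :=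
        (setLIntegral_eq_of_support_subset cover).symm
    _ ≤ ∑' i, ∫⁻ t in T i, ‖f' t‖ₑ ^ s := lintegral_iUnion_le _ _
    _ ≤ ∑' _ : Fin N, _ := ENNReal.tsum_le_tsum piece
    _ = _ := by
      rw [tsum_fintype, Finset.sum_const, Finset.card_univ, Fintype.card_fin, nsmul_eq_mul]
      push_cast
      rw [mul_assoc]; rfl

theorem lintegral_euclideanSpace_eq_lintegral_insertNth {m : ℕ} (i : Fin (m + 1))
    {g : EuclideanSpace ℝ (Fin (m + 1)) → ENNReal} (hg : Measurable g) :
    ∫⁻ x, g x = ∫⁻ y : Fin m → ℝ, ∫⁻ t : ℝ, g (WithLp.toLp 2 (i.insertNth t y)) := by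
  rw [← (PiLp.volume_preserving_toLp (Fin (m + 1))).lintegral_comp hg]
  change ∫⁻ a, (g ∘ WithLp.toLp 2) a = _
  rw [← (volume_preserving_piFinSuccAbove (fun _ : Fin (m + 1) => ℝ) i).symm.lintegral_comp
      (hg.comp (PiLp.volume_preserving_toLp (Fin (m + 1))).measurable),
    Measure.volume_eq_prod, lintegral_prod_symm']
  · rfl
  · exact (hg.comp (PiLp.volume_preserving_toLp (Fin (m + 1))).measurable).comp
      (MeasurableEquiv.measurable _)

theorem toLp_insertNth_eq_add_smul_single {m : ℕ} (i : Fin (m + 1)) (t : ℝ) (y : Fin m → ℝ) :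
    WithLp.toLp 2 (i.insertNth t y : Fin (m + 1) → ℝ) =
      WithLp.toLp 2 (i.insertNth 0 y : Fin (m + 1) → ℝ) + t • EuclideanSpace.single i (1 : ℝ) := by
  ext j
  refine Fin.succAboveCases i ?_ (fun k => ?_) j
  · simp
  · simp [Fin.succAbove_ne]

theorem exists_lintegral_fderiv_single_rpow_le (m : ℕ) {p q s : ℝ} (hp : 1 ≤ p) (hq : 1 ≤ q)
    (hs : 1 ≤ s) (hrel : 2 / s = 1 / p + 1 / q) :
    ∃ K : NNReal, ∀ (F : Type*) [NormedAddCommGroup F] [NormedSpace ℝ F] [CompleteSpace F]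
      (w : EuclideanSpace ℝ (Fin (m + 1)) → F), ContDiff ℝ 2 w → HasCompactSupport w →
      ∀ i, ∫⁻ x, ‖fderiv ℝ w x (EuclideanSpace.single i 1)‖ₑ ^ s ≤
        K * ((∫⁻ x, ‖w x‖ₑ ^ q) ^ (s / (2 * q)) *
          (∫⁻ x, ‖fderiv ℝ (fderiv ℝ w) x‖ₑ ^ p) ^ (s / (2 * p))) := by
  obtain ⟨K, hK⟩ := exists_lintegral_deriv_rpow_le hp hq hs hrel
  refine ⟨K, fun F _ _ _ w hw hsupp i => ?_⟩
  have hp0 : 0 < p := by linarith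
  have hq0 : 0 < q := by linarith
  have hs0 : 0 < s := by linarith
  set v : EuclideanSpace ℝ (Fin (m + 1)) := EuclideanSpace.single i 1 with hv
  have hv1 : ‖v‖ = 1 := by simp [hv]
  have hw1 : ContDiff ℝ 1 (fderiv ℝ w) := hw.fderiv_right (by norm_num)
  have c0 : Continuous w := hw.continuous
  have c1 : Continuous (fderiv ℝ w) := hw1.continuous
  have c2 : Continuous (fderiv ℝ (fderiv ℝ w)) := hw1.continuous_fderiv (by norm_num)
  have hexp : s / (2 * q) + s / (2 * p) = 1 := by
    have : (1 / p + 1 / q) * (s / 2) = 1 := by rw [← hrel]; field_simp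
    rw [← this]; field_simp; ring
  set b : (Fin m → ℝ) → EuclideanSpace ℝ (Fin (m + 1)) := fun y =>
    WithLp.toLp 2 (i.insertNth 0 y : Fin (m + 1) → ℝ) with hb
  have cb : Continuous b := by
    refine (PiLp.continuous_toLp 2 _).comp ?_
    exact continuous_const.finInsertNth i continuous_id
  have fubini : ∀ g : EuclideanSpace ℝ (Fin (m + 1)) → ENNReal, Measurable g →
      ∫⁻ x, g x = ∫⁻ y : Fin m → ℝ, ∫⁻ t : ℝ, g (b y + t • v) := fun g hg => by
    rw [lintegral_euclideanSpace_eq_lintegral_insertNth i hg]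
    exact lintegral_congr fun y => lintegral_congr fun t =>
      congrArg g (toLp_insertNth_eq_add_smul_single i t y)
  have m0 : Measurable fun x => ‖w x‖ₑ ^ q := c0.enorm.measurable.pow_const q
  have m1 : Measurable fun x => ‖fderiv ℝ w x v‖ₑ ^ s :=
    (c1.clm_apply continuous_const).enorm.measurable.pow_const s
  have m2 : Measurable fun x => ‖fderiv ℝ (fderiv ℝ w) x‖ₑ ^ p :=
    c2.nnnorm.measurable.coe_nnreal_ennreal.pow_const p
  have hline : Continuous fun z : (Fin m → ℝ) × ℝ => b z.1 + z.2 • v :=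
    (cb.comp continuous_fst).add (continuous_snd.smul continuous_const)
  have inner_meas : ∀ g : EuclideanSpace ℝ (Fin (m + 1)) → ENNReal, Measurable g →
      Measurable fun y => ∫⁻ t : ℝ, g (b y + t • v) := fun g hg =>
    (hg.comp hline.measurable).lintegral_prod_right'
  have on_line : ∀ y, ∫⁻ t : ℝ, ‖fderiv ℝ w (b y + t • v) v‖ₑ ^ s ≤
      K * ((∫⁻ t : ℝ, ‖w (b y + t • v)‖ₑ ^ q) ^ (s / (2 * q)) *
        (∫⁻ t : ℝ, ‖fderiv ℝ (fderiv ℝ w) (b y + t • v)‖ₑ ^ p) ^ (s / (2 * p))) := by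
    intro y
    have hl : ∀ t : ℝ, HasDerivAt (fun t : ℝ => b y + t • v) v t := fun t => by
      simpa using ((hasDerivAt_id t).smul_const v).const_add (b y)
    have hcl : Continuous fun t : ℝ => b y + t • v := by fun_prop
    have iso : Isometry fun t : ℝ => b y + t • v := by
      refine Isometry.of_dist_eq fun t t' => ?_
      rw [dist_add_left, dist_eq_norm, ← sub_smul, norm_smul, hv1, mul_one, dist_eq_norm]
    have h1 : ∀ t : ℝ, HasDerivAt (fun t : ℝ => w (b y + t • v))
        (fderiv ℝ w (b y + t • v) v) t := fun t =>
      ((hw.differentiable (by norm_num)) _).hasFDerivAt.comp_hasDerivAt t (hl t)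
    have h2 : ∀ t : ℝ, HasDerivAt (fun t : ℝ => fderiv ℝ w (b y + t • v) v)
        (fderiv ℝ (fderiv ℝ w) (b y + t • v) v v) t := fun t => by
      have := ((hw1.differentiable (by norm_num)) _).hasFDerivAt.comp_hasDerivAt t (hl t)
      simpa using this.clm_apply (hasDerivAt_const t v)
    have := hK F _ _ _ h1 h2
      (((c2.comp hcl).clm_apply continuous_const).clm_apply continuous_const)
      (hsupp.comp_isClosedEmbedding iso.isClosedEmbedding)
    refine this.trans ?_
    gcongr with t
    rw [enorm_le_iff_norm_le]
    refine ((ContinuousLinearMap.le_opNorm₂ _ v v)).trans ?_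
    simp [hv1]
  rw [fubini _ m0, fubini _ m1, fubini _ m2]
  calc _ ≤ ∫⁻ y, K * ((∫⁻ t : ℝ, ‖w (b y + t • v)‖ₑ ^ q) ^ (s / (2 * q)) *
        (∫⁻ t : ℝ, ‖fderiv ℝ (fderiv ℝ w) (b y + t • v)‖ₑ ^ p) ^ (s / (2 * p))) :=
        lintegral_mono on_line
    _ ≤ _ := by
      rw [lintegral_const_mul' _ _ ENNReal.coe_ne_top]
      gcongr
      exact ENNReal.lintegral_mul_norm_pow_le (inner_meas _ m0).aemeasurable
        (inner_meas _ m2).aemeasurable (by positivity) (by positivity) hexp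

theorem ContinuousLinearMap.enorm_le_sum_enorm_single {n : ℕ} {F : Type*} [NormedAddCommGroup F]
    [NormedSpace ℝ F] (A : EuclideanSpace ℝ (Fin n) →L[ℝ] F) :
    ‖A‖ₑ ≤ ∑ i, ‖A (EuclideanSpace.single i 1)‖ₑ := by
  have h : ‖A‖ ≤ ∑ i, ‖A (EuclideanSpace.single i 1)‖ := by
    refine A.opNorm_le_bound (by positivity) fun x => ?_
    have hx : x = ∑ i, x i • EuclideanSpace.single i (1 : ℝ) := by
      ext j; simp [Finset.sum_apply, Pi.single_apply]
    conv_lhs => rw [hx]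
    rw [map_sum, Finset.sum_mul]
    refine (norm_sum_le _ _).trans (Finset.sum_le_sum fun i _ => ?_)
    rw [map_smul, norm_smul, mul_comm]
    exact mul_le_mul_of_nonneg_left (PiLp.norm_apply_le x i) (norm_nonneg _)
  rw [← ofReal_norm]
  refine (ENNReal.ofReal_le_ofReal h).trans ?_
  rw [ENNReal.ofReal_sum_of_nonneg fun _ _ => norm_nonneg _]
  simp [ofReal_norm]

theorem exists_lintegral_fderiv_rpow_le {n : ℕ} (hn : 1 ≤ n) {p q s : ℝ} (hp : 1 ≤ p)
    (hq : 1 ≤ q) (hs : 1 ≤ s) (hrel : 2 / s = 1 / p + 1 / q) :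
    ∃ K : NNReal, ∀ (F : Type*) [NormedAddCommGroup F] [NormedSpace ℝ F] [CompleteSpace F]
      (w : EuclideanSpace ℝ (Fin n) → F), ContDiff ℝ 2 w → HasCompactSupport w →
      ∫⁻ x, ‖fderiv ℝ w x‖ₑ ^ s ≤
        K * ((∫⁻ x, ‖w x‖ₑ ^ q) ^ (s / (2 * q)) *
          (∫⁻ x, ‖fderiv ℝ (fderiv ℝ w) x‖ₑ ^ p) ^ (s / (2 * p))) := by
  obtain ⟨m, rfl⟩ : ∃ m, n = m + 1 := ⟨n - 1, by omega⟩
  obtain ⟨K, hK⟩ := exists_lintegral_fderiv_single_rpow_le m hp hq hs hrel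
  refine ⟨((m + 1 : ℕ) : NNReal) ^ (s - 1) * ((m + 1 : ℕ) * K), fun F _ _ _ w hw hsupp => ?_⟩
  have hs0 : 0 < s := by linarith
  have c1 : Continuous (fderiv ℝ w) := hw.continuous_fderiv (by norm_num)
  set Q := (∫⁻ x, ‖w x‖ₑ ^ q) ^ (s / (2 * q)) *
          (∫⁻ x, ‖fderiv ℝ (fderiv ℝ w) x‖ₑ ^ p) ^ (s / (2 * p))
  calc ∫⁻ x, ‖fderiv ℝ w x‖ₑ ^ s
      ≤ ∫⁻ x, ((m + 1 : ℕ) : ENNReal) ^ (s - 1) *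
          ∑ i, ‖fderiv ℝ w x (EuclideanSpace.single i 1)‖ₑ ^ s := by
        refine lintegral_mono fun x => ?_
        refine (ENNReal.rpow_le_rpow (ContinuousLinearMap.enorm_le_sum_enorm_single _)
          hs0.le).trans ?_
        refine (ENNReal.rpow_sum_le_const_mul_sum_rpow _ _ hs).trans ?_
        simp
    _ = ((m + 1 : ℕ) : ENNReal) ^ (s - 1) *
          ∑ i, ∫⁻ x, ‖fderiv ℝ w x (EuclideanSpace.single i 1)‖ₑ ^ s := by
        rw [lintegral_const_mul' _ _ (ENNReal.rpow_ne_top_of_nonneg (by linarith) (by simp)),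
          lintegral_finsetSum]
        exact fun i _ => (c1.clm_apply continuous_const).enorm.measurable.pow_const s
    _ ≤ ((m + 1 : ℕ) : ENNReal) ^ (s - 1) * ∑ _i : Fin (m + 1), K * Q := by
        gcongr with i
        exact hK F w hw hsupp i
    _ = _ := by
        rw [Finset.sum_const, Finset.card_univ, Fintype.card_fin, nsmul_eq_mul]
        push_cast
        rw [ENNReal.coe_rpow_of_nonneg _ (by linarith)]
        push_cast
        ring

/-- Log-convex sequences of nonnegative reals lie below the geometric interpolation of their
endpoints. -/
theorem pow_le_pow_mul_pow_of_sq_le_mul {b : ℕ → ℝ} (hb : ∀ j, 0 ≤ b j) {r : ℕ}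
    (h : ∀ j, j + 2 ≤ r → b (j + 1) ^ 2 ≤ b j * b (j + 2)) {j : ℕ} (hj : j ≤ r) :
    b j ^ r ≤ b 0 ^ (r - j) * b r ^ j := by
  have last : ∀ k, k + 1 ≤ r → b k ^ (k + 1) ≤ b 0 * b (k + 1) ^ k := by
    intro k
    induction k with
    | zero => intro _; simp
    | succ k ih =>
      intro hk
      rcases (hb (k + 1)).eq_or_lt with h0 | hpos
      · rw [← h0, zero_pow (by omega)]
        exact mul_nonneg (hb _) (pow_nonneg (hb _) _)
      have h1 := ih (by omega)
      have h2 := h k (by omega)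
      have h3 : b (k + 1) ^ k * b (k + 1) ^ (k + 2) ≤
          b (k + 1) ^ k * (b 0 * b (k + 2) ^ (k + 1)) := by
        calc b (k + 1) ^ k * b (k + 1) ^ (k + 2) = (b (k + 1) ^ 2) ^ (k + 1) := by ring
          _ ≤ (b k * b (k + 2)) ^ (k + 1) := pow_le_pow_left₀ (by positivity) h2 _
          _ = b k ^ (k + 1) * b (k + 2) ^ (k + 1) := mul_pow _ _ _
          _ ≤ b 0 * b (k + 1) ^ k * b (k + 2) ^ (k + 1) :=
            mul_le_mul_of_nonneg_right h1 (pow_nonneg (hb _) _)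
          _ = _ := by ring
      exact le_of_mul_le_mul_left h3 (by positivity)
  clear h
  induction r with
  | zero => obtain rfl : j = 0 := by omega
            simp
  | succ r ih =>
    rcases hj.eq_or_lt with rfl | hlt
    · simp
    have hjr : j ≤ r := by omega
    rcases Nat.eq_zero_or_pos r with rfl | hr
    · obtain rfl : j = 0 := by omega
      simp
    have h1 := ih hjr fun k hk => last k (by omega)
    have h2 := last r le_rfl
    obtain ⟨d, rfl⟩ : ∃ d, r = j + d := ⟨r - j, by omega⟩
    have e1 : j + d - j = d := by omega
    have e2 : j + d + 1 - j = d + 1 := by omega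
    rw [e1] at h1
    rw [e2]
    refine le_of_pow_le_pow_left₀ hr.ne'
      (mul_nonneg (pow_nonneg (hb _) _) (pow_nonneg (hb _) _)) ?_
    calc (b j ^ (j + d + 1)) ^ (j + d) = (b j ^ (j + d)) ^ (j + d + 1) := by ring
      _ ≤ (b 0 ^ d * b (j + d) ^ j) ^ (j + d + 1) :=
        pow_le_pow_left₀ (pow_nonneg (hb _) _) h1 _
      _ = b 0 ^ (d * (j + d + 1)) * (b (j + d) ^ (j + d + 1)) ^ j := by ring
      _ ≤ b 0 ^ (d * (j + d + 1)) * (b 0 * b (j + d + 1) ^ (j + d)) ^ j :=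
        mul_le_mul_of_nonneg_left (pow_le_pow_left₀ (pow_nonneg (hb _) _) h2 _)
          (pow_nonneg (hb _) _)
      _ = _ := by ring

theorem le_rpow_mul_rpow_of_sq_le_mul {a : ℕ → ℝ} (ha : ∀ j, 0 ≤ a j) {K : ℝ} (hK : 1 ≤ K)
    {r : ℕ} (hr : 1 ≤ r) (h : ∀ j, j + 2 ≤ r → a (j + 1) ^ 2 ≤ K * (a j * a (j + 2)))
    {j : ℕ} (hj : j ≤ r) :
    a j ≤ K ^ (r * j) * (a 0 ^ (1 - (j : ℝ) / r) * a r ^ ((j : ℝ) / r)) := by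
  have hK0 : 0 < K := by linarith
  have hr0 : (r : ℝ) ≠ 0 := by positivity
  have hlog := pow_le_pow_mul_pow_of_sq_le_mul (b := fun j => K ^ (j ^ 2) * a j)
    (fun j => mul_nonneg (by positivity) (ha j)) (r := r) (fun j hj => by
      have h1 := h j hj
      calc (K ^ ((j + 1) ^ 2) * a (j + 1)) ^ 2 = K ^ (2 * (j + 1) ^ 2) * a (j + 1) ^ 2 := by ring
        _ ≤ K ^ (2 * (j + 1) ^ 2) * (K * (a j * a (j + 2))) :=
          mul_le_mul_of_nonneg_left h1 (by positivity)
        _ = K ^ (2 * (j + 1) ^ 2 + 1) * (a j * a (j + 2)) := by ring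
        _ ≤ K ^ (2 * (j + 1) ^ 2 + 2) * (a j * a (j + 2)) :=
          mul_le_mul_of_nonneg_right (pow_le_pow_right₀ hK (by omega))
            (mul_nonneg (ha _) (ha _))
        _ = _ := by ring) hj
  have h1 : a j ^ r ≤ K ^ (r ^ 2 * j) * (a 0 ^ (r - j) * a r ^ j) := by
    calc a j ^ r ≤ (K ^ (j ^ 2) * a j) ^ r :=
          pow_le_pow_left₀ (ha j) (le_mul_of_one_le_left (ha j) (one_le_pow₀ hK)) _
      _ ≤ _ := hlog
      _ = _ := by simp only [ne_eq, OfNat.ofNat_ne_zero, not_false_eq_true, zero_pow, pow_zero,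
                    one_mul]; ring
  refine le_of_pow_le_pow_left₀ (show r ≠ 0 by omega)
    (mul_nonneg (by positivity) (mul_nonneg (Real.rpow_nonneg (ha _) _)
      (Real.rpow_nonneg (ha _) _))) (h1.trans (le_of_eq ?_))
  rw [mul_pow, mul_pow, ← Real.rpow_mul_natCast (ha _), ← Real.rpow_mul_natCast (ha _), sub_mul,
    div_mul_cancel₀ _ hr0, one_mul, ← Nat.cast_sub hj, Real.rpow_natCast, Real.rpow_natCast]
  ring

section Euclidean

variable {E : Type*} [NormedAddCommGroup E] [MeasurableSpace E]
  [BorelSpace E] {μ : Measure E} [IsFiniteMeasureOnCompacts μ]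
  {F : Type*} [NormedAddCommGroup F]

theorem ofReal_integral_norm_rpow_eq_lintegral {g : E → F} (hg : Continuous g)
    (hsupp : HasCompactSupport g) {q : ℝ} (hq : 0 < q) :
    ENNReal.ofReal (∫ x, ‖g x‖ ^ q ∂μ) = ∫⁻ x, ‖g x‖ₑ ^ q ∂μ := by
  have c0 : Continuous fun t => ‖g t‖ ^ q := hg.norm.rpow_const fun _ => Or.inr hq.le
  rw [ofReal_integral_eq_lintegral_ofReal (c0.integrable_of_hasCompactSupport
      (hsupp.comp_left (g := fun z => ‖z‖ ^ q) (by simp [hq.ne'])))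
      (Filter.Eventually.of_forall fun t => by positivity)]
  refine lintegral_congr fun t => ?_
  rw [← ofReal_norm, ENNReal.ofReal_rpow_of_nonneg (norm_nonneg _) hq.le]

/-- Lyapunov's interpolation inequality between Lebesgue norms. -/
theorem rpow_integral_norm_rpow_le_mul {g : E → F} (hg : Continuous g)
    (hsupp : HasCompactSupport g) {p q s θ : ℝ} (hp : 0 < p) (hq : 0 < q) (hs : 0 < s)
    (hθ0 : 0 ≤ θ) (hθ1 : θ ≤ 1) (hrel : 1 / s = θ / q + (1 - θ) / p) :
    (∫ x, ‖g x‖ ^ s ∂μ) ^ (1 / s) ≤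
      ((∫ x, ‖g x‖ ^ q ∂μ) ^ (1 / q)) ^ θ * ((∫ x, ‖g x‖ ^ p ∂μ) ^ (1 / p)) ^ (1 - θ) := by
  have h1θ : 0 ≤ 1 - θ := by linarith
  have hexp : θ * s / q + (1 - θ) * s / p = 1 := by
    have e : θ * s / q + (1 - θ) * s / p = s * (θ / q + (1 - θ) / p) := by ring
    rw [e, ← hrel]; field_simp
  have key := ENNReal.lintegral_mul_norm_pow_le (μ := μ) (f := fun x => ‖g x‖ₑ ^ q)
    (g := fun x => ‖g x‖ₑ ^ p) (hg.enorm.measurable.pow_const q).aemeasurable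
    (hg.enorm.measurable.pow_const p).aemeasurable (p := θ * s / q) (q := (1 - θ) * s / p)
    (by positivity) (by positivity) hexp
  have e : ∀ x, (‖g x‖ₑ ^ q) ^ (θ * s / q) * (‖g x‖ₑ ^ p) ^ ((1 - θ) * s / p) = ‖g x‖ₑ ^ s := by
    intro x
    rw [← ENNReal.rpow_mul, ← ENNReal.rpow_mul, ← ENNReal.rpow_add_of_nonneg _ _
      (by positivity) (by positivity)]
    congr 1; field_simp; ring
  simp_rw [e] at key
  have A0 : 0 ≤ ∫ x, ‖g x‖ ^ q ∂μ := integral_nonneg fun x => by positivity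
  have B0 : 0 ≤ ∫ x, ‖g x‖ ^ p ∂μ := integral_nonneg fun x => by positivity
  have S0 : 0 ≤ ∫ x, ‖g x‖ ^ s ∂μ := integral_nonneg fun x => by positivity
  rw [← ofReal_integral_norm_rpow_eq_lintegral hg hsupp hp,
    ← ofReal_integral_norm_rpow_eq_lintegral hg hsupp hq,
    ← ofReal_integral_norm_rpow_eq_lintegral hg hsupp hs,
    ENNReal.ofReal_rpow_of_nonneg A0 (by positivity),
    ENNReal.ofReal_rpow_of_nonneg B0 (by positivity), ← ENNReal.ofReal_mul (by positivity),
    ENNReal.ofReal_le_ofReal_iff (by positivity)] at key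
  refine (Real.rpow_le_rpow S0 key (by positivity)).trans (le_of_eq ?_)
  rw [Real.mul_rpow (by positivity) (by positivity), ← Real.rpow_mul A0, ← Real.rpow_mul B0,
    ← Real.rpow_mul A0, ← Real.rpow_mul B0]
  congr 2 <;> field_simp

end Euclidean

set_option maxSynthPendingDepth 3 in
set_option synthInstance.maxHeartbeats 400000 in
theorem norm_fderiv_fderiv_iteratedFDeriv {E F : Type*} [NormedAddCommGroup E] [NormedSpace ℝ E]
    [NormedAddCommGroup F] [NormedSpace ℝ F] (u : E → F) (j : ℕ) (x : E) :
    ‖fderiv ℝ (fderiv ℝ (iteratedFDeriv ℝ j u)) x‖ = ‖iteratedFDeriv ℝ (j + 2) u x‖ := by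
  rw [← norm_fderiv_iteratedFDeriv (n := j + 1), iteratedFDeriv_succ_eq_comp_left,
    LinearIsometryEquiv.comp_fderiv]
  exact (LinearIsometry.norm_toContinuousLinearMap_comp
    (continuousMultilinearCurryLeftEquiv ℝ (fun _ : Fin (j + 1) => E) F).symm.toLinearIsometry).symm

set_option maxSynthPendingDepth 3 in
set_option synthInstance.maxHeartbeats 400000 in
theorem exists_sq_iteratedFDeriv_succ_le {n : ℕ} (hn : 1 ≤ n) {p q s : ℝ} (hp : 1 ≤ p)
    (hq : 1 ≤ q) (hs : 1 ≤ s) (hrel : 2 / s = 1 / p + 1 / q) :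
    ∃ K : ℝ, ∀ u : EuclideanSpace ℝ (Fin n) → ℝ, ContDiff ℝ (⊤ : ℕ∞) u → HasCompactSupport u →
      ∀ j : ℕ, ((∫ x, ‖iteratedFDeriv ℝ (j + 1) u x‖ ^ s) ^ (1 / s)) ^ 2 ≤
        K * ((∫ x, ‖iteratedFDeriv ℝ j u x‖ ^ q) ^ (1 / q) *
          (∫ x, ‖iteratedFDeriv ℝ (j + 2) u x‖ ^ p) ^ (1 / p)) := by
  obtain ⟨K, hK⟩ := exists_lintegral_fderiv_rpow_le hn hp hq hs hrel
  refine ⟨(K : ℝ) ^ (2 / s), fun u hu hsupp j => ?_⟩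
  have hp0 : 0 < p := by linarith
  have hq0 : 0 < q := by linarith
  have hs0 : 0 < s := by linarith
  have cont : ∀ i : ℕ, Continuous (iteratedFDeriv ℝ i u) := fun i =>
    hu.continuous_iteratedFDeriv (by exact_mod_cast le_top)
  have key := hK _ (iteratedFDeriv ℝ j u)
    ((contDiff_infty.1 hu (2 + j)).iteratedFDeriv_right (m := 2) (by norm_cast))
    (hsupp.iteratedFDeriv j)
  have e1 : ∀ x, ‖fderiv ℝ (iteratedFDeriv ℝ j u) x‖ₑ = ‖iteratedFDeriv ℝ (j + 1) u x‖ₑ :=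
    fun x => by rw [← ofReal_norm, ← ofReal_norm, norm_fderiv_iteratedFDeriv]
  have e2 : ∀ x, ‖fderiv ℝ (fderiv ℝ (iteratedFDeriv ℝ j u)) x‖ₑ =
      ‖iteratedFDeriv ℝ (j + 2) u x‖ₑ :=
    fun x => by rw [← ofReal_norm, ← ofReal_norm, norm_fderiv_fderiv_iteratedFDeriv]
  simp_rw [e1, e2] at key
  have A0 : 0 ≤ ∫ x, ‖iteratedFDeriv ℝ j u x‖ ^ q := integral_nonneg fun x => by positivity
  have B0 : 0 ≤ ∫ x, ‖iteratedFDeriv ℝ (j + 2) u x‖ ^ p :=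
    integral_nonneg fun x => by positivity
  have S0 : 0 ≤ ∫ x, ‖iteratedFDeriv ℝ (j + 1) u x‖ ^ s :=
    integral_nonneg fun x => by positivity
  rw [← ofReal_integral_norm_rpow_eq_lintegral (cont _) (hsupp.iteratedFDeriv _) hp0,
    ← ofReal_integral_norm_rpow_eq_lintegral (cont _) (hsupp.iteratedFDeriv _) hq0,
    ← ofReal_integral_norm_rpow_eq_lintegral (cont _) (hsupp.iteratedFDeriv _) hs0,
    ENNReal.ofReal_rpow_of_nonneg A0 (by positivity),
    ENNReal.ofReal_rpow_of_nonneg B0 (by positivity), ← ENNReal.ofReal_mul (by positivity),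
    ← ENNReal.ofReal_coe_nnreal, ← ENNReal.ofReal_mul (by positivity),
    ENNReal.ofReal_le_ofReal_iff (by positivity)] at key
  rw [← Real.rpow_mul_natCast S0]
  refine (Real.rpow_le_rpow S0 key (by positivity)).trans (le_of_eq ?_)
  rw [Real.mul_rpow (by positivity) (by positivity), Real.mul_rpow (by positivity) (by positivity),
    ← Real.rpow_mul A0, ← Real.rpow_mul B0]
  have e0 : 1 / s * ((2 : ℕ) : ℝ) = 2 / s := by push_cast; ring
  have e3 : ∀ t : ℝ, 0 < t → s / (2 * t) * (1 / s * ((2 : ℕ) : ℝ)) = 1 / t := by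
    intro t ht; push_cast; field_simp
  rw [e3 q hq0, e3 p hp0, e0]

/-- The homogeneous Gagliardo-Nirenberg inequality at the scaling exponent. -/
theorem exists_iteratedFDeriv_le_rpow_mul_rpow {n r : ℕ} (hn : 1 ≤ n) (hr : 1 ≤ r) {p q : ℝ}
    (hp : 1 ≤ p) (hq : 1 ≤ q) :
    ∃ K : ℝ, 0 ≤ K ∧ ∀ u : EuclideanSpace ℝ (Fin n) → ℝ, ContDiff ℝ (⊤ : ℕ∞) u →
      HasCompactSupport u → ∀ (j : ℕ) (σ : ℝ), j ≤ r →
      1 / σ = (j : ℝ) / r / p + (1 - (j : ℝ) / r) / q →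
      (∫ x, ‖iteratedFDeriv ℝ j u x‖ ^ σ) ^ (1 / σ) ≤
        K * (((∫ x, ‖u x‖ ^ q) ^ (1 / q)) ^ (1 - (j : ℝ) / r) *
          ((∫ x, ‖iteratedFDeriv ℝ r u x‖ ^ p) ^ (1 / p)) ^ ((j : ℝ) / r)) := by
  have hr0 : (0 : ℝ) < r := by positivity
  have hp0 : 0 < p := by linarith
  have hq0 : 0 < q := by linarith
  set ρ : ℕ → ℝ := fun j => (j : ℝ) / r / p + (1 - (j : ℝ) / r) / q with hρ
  have hfrac : ∀ j ≤ r, (j : ℝ) / r ≤ 1 := fun j hj => by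
    rw [div_le_one hr0]; exact_mod_cast hj
  have one_le : ∀ j ≤ r, 1 ≤ (ρ j)⁻¹ := by
    intro j hj
    have h1 := hfrac j hj
    have h0 : 0 ≤ (j : ℝ) / r := by positivity
    have hpos : 0 < ρ j := by
      rcases h0.eq_or_lt with h | h
      · simp only [hρ, ← h]; simp [hq0]
      · exact add_pos_of_pos_of_nonneg (by positivity)
          (div_nonneg (by linarith) hq0.le)
    have hle : ρ j ≤ 1 := by
      have e1 : (j : ℝ) / r / p ≤ (j : ℝ) / r := div_le_self h0 hp
      have e2 : (1 - (j : ℝ) / r) / q ≤ 1 - (j : ℝ) / r := div_le_self (by linarith) hq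
      simp only [hρ]; linarith
    exact (one_le_inv₀ hpos).2 hle
  have step : ∀ j, ∃ K : ℝ, j + 2 ≤ r → ∀ u : EuclideanSpace ℝ (Fin n) → ℝ,
      ContDiff ℝ (⊤ : ℕ∞) u → HasCompactSupport u →
      ((∫ x, ‖iteratedFDeriv ℝ (j + 1) u x‖ ^ (ρ (j + 1))⁻¹) ^ ρ (j + 1)) ^ 2 ≤
        K * ((∫ x, ‖iteratedFDeriv ℝ j u x‖ ^ (ρ j)⁻¹) ^ ρ j *
          (∫ x, ‖iteratedFDeriv ℝ (j + 2) u x‖ ^ (ρ (j + 2))⁻¹) ^ ρ (j + 2)) := by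
    intro j
    by_cases hj : j + 2 ≤ r
    · obtain ⟨K, hK⟩ := exists_sq_iteratedFDeriv_succ_le hn (one_le (j + 2) hj)
        (one_le j (by omega)) (one_le (j + 1) (by omega)) (by
          simp only [div_inv_eq_mul, one_mul, hρ]; push_cast; ring)
      refine ⟨K, fun _ u hu hsupp => ?_⟩
      simpa only [one_div, inv_inv] using hK u hu hsupp j
    · exact ⟨0, fun h => absurd h hj⟩
  choose K hK using step
  set K' := 1 + ∑ j ∈ range r, |K j| with hK'
  have hK'1 : 1 ≤ K' := le_add_of_nonneg_right (Finset.sum_nonneg fun _ _ => abs_nonneg _)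
  refine ⟨K' ^ (r * r), by positivity, fun u hu hsupp j σ hj hσ => ?_⟩
  set a : ℕ → ℝ := fun j => (∫ x, ‖iteratedFDeriv ℝ j u x‖ ^ (ρ j)⁻¹) ^ ρ j with ha
  have a0 : ∀ j, 0 ≤ a j := fun j =>
    Real.rpow_nonneg (integral_nonneg fun x => Real.rpow_nonneg (norm_nonneg _) _) _
  have main := le_rpow_mul_rpow_of_sq_le_mul a0 hK'1 hr (fun i hi => by
    refine (hK i hi u hu hsupp).trans (mul_le_mul_of_nonneg_right ?_ (mul_nonneg (a0 _) (a0 _)))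
    calc K i ≤ |K i| := le_abs_self _
      _ ≤ ∑ j ∈ range r, |K j| :=
        Finset.single_le_sum (f := fun j => |K j|) (fun _ _ => abs_nonneg _)
          (mem_range.2 (by omega))
      _ ≤ K' := by rw [hK']; linarith) hj
  have eσ : ρ j = 1 / σ := hσ.symm
  have eσ' : (ρ j)⁻¹ = σ := by rw [eσ]; simp
  have ρ0 : ρ 0 = 1 / q := by simp [hρ]
  have ρr : ρ r = 1 / p := by simp [hρ, hr0.ne']
  have aj : a j = (∫ x, ‖iteratedFDeriv ℝ j u x‖ ^ σ) ^ (1 / σ) := by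
    simp only [ha]; rw [eσ', eσ]
  have a_zero : a 0 = (∫ x, ‖u x‖ ^ q) ^ (1 / q) := by
    simp only [ha, ρ0, norm_iteratedFDeriv_zero, one_div, inv_inv]
  have ar : a r = (∫ x, ‖iteratedFDeriv ℝ r u x‖ ^ p) ^ (1 / p) := by
    simp only [ha, ρr, one_div, inv_inv]
  rw [← aj, ← a_zero, ← ar]
  refine main.trans (mul_le_mul_of_nonneg_right ?_
    (mul_nonneg (Real.rpow_nonneg (a0 _) _) (Real.rpow_nonneg (a0 _) _)))
  exact pow_le_pow_right₀ hK'1 (Nat.mul_le_mul_left r hj)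

theorem stmt6 (n : ℕ) (hn : 1 ≤ n) (l r : ℕ) (hlr : l ≤ r) (hr : 1 ≤ r)
    (p q s : ℝ) (hp : 1 ≤ p) (hq : 1 ≤ q) (hs : 1 ≤ s)
    (hrel : (r : ℝ) / s = (l : ℝ) / p + ((r : ℝ) - (l : ℝ)) / q) :
    ∃ C > 0, ∀ u : EuclideanSpace ℝ (Fin n) → ℝ,
      ContDiff ℝ (⊤ : ℕ∞) u → HasCompactSupport u →
      ∑ j ∈ Finset.range (l + 1), (∫ x, ‖iteratedFDeriv ℝ j u x‖ ^ s) ^ (1 / s) ≤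
        C * ((∫ x, |u x| ^ q) ^ (1 / q)) ^ (1 - (l : ℝ) / r) *
          (∑ i ∈ Finset.range (r + 1),
            (∫ x, ‖iteratedFDeriv ℝ i u x‖ ^ p) ^ (1 / p)) ^ ((l : ℝ) / r) := by
  obtain ⟨K, hK0, hK⟩ := exists_iteratedFDeriv_le_rpow_mul_rpow hn hr hp hq
  have hr0 : (0 : ℝ) < r := by positivity
  have hp0 : 0 < p := by linarith
  have hq0 : 0 < q := by linarith
  have hs0 : 0 < s := by linarith
  set θ : ℕ → ℝ := fun j => ((r : ℝ) - l) / (r - j) with hθ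
  have hlr' : (l : ℝ) ≤ r := by exact_mod_cast hlr
  refine ⟨1 + ∑ j ∈ range (l + 1), K ^ θ j,
    add_pos_of_pos_of_nonneg one_pos (Finset.sum_nonneg fun _ _ => Real.rpow_nonneg hK0 _),
    fun u hu hsupp => ?_⟩
  have U0 : 0 ≤ (∫ x, |u x| ^ q) ^ (1 / q) :=
    Real.rpow_nonneg (integral_nonneg fun x => by positivity) _
  have N0 : ∀ i, 0 ≤ (∫ x, ‖iteratedFDeriv ℝ i u x‖ ^ p) ^ (1 / p) := fun i =>
    Real.rpow_nonneg (integral_nonneg fun x => by positivity) _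
  have le_M : ∀ i ≤ r, (∫ x, ‖iteratedFDeriv ℝ i u x‖ ^ p) ^ (1 / p) ≤
      ∑ i ∈ Finset.range (r + 1), (∫ x, ‖iteratedFDeriv ℝ i u x‖ ^ p) ^ (1 / p) := fun i hi =>
    Finset.single_le_sum (f := fun i => (∫ x, ‖iteratedFDeriv ℝ i u x‖ ^ p) ^ (1 / p))
      (fun i _ => N0 i) (mem_range.2 (by omega))
  set M := ∑ i ∈ Finset.range (r + 1), (∫ x, ‖iteratedFDeriv ℝ i u x‖ ^ p) ^ (1 / p)
  have M0 : 0 ≤ M := Finset.sum_nonneg fun i _ => N0 i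
  have term : ∀ j ∈ range (l + 1), (∫ x, ‖iteratedFDeriv ℝ j u x‖ ^ s) ^ (1 / s) ≤
      K ^ θ j * (((∫ x, |u x| ^ q) ^ (1 / q)) ^ (1 - (l : ℝ) / r) * M ^ ((l : ℝ) / r)) := by
    intro j hj
    have hjl : j ≤ l := by have := mem_range.1 hj; omega
    have hjl' : (j : ℝ) ≤ l := by exact_mod_cast hjl
    have hjr : j ≤ r := hjl.trans hlr
    have hθ0 : 0 ≤ θ j := div_nonneg (by linarith) (by linarith)
    have hθ1 : θ j ≤ 1 := div_le_one_of_le₀ (by linarith) (by linarith)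
    have hθmul : θ j * (r - j) = r - l := by
      rcases (hjl'.trans hlr').eq_or_lt with h | h
      · have : (l : ℝ) = r := le_antisymm hlr' (h ▸ hjl')
        rw [this, h]; ring
      · simp only [hθ]; rw [div_mul_cancel₀]; linarith
    have eU : (1 - (j : ℝ) / r) * θ j = 1 - (l : ℝ) / r := by
      field_simp; linarith
    have eM : (j : ℝ) / r * θ j + (1 - θ j) = (l : ℝ) / r := by linarith
    set σ : ℝ := ((j : ℝ) / r / p + (1 - (j : ℝ) / r) / q)⁻¹ with hσ
    have hσ' : 1 / σ = (j : ℝ) / r / p + (1 - (j : ℝ) / r) / q := by rw [hσ, one_div, inv_inv]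
    have hσ0 : 0 < σ := by
      have hf : (j : ℝ) / r ≤ 1 := by rw [div_le_one hr0]; linarith
      have h0 : 0 ≤ (j : ℝ) / r := by positivity
      refine inv_pos.2 ?_
      rcases h0.eq_or_lt with h | h
      · rw [← h]; simp [hq0]
      · exact add_pos_of_pos_of_nonneg (by positivity) (div_nonneg (by linarith) hq0.le)
    have hsrel : 1 / s = θ j / σ + (1 - θ j) / p := by
      have h1 : 1 / s = (l : ℝ) / r / p + (1 - (l : ℝ) / r) / q := by
        have : 1 / s = (r / s) / r := by field_simp
        rw [this, hrel]; field_simp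
      have h2 : θ j / σ = θ j * (1 / σ) := by ring
      rw [h2, hσ', h1, ← eU, ← eM]; ring
    have hol := rpow_integral_norm_rpow_le_mul (μ := volume)
      (hu.continuous_iteratedFDeriv (m := j) (by exact_mod_cast le_top))
      (hsupp.iteratedFDeriv j) hp0 hσ0 hs0 hθ0 hθ1 hsrel
    have hom := hK u hu hsupp j σ hjr hσ'
    simp only [Real.norm_eq_abs (u _)] at hom
    set U := (∫ x, |u x| ^ q) ^ (1 / q)
    calc (∫ x, ‖iteratedFDeriv ℝ j u x‖ ^ s) ^ (1 / s) ≤ _ := hol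
      _ ≤ (K * (U ^ (1 - (j : ℝ) / r) * M ^ ((j : ℝ) / r))) ^ θ j * M ^ (1 - θ j) := by
        refine mul_le_mul (Real.rpow_le_rpow ?_ (hom.trans ?_) hθ0)
          (Real.rpow_le_rpow (N0 j) (le_M j hjr) (by linarith))
          (Real.rpow_nonneg (N0 j) _) (by positivity)
        · exact Real.rpow_nonneg (integral_nonneg fun x => by positivity) _
        · have := Real.rpow_le_rpow (N0 r) (le_M r le_rfl) (show 0 ≤ (j : ℝ) / r by positivity)
          exact mul_le_mul_of_nonneg_left (mul_le_mul_of_nonneg_left this (by positivity)) hK0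
      _ = K ^ θ j * (U ^ ((1 - (j : ℝ) / r) * θ j) * M ^ ((j : ℝ) / r * θ j + (1 - θ j))) := by
        rw [Real.mul_rpow hK0 (by positivity), Real.mul_rpow (by positivity) (by positivity),
          ← Real.rpow_mul U0, ← Real.rpow_mul M0,
          Real.rpow_add_of_nonneg M0 (by positivity) (by linarith)]
        ring
      _ = _ := by rw [eU, eM]
  refine (Finset.sum_le_sum term).trans ?_
  rw [← Finset.sum_mul, mul_assoc]
  exact mul_le_mul_of_nonneg_right (by linarith) (by positivity)
end

section
/- Let n ≥ 1. There is a constant C depending only on n such that for every real n×n matrix A and every unit vector N ∈ ℝⁿ, writing γ = I − N Nᵀ for the orthogonal projection onto the hyperplane orthogonal to N: ‖A‖² ≤ C (‖γA‖² + (tr A)² + ‖A − Aᵀ‖²), where ‖·‖ denotes the Frobenius norm of a matrix and tr the trace. -/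
open Matrix

/-- Cauchy–Schwarz for a matrix applied to a unit vector, in the Frobenius norm. -/
lemma sum_sq_mulVec_le {m n : Type*} [Fintype m] [Fintype n] (M : Matrix m n ℝ) (N : n → ℝ)
    (hN : ∑ i, N i ^ 2 = 1) :
    ∑ i, (M *ᵥ N) i ^ 2 ≤ ∑ i, ∑ j, M i j ^ 2 := by
  refine Finset.sum_le_sum fun i _ => ?_
  have h := Finset.sum_mul_sq_le_sq_mul_sq Finset.univ (M i) N
  rwa [hN, mul_one] at h

lemma trace_sq_le {n : Type*} [Fintype n] (M : Matrix n n ℝ) :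
    M.trace ^ 2 ≤ Fintype.card n * ∑ i, ∑ j, M i j ^ 2 := by
  have h : (∑ i, M i i) ^ 2 ≤ Fintype.card n * ∑ i, M i i ^ 2 :=
    sq_sum_le_card_mul_sum_sq (s := Finset.univ)
  refine h.trans ?_
  gcongr with i
  exact Finset.single_le_sum (f := fun j => M i j ^ 2) (fun j _ => sq_nonneg _)
    (Finset.mem_univ i)

/-- A matrix is recovered from its tangential part `G`, its trace and its antisymmetric part. -/
lemma eq_tangential_add_normal {n : Type*} [Fintype n] [DecidableEq n] (A : Matrix n n ℝ)
    (N : n → ℝ) (G : Matrix n n ℝ)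
    (hG : G = (1 - Matrix.of fun i j => N i * N j) * A) (i j : n) :
    A i j = G i j + N i * ((A.trace - G.trace) * N j + (G *ᵥ N) j - ((A - Aᵀ) *ᵥ N) j) := by
  have hA (i j) : A i j = G i j + N i * (N ᵥ* A) j := by
    simp [hG, sub_mul, Matrix.mul_apply, vecMul, dotProduct, Finset.mul_sum, mul_assoc]
  have htr : A.trace - G.trace = N ᵥ* A ⬝ᵥ N := by
    simp only [Matrix.trace, Matrix.diag_apply, dotProduct, ← Finset.sum_sub_distrib]
    exact Finset.sum_congr rfl fun i _ => by linear_combination hA i i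
  have hAN : (A *ᵥ N) j = (G *ᵥ N) j + N j * (N ᵥ* A ⬝ᵥ N) := by
    simp only [mulVec, dotProduct, Finset.mul_sum, ← Finset.sum_add_distrib]
    exact Finset.sum_congr rfl fun k _ => by linear_combination N k * hA j k
  rw [sub_mulVec, Pi.sub_apply, mulVec_transpose, htr]
  linear_combination hA i j + N i * hAN

theorem stmt8 (n : ℕ) (hn : 1 ≤ n) :
    ∃ C > 0, ∀ (A : Matrix (Fin n) (Fin n) ℝ) (N : Fin n → ℝ),
      (∑ i, (N i) ^ 2) = 1 →
      (∑ i, ∑ j, (A i j) ^ 2) ≤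
        C * ((∑ i, ∑ j, ((((1 : Matrix (Fin n) (Fin n) ℝ) -
                Matrix.of fun i j => N i * N j) * A) i j) ^ 2) +
             (Matrix.trace A) ^ 2 +
             (∑ i, ∑ j, (A i j - Aᵀ i j) ^ 2)) := by
  refine ⟨8 * n + 8, by positivity, fun A N hN => ?_⟩
  set G := (1 - Matrix.of fun i j => N i * N j) * A with hG
  have hGN := sum_sq_mulVec_le G N hN
  have hDN := sum_sq_mulVec_le (A - Aᵀ) N hN
  simp only [Matrix.sub_apply] at hDN
  have htr := trace_sq_le G
  rw [Fintype.card_fin] at htr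
  set s := A.trace - G.trace with hs
  set g := G *ᵥ N
  set d := (A - Aᵀ) *ᵥ N
  have hpt (i j) : A i j ^ 2 ≤
      4 * (G i j ^ 2 + N i ^ 2 * (s ^ 2 * N j ^ 2 + g j ^ 2 + d j ^ 2)) := by
    rw [eq_tangential_add_normal A N G hG i j]
    have four (a b c e : ℝ) :
        (a + b + c - e) ^ 2 ≤ 4 * (a ^ 2 + b ^ 2 + c ^ 2 + e ^ 2) := by
      linarith [sq_nonneg (a - b), sq_nonneg (a - c), sq_nonneg (a + e), sq_nonneg (b - c),
        sq_nonneg (b + e), sq_nonneg (c + e)]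
    linarith [four (G i j) (N i * (s * N j)) (N i * g j) (N i * d j)]
  have hsum : ∑ i, ∑ j, A i j ^ 2 ≤
      4 * (∑ i, ∑ j, G i j ^ 2 + (s ^ 2 + ∑ j, g j ^ 2 + ∑ j, d j ^ 2)) := by
    refine (Finset.sum_le_sum fun i _ => Finset.sum_le_sum fun j _ => hpt i j).trans_eq ?_
    simp only [← Finset.mul_sum, Finset.sum_add_distrib, ← Finset.sum_mul, hN]
    ring
  have hs2 : s ^ 2 ≤ 2 * A.trace ^ 2 + 2 * G.trace ^ 2 := by
    rw [hs]; linarith [sq_nonneg (A.trace + G.trace)]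
  have hD : 0 ≤ ∑ i, ∑ j, (A i j - Aᵀ i j) ^ 2 := by positivity
  have hn0 : (0 : ℝ) ≤ n := n.cast_nonneg
  linarith [mul_nonneg hn0 hD, mul_nonneg hn0 (sq_nonneg A.trace)]
end

section
/- Let U ⊆ ℝⁿ be open with n ≥ 1, and let v : ℝ × U → ℝⁿ, h : ℝ × U → ℝ, and e : ℝ → ℝ be smooth. Define the material derivative D_t u = ∂_t u + Σ_j v^j ∂_{x_j} u, acting componentwise on vector-valued functions. Suppose that on ℝ × U: D_t v = −∇h − eₙ, where ∇h is the spatial gradient of h and eₙ is the n-th standard basis vector of ℝⁿ, and that div v = −D_t(e ∘ h), where div v = Σ_j ∂_{x_j} v^j. Then on ℝ × U: D_t(D_t(e ∘ h)) − Δh = Σ_{i,j=1}^{n} (∂_{x_i} v^j)(∂_{x_j} v^i), where Δ is the spatial Laplacian. -/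
/-- Spatial partial derivative `∂_{x_i} u` of a function `u(t,x)`. -/
noncomputable def pd (n : ℕ) (u : ℝ × (Fin n → ℝ) → ℝ) (i : Fin n)
    (p : ℝ × (Fin n → ℝ)) : ℝ :=
  fderiv ℝ (fun z => u (p.1, z)) p.2 (Pi.single i 1)

/-- Time derivative `∂_t u` of a function `u(t,x)`. -/
noncomputable def td (n : ℕ) (u : ℝ × (Fin n → ℝ) → ℝ) (p : ℝ × (Fin n → ℝ)) : ℝ :=
  deriv (fun s => u (s, p.2)) p.1

/-- The material derivative `D_t u = ∂_t u + Σ_j v^j ∂_{x_j} u`. -/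
noncomputable def matD (n : ℕ) (v : ℝ × (Fin n → ℝ) → Fin n → ℝ)
    (u : ℝ × (Fin n → ℝ) → ℝ) (p : ℝ × (Fin n → ℝ)) : ℝ :=
  td n u p + ∑ j, v p j * pd n u j p

open Filter Topology in
theorem pd_congr_of_eventuallyEq {n : ℕ} {f g : ℝ × (Fin n → ℝ) → ℝ} {p : ℝ × (Fin n → ℝ)}
    (hfg : f =ᶠ[𝓝 p] g) (i : Fin n) : pd n f i p = pd n g i p := by
  have hc : Tendsto (fun z : Fin n → ℝ => (p.1, z)) (𝓝 p.2) (𝓝 p) :=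
    (Continuous.prodMk_right p.1).tendsto p.2
  have hs : (fun z => f (p.1, z)) =ᶠ[𝓝 p.2] fun z => g (p.1, z) := hc.eventually hfg
  rw [pd, pd, hs.fderiv_eq]

open Filter Topology in
theorem matD_congr_of_eventuallyEq {n : ℕ} {f g : ℝ × (Fin n → ℝ) → ℝ} {p : ℝ × (Fin n → ℝ)}
    (v : ℝ × (Fin n → ℝ) → Fin n → ℝ) (hfg : f =ᶠ[𝓝 p] g) : matD n v f p = matD n v g p := by
  have hc : Tendsto (fun s : ℝ => (s, p.2)) (𝓝 p.1) (𝓝 p) :=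
    (Continuous.prodMk_left p.2).tendsto p.1
  have hs : (fun s => f (s, p.2)) =ᶠ[𝓝 p.1] fun s => g (s, p.2) := hc.eventually hfg
  rw [matD, matD, td, td, hs.deriv_eq]
  simp_rw [pd_congr_of_eventuallyEq hfg]

theorem pd_eq_fderiv {n : ℕ} {u : ℝ × (Fin n → ℝ) → ℝ} {p : ℝ × (Fin n → ℝ)}
    (hu : DifferentiableAt ℝ u p) (i : Fin n) :
    pd n u i p = fderiv ℝ u p (0, Pi.single i 1) := by
  have hs : HasFDerivAt (fun z => u (p.1, z))
      ((fderiv ℝ u p).comp (ContinuousLinearMap.inr ℝ ℝ (Fin n → ℝ))) p.2 :=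
    HasFDerivAt.comp p.2 (f := fun z => (p.1, z)) hu.hasFDerivAt (hasFDerivAt_prodMk_right p.1 p.2)
  simp [pd, hs.fderiv]

theorem td_eq_fderiv {n : ℕ} {u : ℝ × (Fin n → ℝ) → ℝ} {p : ℝ × (Fin n → ℝ)}
    (hu : DifferentiableAt ℝ u p) : td n u p = fderiv ℝ u p (1, 0) := by
  have hs : HasFDerivAt (fun s => u (s, p.2))
      ((fderiv ℝ u p).comp (ContinuousLinearMap.inl ℝ ℝ (Fin n → ℝ))) p.1 :=
    HasFDerivAt.comp p.1 (f := fun s => (s, p.2)) hu.hasFDerivAt (hasFDerivAt_prodMk_left p.1 p.2)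
  simp [td, hs.hasDerivAt.deriv]

theorem sum_mul_pd_eq_fderiv {n : ℕ} {u : ℝ × (Fin n → ℝ) → ℝ} {p : ℝ × (Fin n → ℝ)}
    (hu : DifferentiableAt ℝ u p) (w : Fin n → ℝ) :
    ∑ j, w j * pd n u j p = fderiv ℝ u p (0, w) := by
  have hw : ((0 : ℝ), w) = ∑ j, w j • ((0 : ℝ), (Pi.single j 1 : Fin n → ℝ)) := by
    ext k
    · simp [Prod.fst_sum]
    · simp [Prod.snd_sum, Finset.sum_apply, Pi.single_apply]
  rw [hw, map_sum]
  simp only [map_smul, smul_eq_mul, pd_eq_fderiv hu]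

theorem matD_eq_fderiv {n : ℕ} {u : ℝ × (Fin n → ℝ) → ℝ} {p : ℝ × (Fin n → ℝ)}
    (v : ℝ × (Fin n → ℝ) → Fin n → ℝ) (hu : DifferentiableAt ℝ u p) :
    matD n v u p = fderiv ℝ u p (1, v p) := by
  rw [matD, td_eq_fderiv hu, sum_mul_pd_eq_fderiv hu, ← map_add]
  simp

theorem ContDiffAt.eventually_differentiableAt_of_two {n : ℕ} {u : ℝ × (Fin n → ℝ) → ℝ}
    {p : ℝ × (Fin n → ℝ)} (hu : ContDiffAt ℝ 2 u p) :
    ∀ᶠ q in nhds p, DifferentiableAt ℝ u q :=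
  (hu.eventually (by simp)).mono fun _ hq => hq.differentiableAt (by simp)

theorem ContDiffAt.differentiableAt_fderiv_of_two {n : ℕ} {u : ℝ × (Fin n → ℝ) → ℝ}
    {p : ℝ × (Fin n → ℝ)} (hu : ContDiffAt ℝ 2 u p) : DifferentiableAt ℝ (fderiv ℝ u) p :=
  (hu.fderiv_right (m := 1) (by norm_num)).differentiableAt (by simp)

theorem pd_eventuallyEq_fderiv {n : ℕ} {u : ℝ × (Fin n → ℝ) → ℝ} {p : ℝ × (Fin n → ℝ)}
    (hu : ContDiffAt ℝ 2 u p) (i : Fin n) :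
    pd n u i =ᶠ[nhds p] fun q => fderiv ℝ u q (0, Pi.single i 1) :=
  hu.eventually_differentiableAt_of_two.mono fun _ hq => pd_eq_fderiv hq i

theorem differentiableAt_pd {n : ℕ} {u : ℝ × (Fin n → ℝ) → ℝ} {p : ℝ × (Fin n → ℝ)}
    (hu : ContDiffAt ℝ 2 u p) (i : Fin n) : DifferentiableAt ℝ (pd n u i) p :=
  (hu.differentiableAt_fderiv_of_two.clm_apply (differentiableAt_const _)).congr_of_eventuallyEq
    (pd_eventuallyEq_fderiv hu i)

/-- The commutator of a spatial derivative with the material derivative. -/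
theorem pd_matD {n : ℕ} {u : ℝ × (Fin n → ℝ) → ℝ} {v : ℝ × (Fin n → ℝ) → Fin n → ℝ}
    {p : ℝ × (Fin n → ℝ)} (hu : ContDiffAt ℝ 2 u p) (hv : DifferentiableAt ℝ v p) (i : Fin n) :
    pd n (matD n v u) i p =
      matD n v (pd n u i) p + ∑ j, pd n (fun q => v q j) i p * pd n u j p := by
  have hdu := hu.differentiableAt_fderiv_of_two
  have hW : HasFDerivAt (fun q => ((1 : ℝ), v q))
      ((0 : ℝ × (Fin n → ℝ) →L[ℝ] ℝ).prod (fderiv ℝ v p)) p :=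
    (hasFDerivAt_const (1 : ℝ) p).prodMk hv.hasFDerivAt
  have hG := hdu.hasFDerivAt.clm_apply hW
  have hP := hdu.hasFDerivAt.clm_apply
    (hasFDerivAt_const ((0 : ℝ), (Pi.single i 1 : Fin n → ℝ)) p)
  have hsymm : IsSymmSndFDerivAt ℝ u p := hu.isSymmSndFDerivAt (by simp)
  have hvi : (fun j => pd n (fun q => v q j) i p) = fderiv ℝ v p (0, Pi.single i 1) := by
    ext j
    rw [pd_eq_fderiv (differentiableAt_pi.1 hv j), fderiv_apply hv]
    rfl
  have hmat : matD n v u =ᶠ[nhds p] fun q => fderiv ℝ u q (1, v q) :=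
    hu.eventually_differentiableAt_of_two.mono fun _ hq => matD_eq_fderiv v hq
  rw [pd_congr_of_eventuallyEq hmat, pd_eq_fderiv hG.differentiableAt, hG.fderiv,
    matD_congr_of_eventuallyEq v (pd_eventuallyEq_fderiv hu i),
    matD_eq_fderiv v hP.differentiableAt, hP.fderiv,
    sum_mul_pd_eq_fderiv (hu.differentiableAt (by simp)) (fun j => pd n (fun q => v q j) i p), hvi]
  simp [hsymm.eq (1, v p) (0, Pi.single i 1), add_comm]

theorem matD_neg_sum {n : ℕ} {ι : Type*} [Fintype ι] {f : ι → ℝ × (Fin n → ℝ) → ℝ}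
    {p : ℝ × (Fin n → ℝ)} (v : ℝ × (Fin n → ℝ) → Fin n → ℝ)
    (hf : ∀ j, DifferentiableAt ℝ (f j) p) :
    matD n v (fun q => -∑ j, f j q) p = -∑ j, matD n v (f j) p := by
  have hs := (HasFDerivAt.fun_sum (u := Finset.univ) fun j _ => (hf j).hasFDerivAt).fun_neg
  rw [matD_eq_fderiv v hs.differentiableAt, hs.fderiv]
  simp [fun j => matD_eq_fderiv v (hf j)]

theorem pd_neg_sub_const {n : ℕ} (f : ℝ × (Fin n → ℝ) → ℝ) (c : ℝ) (i : Fin n)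
    (p : ℝ × (Fin n → ℝ)) : pd n (fun q => -f q - c) i p = -pd n f i p := by
  simp [pd, fderiv_sub_const, fderiv_fun_neg]

theorem stmt13 (n : ℕ) (hn : 1 ≤ n) (U : Set (Fin n → ℝ)) (hU : IsOpen U)
    (v : ℝ × (Fin n → ℝ) → Fin n → ℝ) (h : ℝ × (Fin n → ℝ) → ℝ) (e : ℝ → ℝ)
    (hv : ContDiffOn ℝ (⊤ : ℕ∞) v (Set.univ ×ˢ U)) (hh : ContDiffOn ℝ (⊤ : ℕ∞) h (Set.univ ×ˢ U))
    (he : ContDiff ℝ (⊤ : ℕ∞) e)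
    (heuler : ∀ t : ℝ, ∀ x ∈ U, ∀ i : Fin n,
      matD n v (fun p => v p i) (t, x) =
        -(pd n h i (t, x)) - (Pi.single (⟨n - 1, by omega⟩ : Fin n) (1 : ℝ) : Fin n → ℝ) i)
    (hdiv : ∀ t : ℝ, ∀ x ∈ U,
      (∑ j, pd n (fun p => v p j) j (t, x)) = -matD n v (fun p => e (h p)) (t, x)) :
    ∀ t : ℝ, ∀ x ∈ U,
      matD n v (matD n v (fun p => e (h p))) (t, x) - ∑ i, pd n (pd n h i) i (t, x) =
        ∑ i, ∑ j, pd n (fun p => v p j) i (t, x) * pd n (fun p => v p i) j (t, x) := by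
  intro t x hx
  have hS : Set.univ ×ˢ U ∈ nhds (t, x) :=
    (isOpen_univ.prod hU).mem_nhds ⟨Set.mem_univ t, hx⟩
  have hvp : ContDiffAt ℝ 2 v (t, x) :=
    (hv.contDiffAt hS).of_le (WithTop.coe_le_coe.2 (le_top : (2 : ℕ∞) ≤ ⊤))
  have hvj : ∀ j, ContDiffAt ℝ 2 (fun p => v p j) (t, x) := contDiffAt_pi.1 hvp
  have hdivloc : matD n v (fun p => e (h p)) =ᶠ[nhds (t, x)]
      fun q => -∑ j, pd n (fun p => v p j) j q := by
    filter_upwards [hS] with q hq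
    rw [hdiv q.1 q.2 hq.2, neg_neg]
  have hlap : ∀ i, pd n (pd n h i) i (t, x) = -pd n (matD n v (fun p => v p i)) i (t, x) := by
    intro i
    rw [← pd_neg_sub_const _ ((Pi.single (⟨n - 1, by omega⟩ : Fin n) (1 : ℝ) : Fin n → ℝ) i)]
    refine pd_congr_of_eventuallyEq ?_ i
    filter_upwards [hS] with q hq
    rw [heuler q.1 q.2 hq.2 i]
    ring
  rw [matD_congr_of_eventuallyEq v hdivloc, matD_neg_sum v fun j => differentiableAt_pd (hvj j) j]
  simp_rw [hlap, fun i => pd_matD (hvj i) (hvp.differentiableAt (by simp)) i]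
  rw [Finset.sum_neg_distrib, Finset.sum_add_distrib]
  ring
end

section
/- Let m ≥ 1, let μ ≥ 2 be a real number, w(x) = (1+|x|²)^μ, and let 0 ≤ l < k ≤ r be integers with k ≥ 1. There is a constant C depending only on m, r and μ such that for every u ∈ C_c^∞(ℝ^m): ‖∇^l u‖_{L^{2r/k}_w(ℝ^m)} ≤ C ‖u‖_{L^{2(r−l)/(k−l)}_w(ℝ^m)}^{1−l/r} (Σ_{i=0}^{r} ‖∇^i u‖_{L²_w(ℝ^m)})^{l/r}. -/
open MeasureTheory Finset

/-- A nonnegative sequence which is log-convex up to a constant interpolates between its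
endpoints. -/
theorem exists_pow_le_of_sq_le_mul {C : ℝ} (hC : 0 ≤ C) {l r : ℕ} (hlr : l ≤ r) :
    ∃ K > 0, ∀ N : ℕ → ℝ, (∀ j, 0 ≤ N j) →
      (∀ j, j + 2 ≤ r → N (j + 1) ^ 2 ≤ C * (N j * N (j + 2))) →
      N l ^ r ≤ K * (N 0 ^ (r - l) * N r ^ l) := by
  have step : ∀ n, ∃ K > 0, ∀ N : ℕ → ℝ, (∀ j, 0 ≤ N j) →
      (∀ j, j + 2 ≤ n + 1 → N (j + 1) ^ 2 ≤ C * (N j * N (j + 2))) →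
      N n ^ (n + 1) ≤ K * (N 0 * N (n + 1) ^ n) := by
    intro n
    induction n with
    | zero => exact ⟨1, one_pos, fun N _ _ => by simp⟩
    | succ n ih =>
      obtain ⟨K, hK, ih⟩ := ih
      refine ⟨(C + 1) ^ (n + 1) * K, by positivity, fun N hN hc => ?_⟩
      have h1 := ih N hN fun j hj => hc j (by omega)
      have h2 := hc n (by omega)
      have n0 := hN 0
      have nn := hN n
      have n1 := hN (n + 1)
      have n2 := hN (n + 2)
      rcases n1.eq_or_lt with h0 | h0
      · rw [← h0, zero_pow (by omega)]
        positivity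
      refine le_of_mul_le_mul_right ?_ (pow_pos h0 n)
      calc N (n + 1) ^ (n + 1 + 1) * N (n + 1) ^ n = (N (n + 1) ^ 2) ^ (n + 1) := by ring
        _ ≤ ((C + 1) * (N n * N (n + 2))) ^ (n + 1) := by
          gcongr
          exact h2.trans (by gcongr; linarith)
        _ = (C + 1) ^ (n + 1) * N (n + 2) ^ (n + 1) * N n ^ (n + 1) := by
          rw [mul_pow, mul_pow]; ring
        _ ≤ (C + 1) ^ (n + 1) * N (n + 2) ^ (n + 1) * (K * (N 0 * N (n + 1) ^ n)) := by gcongr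
        _ = _ := by ring
  induction r, hlr using Nat.le_induction with
  | base => exact ⟨1, one_pos, fun N _ _ => by simp⟩
  | succ n hln ih =>
    obtain ⟨K, hK, ih⟩ := ih
    obtain ⟨K', hK', step⟩ := step n
    rcases Nat.eq_zero_or_pos n with rfl | hn
    · obtain rfl : l = 0 := by omega
      exact ⟨1, one_pos, fun N _ _ => by simp⟩
    refine ⟨(K + 1) ^ (n + 1) * (K' + 1) ^ l, by positivity, fun N hN hc => ?_⟩
    have h1 := ih N hN fun j hj => hc j (by omega)
    have h2 := step N hN hc
    have n0 := hN 0
    have nl := hN l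
    have nn := hN n
    have n1 := hN (n + 1)
    refine le_of_pow_le_pow_left₀ hn.ne' (by positivity) ?_
    obtain ⟨d, rfl⟩ := Nat.exists_eq_add_of_le hln
    have e1 : l + d - l = d := by omega
    have e2 : l + d + 1 - l = d + 1 := by omega
    rw [e1] at h1
    rw [e2]
    calc (N l ^ (l + d + 1)) ^ (l + d) = (N l ^ (l + d)) ^ (l + d + 1) := by ring
      _ ≤ (K * (N 0 ^ d * N (l + d) ^ l)) ^ (l + d + 1) := by gcongr
      _ = K ^ (l + d + 1) * N 0 ^ (d * (l + d + 1)) * (N (l + d) ^ (l + d + 1)) ^ l := by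
        simp only [mul_pow, ← pow_mul]; ring
      _ ≤ K ^ (l + d + 1) * N 0 ^ (d * (l + d + 1)) *
          (K' * (N 0 * N (l + d + 1) ^ (l + d))) ^ l := by gcongr
      _ = K ^ (l + d + 1) * K' ^ l * (N 0 ^ ((d + 1) * (l + d)) *
          N (l + d + 1) ^ (l * (l + d))) := by
        simp only [mul_pow, ← pow_mul]; ring
      _ ≤ ((K + 1) ^ (l + d + 1) * (K' + 1) ^ l) ^ (l + d) * (N 0 ^ ((d + 1) * (l + d)) *
          N (l + d + 1) ^ (l * (l + d))) := by
        gcongr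
        calc K ^ (l + d + 1) * K' ^ l ≤ (K + 1) ^ (l + d + 1) * (K' + 1) ^ l := by
              gcongr <;> linarith
          _ ≤ _ := le_self_pow₀ (one_le_mul_of_one_le_of_one_le
              (one_le_pow₀ (by linarith)) (one_le_pow₀ (by linarith))) hn.ne'
      _ = _ := by simp only [mul_pow, ← pow_mul]

theorem hasDerivAt_abs_rpow_mul_self {p : ℝ} (hp : 0 ≤ p) (x : ℝ) :
    HasDerivAt (fun x : ℝ => |x| ^ p * x) ((p + 1) * |x| ^ p) x := by
  have hc : Continuous fun x : ℝ => |x| ^ p := continuous_abs.rpow_const fun _ => Or.inr hp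
  refine hasDerivAt_of_hasDerivAt_of_ne' (x := 0) (g := fun x => (p + 1) * |x| ^ p)
    (fun y hy => ?_) (by fun_prop) (by fun_prop) x
  have h := ((hasDerivAt_abs hy).rpow_const (p := p) (Or.inl (abs_ne_zero.2 hy))).mul
    (hasDerivAt_id y)
  refine h.congr_deriv ?_
  have h3 : (SignType.sign y : ℝ) * y = |y| := by
    rw [mul_comm, self_mul_sign]
  have h4 : |y| ^ (p - 1) * |y| = |y| ^ p := by
    rw [← Real.rpow_add_one (abs_ne_zero.2 hy)]; ring_nf
  simp only [id, mul_one]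
  linear_combination p * |y| ^ (p - 1) * h3 + p * h4

section Weighted

variable {E : Type*} [NormedAddCommGroup E] [MeasurableSpace E] [BorelSpace E]

/-- Three-factor Hölder inequality with a continuous weight. -/
theorem integral_mul_mul_le_of_hasCompactSupport {ν : Measure E} [IsFiniteMeasureOnCompacts ν]
    {w a b c : E → ℝ} (hw : Continuous w) (w0 : ∀ x, 0 ≤ w x)
    (ha : Continuous a) (hb : Continuous b) (hc : Continuous c)
    (a0 : ∀ x, 0 ≤ a x) (b0 : ∀ x, 0 ≤ b x) (c0 : ∀ x, 0 ≤ c x)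
    (sa : HasCompactSupport a) (sb : HasCompactSupport b) (sc : HasCompactSupport c)
    {α β γ : ℝ} (hα : 0 ≤ α) (hβ : 0 ≤ β) (hγ : 0 ≤ γ) (h : α + β + γ = 1) :
    ∫ x, a x ^ α * b x ^ β * c x ^ γ * w x ∂ν ≤
      (∫ x, a x * w x ∂ν) ^ α * (∫ x, b x * w x ∂ν) ^ β * (∫ x, c x * w x ∂ν) ^ γ := by
  have key : ∀ f : E → ℝ, Continuous f → (∀ x, 0 ≤ f x) → HasCompactSupport f →
      ∫⁻ x, ENNReal.ofReal (f x * w x) ∂ν = ENNReal.ofReal (∫ x, f x * w x ∂ν) :=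
    fun f hf f0 sf => (ofReal_integral_eq_lintegral_ofReal
      ((hf.mul hw).integrable_of_hasCompactSupport sf.mul_right)
      (Filter.Eventually.of_forall fun x => mul_nonneg (f0 x) (w0 x))).symm
  have nn : ∀ f : E → ℝ, (∀ x, 0 ≤ f x) → 0 ≤ ∫ x, f x * w x ∂ν := fun f f0 =>
    integral_nonneg fun x => mul_nonneg (f0 x) (w0 x)
  have hol := ENNReal.lintegral_prod_norm_pow_le (μ := ν) (univ : Finset (Fin 3))
    (f := ![fun x => ENNReal.ofReal (a x * w x), fun x => ENNReal.ofReal (b x * w x),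
      fun x => ENNReal.ofReal (c x * w x)]) (p := ![α, β, γ])
    (by
      intro i _
      fin_cases i
      · exact (ha.mul hw).measurable.ennreal_ofReal.aemeasurable
      · exact (hb.mul hw).measurable.ennreal_ofReal.aemeasurable
      · exact (hc.mul hw).measurable.ennreal_ofReal.aemeasurable)
    (by simpa [Fin.sum_univ_three] using h)
    (by intro i _; fin_cases i <;> simpa)
  simp only [Fin.prod_univ_three, Matrix.cons_val] at hol
  rw [key a ha a0 sa, key b hb b0 sb, key c hc c0 sc,
    ENNReal.ofReal_rpow_of_nonneg (nn a a0) hα, ENNReal.ofReal_rpow_of_nonneg (nn b b0) hβ,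
    ENNReal.ofReal_rpow_of_nonneg (nn c c0) hγ,
    ← ENNReal.ofReal_mul (Real.rpow_nonneg (nn a a0) _),
    ← ENNReal.ofReal_mul (mul_nonneg (Real.rpow_nonneg (nn a a0) _)
      (Real.rpow_nonneg (nn b b0) _))] at hol
  have hR : 0 ≤ (∫ x, a x * w x ∂ν) ^ α * (∫ x, b x * w x ∂ν) ^ β *
      (∫ x, c x * w x ∂ν) ^ γ := mul_nonneg (mul_nonneg (Real.rpow_nonneg (nn a a0) _)
      (Real.rpow_nonneg (nn b b0) _)) (Real.rpow_nonneg (nn c c0) _)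
  rw [integral_eq_lintegral_of_nonneg_ae
    (Filter.Eventually.of_forall fun x => mul_nonneg (mul_nonneg (mul_nonneg
      (Real.rpow_nonneg (a0 x) _) (Real.rpow_nonneg (b0 x) _)) (Real.rpow_nonneg (c0 x) _)) (w0 x))
    ((((ha.rpow_const fun _ => Or.inr hα).mul (hb.rpow_const fun _ => Or.inr hβ)).mul
      (hc.rpow_const fun _ => Or.inr hγ)).mul hw).measurable.aestronglyMeasurable]
  refine ENNReal.toReal_le_of_le_ofReal hR (le_trans (le_of_eq ?_) hol)
  refine lintegral_congr fun x => ?_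
  have hax := mul_nonneg (a0 x) (w0 x)
  have hbx := mul_nonneg (b0 x) (w0 x)
  have hcx := mul_nonneg (c0 x) (w0 x)
  rw [ENNReal.ofReal_rpow_of_nonneg hax hα, ENNReal.ofReal_rpow_of_nonneg hbx hβ,
    ENNReal.ofReal_rpow_of_nonneg hcx hγ, ← ENNReal.ofReal_mul (Real.rpow_nonneg hax _),
    ← ENNReal.ofReal_mul (mul_nonneg (Real.rpow_nonneg hax _) (Real.rpow_nonneg hbx _)),
    Real.mul_rpow (a0 x) (w0 x), Real.mul_rpow (b0 x) (w0 x), Real.mul_rpow (c0 x) (w0 x)]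
  congr 1
  have hwx : w x ^ α * w x ^ β * w x ^ γ = w x := by
    rw [← Real.rpow_add_of_nonneg (w0 x) hα hβ,
      ← Real.rpow_add_of_nonneg (w0 x) (by positivity) hγ, h, Real.rpow_one]
  linear_combination -(a x ^ α * b x ^ β * c x ^ γ) * hwx

end Weighted

theorem continuous_one_add_norm_sq_rpow {E : Type*} [NormedAddCommGroup E] (μ : ℝ) :
    Continuous fun x : E => (1 + ‖x‖ ^ 2) ^ μ :=
  (by fun_prop : Continuous fun x : E => 1 + ‖x‖ ^ 2).rpow_const
    fun x => Or.inl (by positivity)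

section WeightedNorm

variable {E : Type*} [NormedAddCommGroup E] [InnerProductSpace ℝ E]

theorem hasFDerivAt_one_add_norm_sq_rpow (μ : ℝ) (x : E) :
    HasFDerivAt (fun x : E => (1 + ‖x‖ ^ 2) ^ μ)
      ((μ * (1 + ‖x‖ ^ 2) ^ (μ - 1)) • ((2 : ℝ) • innerSL ℝ x)) x := by
  have hx : 1 + ‖x‖ ^ 2 ≠ 0 := by positivity
  have h1 : HasFDerivAt (fun x : E => 1 + ‖x‖ ^ 2) ((2 : ℝ) • innerSL ℝ x) x := by
    have := (hasStrictFDerivAt_norm_sq x).hasFDerivAt.const_add 1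
    rwa [ofNat_smul_eq_nsmul ℝ 2]
  exact h1.rpow_const (Or.inl hx)

theorem abs_deriv_one_add_norm_sq_rpow_le (μ : ℝ) (x : E) {e : E} (he : ‖e‖ = 1) :
    |μ * (1 + ‖x‖ ^ 2) ^ (μ - 1) * (2 * inner ℝ x e)| ≤ 2 * |μ| * (1 + ‖x‖ ^ 2) ^ μ := by
  have hx : 0 < 1 + ‖x‖ ^ 2 := by positivity
  have h1 : |inner ℝ x e| ≤ 1 + ‖x‖ ^ 2 := by
    have := abs_real_inner_le_norm x e
    rw [he, mul_one] at this
    nlinarith [sq_nonneg (‖x‖ - 1), norm_nonneg x]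
  have h2 : (1 + ‖x‖ ^ 2) ^ μ = (1 + ‖x‖ ^ 2) ^ (μ - 1) * (1 + ‖x‖ ^ 2) := by
    rw [← Real.rpow_add_one hx.ne']; ring_nf
  rw [abs_mul, abs_mul, abs_mul, abs_two, abs_of_pos (Real.rpow_pos_of_pos hx _), h2]
  calc |μ| * (1 + ‖x‖ ^ 2) ^ (μ - 1) * (2 * |inner ℝ x e|)
      ≤ |μ| * (1 + ‖x‖ ^ 2) ^ (μ - 1) * (2 * (1 + ‖x‖ ^ 2)) := by gcongr
    _ = _ := by ring

theorem HasCompactSupport.abs_rpow {X : Type*} [TopologicalSpace X] {f : X → ℝ}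
    (hf : HasCompactSupport f) {p : ℝ} (hp : p ≠ 0) :
    HasCompactSupport fun x => |f x| ^ p :=
  hf.comp_left (g := fun y : ℝ => |y| ^ p) (by simp [Real.zero_rpow hp])

variable [FiniteDimensional ℝ E] [MeasurableSpace E] [BorelSpace E]

/-- The weighted norm `(∫ |g| ^ (1 / t) (1 + ‖x‖ ^ 2) ^ μ) ^ t`, parametrised by the inverse `t`
of the Lebesgue exponent. -/
noncomputable def weightedNorm (μ t : ℝ) (g : E → ℝ) : ℝ :=
  (∫ x, |g x| ^ (1 / t) * (1 + ‖x‖ ^ 2) ^ μ) ^ t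

theorem weightedIntegral_nonneg (μ p : ℝ) (g : E → ℝ) :
    0 ≤ ∫ x, |g x| ^ p * (1 + ‖x‖ ^ 2) ^ μ :=
  integral_nonneg fun x => by positivity

theorem weightedNorm_nonneg (μ t : ℝ) (g : E → ℝ) : 0 ≤ weightedNorm μ t g :=
  Real.rpow_nonneg (weightedIntegral_nonneg _ _ _) _

theorem integrable_abs_rpow_mul {μ p : ℝ} (hp : 0 < p) {g : E → ℝ} (hg : Continuous g)
    (sg : HasCompactSupport g) :
    Integrable fun x => |g x| ^ p * (1 + ‖x‖ ^ 2) ^ μ :=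
  ((hg.abs.rpow_const fun _ => Or.inr hp.le).mul
    (continuous_one_add_norm_sq_rpow μ)).integrable_of_hasCompactSupport
      (sg.abs_rpow hp.ne').mul_right

theorem weightedNorm_mono {μ t : ℝ} (ht : 0 < t) {f g : E → ℝ} (hg : Continuous g)
    (sg : HasCompactSupport g) (h : ∀ x, |f x| ≤ |g x|) :
    weightedNorm μ t f ≤ weightedNorm μ t g := by
  refine Real.rpow_le_rpow (weightedIntegral_nonneg _ _ _) ?_ ht.le
  refine integral_mono_of_nonneg (Filter.Eventually.of_forall fun x => by positivity)
    (integrable_abs_rpow_mul (by positivity) hg sg) (Filter.Eventually.of_forall fun x => ?_)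
  exact mul_le_mul_of_nonneg_right (Real.rpow_le_rpow (abs_nonneg _) (h x) (by positivity))
    (by positivity)

theorem integral_mul_mul_le_weightedNorm {μ s t s' : ℝ} (hs : 0 < s) (ht : 0 < t) (hs' : 0 < s')
    (ht2 : t ≤ 1 / 2) (hst : s + s' = 2 * t) {f g h : E → ℝ}
    (hf : Continuous f) (hg : Continuous g) (hh : Continuous h)
    (sf : HasCompactSupport f) (sg : HasCompactSupport g) (sh : HasCompactSupport h) :
    ∫ x, |f x| * |g x| ^ (1 / t - 2) * |h x| * (1 + ‖x‖ ^ 2) ^ μ ≤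
      weightedNorm μ s f * weightedNorm μ s' h *
        (∫ x, |g x| ^ (1 / t) * (1 + ‖x‖ ^ 2) ^ μ) ^ (1 - 2 * t) := by
  have key : ∀ {y p : ℝ}, 0 < p → (|y| ^ (1 / p)) ^ p = |y| := fun {y p} hp => by
    rw [← Real.rpow_mul (abs_nonneg y), one_div_mul_cancel hp.ne', Real.rpow_one]
  have cont : ∀ {k : E → ℝ} {p : ℝ}, 0 < p → Continuous k →
      Continuous fun x => |k x| ^ (1 / p) := fun hp hk =>
    hk.abs.rpow_const fun _ => Or.inr (by positivity)
  have := integral_mul_mul_le_of_hasCompactSupport (ν := (volume : Measure E))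
    (continuous_one_add_norm_sq_rpow μ) (fun x => by positivity)
    (cont hs hf) (cont ht hg) (cont hs' hh)
    (fun x => by positivity) (fun x => by positivity) (fun x => by positivity)
    (sf.abs_rpow (by positivity)) (sg.abs_rpow (by positivity)) (sh.abs_rpow (by positivity))
    hs.le (β := 1 - 2 * t) (by linarith) hs'.le (by linarith)
  calc _ = _ := ?_
    _ ≤ _ := this
    _ = _ := by simp only [weightedNorm]; ring
  refine integral_congr_ae (Filter.Eventually.of_forall fun x => ?_)
  dsimp only
  rw [key hs, key hs', ← Real.rpow_mul (abs_nonneg (g x))]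
  congr 4
  field_simp

theorem sq_weightedNorm_le_of_le {μ t X : ℝ} {g : E → ℝ} (ht : 0 < t) (hX : 0 ≤ X)
    (h : ∫ x, |g x| ^ (1 / t) * (1 + ‖x‖ ^ 2) ^ μ ≤
      X * (∫ x, |g x| ^ (1 / t) * (1 + ‖x‖ ^ 2) ^ μ) ^ (1 - 2 * t)) :
    weightedNorm μ t g ^ 2 ≤ X := by
  rw [weightedNorm, ← Real.rpow_mul_natCast (weightedIntegral_nonneg _ _ _)]
  rcases (weightedIntegral_nonneg μ (1 / t) g).eq_or_lt with h0 | h0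
  · rw [← h0, Real.zero_rpow (by push_cast; positivity)]
    exact hX
  · refine le_of_mul_le_mul_right ?_ (Real.rpow_pos_of_pos h0 (1 - 2 * t))
    rw [← Real.rpow_add h0]
    refine le_trans (le_of_eq ?_) h
    push_cast
    ring_nf
    simp

theorem sq_weightedNorm_le {μ s t s' : ℝ} (hs : 0 < s) (ht : 0 < t) (hs' : 0 < s')
    (ht2 : t ≤ 1 / 2) (hst : s + s' = 2 * t) {f : E → ℝ}
    (hf : Continuous f) (sf : HasCompactSupport f) :
    weightedNorm μ t f ^ 2 ≤ weightedNorm μ s f * weightedNorm μ s' f := by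
  refine sq_weightedNorm_le_of_le ht
    (mul_nonneg (weightedNorm_nonneg _ _ _) (weightedNorm_nonneg _ _ _)) ?_
  refine le_trans (le_of_eq ?_)
    (integral_mul_mul_le_weightedNorm hs ht hs' ht2 hst hf hf hf sf sf sf)
  refine integral_congr_ae (Filter.Eventually.of_forall fun x => ?_)
  dsimp only
  have h2 : 2 ≤ 1 / t := by rw [le_div_iff₀ ht]; linarith
  have : |f x| ^ (1 / t) = |f x| ^ (1 / t - 2) * |f x| ^ (2 : ℝ) := by
    rw [← Real.rpow_add_of_nonneg (abs_nonneg _) (by linarith) (by norm_num)]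
    ring_nf
  rw [this, Real.rpow_two]
  ring

/-- One-step weighted interpolation inequality for a directional derivative. -/
theorem sq_weightedNorm_fderiv_le {μ s t s' : ℝ} (hs : 0 < s) (ht : 0 < t) (hs' : 0 < s')
    (ht2 : t ≤ 1 / 2) (hst : s + s' = 2 * t) {f g : E → ℝ} {e : E} (he : ‖e‖ = 1)
    (hf : ContDiff ℝ 1 f) (sf : HasCompactSupport f) (hfg : ∀ x, fderiv ℝ f x e = g x)
    (hg : ContDiff ℝ 1 g) :
    weightedNorm μ t g ^ 2 ≤ (1 / t - 1 + 2 * |μ|) * (weightedNorm μ s f *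
      (weightedNorm μ s' (fun x => fderiv ℝ g x e) + weightedNorm μ s' g)) := by
  have h2 : 2 ≤ 1 / t := by rw [le_div_iff₀ ht]; linarith
  set h : E → ℝ := fun x => fderiv ℝ g x e with h_def
  set p : ℝ := 1 / t - 2 with p_def
  have hp : 0 ≤ p := by linarith
  have sg : HasCompactSupport g := funext hfg ▸ sf.fderiv_apply ℝ e
  have sh : HasCompactSupport h := sg.fderiv_apply ℝ e
  have ch : Continuous h := (hg.continuous_fderiv (by norm_num)).clm_apply continuous_const
  have cg := hg.continuous
  have cf := hf.continuous
  have cw := continuous_one_add_norm_sq_rpow (E := E) μ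
  have cw1 := continuous_one_add_norm_sq_rpow (E := E) (μ - 1)
  have cgp : Continuous fun x => |g x| ^ p := cg.abs.rpow_const fun _ => Or.inr hp
  have hX := weightedNorm_nonneg μ s f
  have hY := weightedNorm_nonneg μ s' h
  have hZ := weightedNorm_nonneg μ s' g
  refine sq_weightedNorm_le_of_le ht (mul_nonneg (by linarith [abs_nonneg μ]) (by positivity)) ?_
  have dG : ∀ x, HasFDerivAt (fun x => |g x| ^ p * g x * (1 + ‖x‖ ^ 2) ^ μ) _ x := fun x =>
    ((hasDerivAt_abs_rpow_mul_self hp (g x)).comp_hasFDerivAt x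
      (hg.differentiable (by norm_num) x).hasFDerivAt).mul (hasFDerivAt_one_add_norm_sq_rpow μ x)
  have dGe : ∀ x, fderiv ℝ (fun x => |g x| ^ p * g x * (1 + ‖x‖ ^ 2) ^ μ) x e =
      |g x| ^ p * g x * (μ * (1 + ‖x‖ ^ 2) ^ (μ - 1) * (2 * inner ℝ x e)) +
        (1 + ‖x‖ ^ 2) ^ μ * ((p + 1) * |g x| ^ p * h x) := fun x => by
    rw [(dG x).fderiv]
    simp [h_def]
  have parts := integral_mul_fderiv_eq_neg_fderiv_mul_of_integrable (μ := (volume : Measure E))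
    (f := fun x => |g x| ^ p * g x * (1 + ‖x‖ ^ 2) ^ μ) (g := f) (v := e)
    (by
      simp only [dGe]
      exact Continuous.integrable_of_hasCompactSupport (by fun_prop) sf.mul_left)
    (by
      simp only [hfg]
      exact Continuous.integrable_of_hasCompactSupport (by fun_prop) sg.mul_left)
    (Continuous.integrable_of_hasCompactSupport (by fun_prop) sf.mul_left)
    (fun x _ => (dG x).differentiableAt)
    (fun x _ => hf.differentiable (by norm_num) x)
  have lhs : ∀ x, |g x| ^ (1 / t) * (1 + ‖x‖ ^ 2) ^ μ =
      |g x| ^ p * g x * (1 + ‖x‖ ^ 2) ^ μ * fderiv ℝ f x e := fun x => by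
    have : |g x| ^ (1 / t) = |g x| ^ p * |g x| ^ (2 : ℝ) := by
      rw [← Real.rpow_add_of_nonneg (abs_nonneg _) hp (by norm_num), p_def]
      ring_nf
    rw [this, Real.rpow_two, sq_abs, hfg]
    ring
  have i1 := integral_mul_mul_le_weightedNorm (μ := μ) hs ht hs' ht2 hst cf cg ch sf sg sh
  have i2 := integral_mul_mul_le_weightedNorm (μ := μ) hs ht hs' ht2 hst cf cg cg sf sg sg
  have n1 : Integrable fun x => |f x| * |g x| ^ p * |h x| * (1 + ‖x‖ ^ 2) ^ μ :=
    Continuous.integrable_of_hasCompactSupport (by fun_prop) sh.abs.mul_left.mul_right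
  have n2 : Integrable fun x => |f x| * |g x| ^ p * |g x| * (1 + ‖x‖ ^ 2) ^ μ :=
    Continuous.integrable_of_hasCompactSupport (by fun_prop) sg.abs.mul_left.mul_right
  set I := ∫ x, |g x| ^ (1 / t) * (1 + ‖x‖ ^ 2) ^ μ with I_def
  have I0 : 0 ≤ I := weightedIntegral_nonneg _ _ _
  have J0 : 0 ≤ I ^ (1 - 2 * t) := Real.rpow_nonneg I0 _
  calc I = - ∫ x, fderiv ℝ (fun x => |g x| ^ p * g x * (1 + ‖x‖ ^ 2) ^ μ) x e * f x := by
        rw [← parts, I_def]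
        exact integral_congr_ae (Filter.Eventually.of_forall lhs)
    _ ≤ |∫ x, fderiv ℝ (fun x => |g x| ^ p * g x * (1 + ‖x‖ ^ 2) ^ μ) x e * f x| :=
        neg_le_abs _
    _ ≤ ∫ x, ((p + 1) * (|f x| * |g x| ^ p * |h x| * (1 + ‖x‖ ^ 2) ^ μ) +
          2 * |μ| * (|f x| * |g x| ^ p * |g x| * (1 + ‖x‖ ^ 2) ^ μ)) := by
        rw [← Real.norm_eq_abs]
        refine norm_integral_le_of_norm_le ((n1.const_mul _).add (n2.const_mul _))
          (Filter.Eventually.of_forall fun x => ?_)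
        have w0 : 0 ≤ (1 + ‖x‖ ^ 2) ^ μ := by positivity
        have gp0 : 0 ≤ |g x| ^ p := by positivity
        rw [dGe, Real.norm_eq_abs, abs_mul]
        calc _ ≤ (|g x| ^ p * |g x| * (2 * |μ| * (1 + ‖x‖ ^ 2) ^ μ) +
              (1 + ‖x‖ ^ 2) ^ μ * ((p + 1) * |g x| ^ p * |h x|)) * |f x| := by
              gcongr
              refine (abs_add_le _ _).trans (add_le_add ?_ (le_of_eq ?_))
              · rw [abs_mul, abs_mul, abs_of_nonneg gp0]
                gcongr
                exact abs_deriv_one_add_norm_sq_rpow_le μ x he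
              · rw [abs_mul, abs_mul, abs_mul, abs_of_nonneg gp0, abs_of_nonneg w0,
                  abs_of_nonneg (by linarith : 0 ≤ p + 1)]
          _ = _ := by ring
    _ = (p + 1) * (∫ x, |f x| * |g x| ^ p * |h x| * (1 + ‖x‖ ^ 2) ^ μ) +
          2 * |μ| * ∫ x, |f x| * |g x| ^ p * |g x| * (1 + ‖x‖ ^ 2) ^ μ := by
        rw [integral_add (n1.const_mul _) (n2.const_mul _), integral_const_mul,
          integral_const_mul]
    _ ≤ (p + 1) * (weightedNorm μ s f * weightedNorm μ s' h * I ^ (1 - 2 * t)) +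
          2 * |μ| * (weightedNorm μ s f * weightedNorm μ s' g * I ^ (1 - 2 * t)) := by
        gcongr
    _ ≤ (p + 1 + 2 * |μ|) * (weightedNorm μ s f * weightedNorm μ s' h * I ^ (1 - 2 * t)) +
          (p + 1 + 2 * |μ|) * (weightedNorm μ s f * weightedNorm μ s' g * I ^ (1 - 2 * t)) := by
        refine add_le_add (mul_le_mul_of_nonneg_right ?_ (by positivity))
          (mul_le_mul_of_nonneg_right ?_ (by positivity)) <;> linarith [abs_nonneg μ]
    _ = _ := by rw [p_def]; ring

theorem weightedNorm_le_of_abs_le_sum {ι : Type*} [Fintype ι] [Nonempty ι] {μ t B : ℝ}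
    (ht : 0 < t) (ht1 : t ≤ 1) {f : E → ℝ} {g : ι → E → ℝ} (hg : ∀ i, Continuous (g i))
    (sg : ∀ i, HasCompactSupport (g i)) (h : ∀ x, |f x| ≤ ∑ i, |g i x|)
    (hB : ∀ i, weightedNorm μ t (g i) ≤ B) :
    weightedNorm μ t f ≤ Fintype.card ι * B := by
  have B0 : 0 ≤ B := (weightedNorm_nonneg μ t _).trans (hB (Classical.arbitrary ι))
  have q1 : 1 ≤ 1 / t := by rwa [le_div_iff₀ ht, one_mul]
  have card0 : (0 : ℝ) < Fintype.card ι := by exact_mod_cast Fintype.card_pos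
  have hint : ∀ i, Integrable fun x => |g i x| ^ (1 / t) * (1 + ‖x‖ ^ 2) ^ μ := fun i =>
    integrable_abs_rpow_mul (by positivity) (hg i) (sg i)
  have hI : ∀ i, ∫ x, |g i x| ^ (1 / t) * (1 + ‖x‖ ^ 2) ^ μ ≤ B ^ (1 / t) := fun i => by
    have := Real.rpow_le_rpow (weightedNorm_nonneg _ _ _) (hB i) (by positivity : 0 ≤ 1 / t)
    rwa [weightedNorm, ← Real.rpow_mul (weightedIntegral_nonneg _ _ _),
      mul_one_div_cancel ht.ne', Real.rpow_one] at this
  have key : ∫ x, |f x| ^ (1 / t) * (1 + ‖x‖ ^ 2) ^ μ ≤ (Fintype.card ι * B) ^ (1 / t) := by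
    calc ∫ x, |f x| ^ (1 / t) * (1 + ‖x‖ ^ 2) ^ μ
        ≤ ∫ x, (Fintype.card ι : ℝ) ^ (1 / t - 1) *
            ∑ i, |g i x| ^ (1 / t) * (1 + ‖x‖ ^ 2) ^ μ := by
          refine integral_mono_of_nonneg (Filter.Eventually.of_forall fun x => by positivity)
            ((integrable_finsetSum _ fun i _ => hint i).const_mul _)
            (Filter.Eventually.of_forall fun x => ?_)
          dsimp only
          rw [← Finset.sum_mul, ← mul_assoc]
          refine mul_le_mul_of_nonneg_right ?_ (by positivity)
          exact (Real.rpow_le_rpow (abs_nonneg _) (h x) (by positivity)).trans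
            (Real.rpow_sum_le_const_mul_sum_rpow univ (fun i => g i x) q1)
      _ = (Fintype.card ι : ℝ) ^ (1 / t - 1) *
            ∑ i, ∫ x, |g i x| ^ (1 / t) * (1 + ‖x‖ ^ 2) ^ μ := by
          rw [integral_const_mul, integral_finsetSum _ fun i _ => hint i]
      _ ≤ (Fintype.card ι : ℝ) ^ (1 / t - 1) * ∑ _i : ι, B ^ (1 / t) := by
          gcongr with i
          exact hI i
      _ = (Fintype.card ι : ℝ) ^ (1 / t - 1) * Fintype.card ι * B ^ (1 / t) := by
          rw [Finset.sum_const, nsmul_eq_mul, Finset.card_univ, mul_assoc]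
      _ = _ := by
          rw [← Real.rpow_add_one card0.ne', sub_add_cancel, Real.mul_rpow card0.le B0]
  have := Real.rpow_le_rpow (weightedIntegral_nonneg _ _ _) key ht.le
  rwa [← Real.rpow_mul (by positivity), one_div_mul_cancel ht.ne', Real.rpow_one] at this

end WeightedNorm

section Components

variable {m : ℕ}

/-- The partial derivative of `u` along the coordinate directions listed by `idx`. -/
noncomputable def partialDeriv (u : EuclideanSpace ℝ (Fin m) → ℝ) (i : ℕ) (idx : Fin i → Fin m)
    (x : EuclideanSpace ℝ (Fin m)) : ℝ :=
  iteratedFDeriv ℝ i u x fun a => EuclideanSpace.single (idx a) 1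

variable {u : EuclideanSpace ℝ (Fin m) → ℝ}

theorem contDiff_partialDeriv (hu : ContDiff ℝ (⊤ : ℕ∞) u) (i : ℕ) (idx : Fin i → Fin m) :
    ContDiff ℝ 1 (partialDeriv u i idx) := by
  have h : ContDiff ℝ 1 (iteratedFDeriv ℝ i u) :=
    hu.iteratedFDeriv_right (by exact_mod_cast le_top)
  exact (ContinuousMultilinearMap.apply ℝ (fun _ : Fin i => EuclideanSpace ℝ (Fin m)) ℝ
    fun a => EuclideanSpace.single (idx a) 1).contDiff.comp h

theorem hasCompactSupport_partialDeriv (su : HasCompactSupport u) (i : ℕ) (idx : Fin i → Fin m) :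
    HasCompactSupport (partialDeriv u i idx) :=
  (su.iteratedFDeriv (𝕜 := ℝ) i).comp_left
    (g := fun T : ContinuousMultilinearMap ℝ (fun _ : Fin i => EuclideanSpace ℝ (Fin m)) ℝ =>
      T fun a => EuclideanSpace.single (idx a) 1) rfl

theorem fderiv_partialDeriv (hu : ContDiff ℝ (⊤ : ℕ∞) u) (i : ℕ) (idx : Fin i → Fin m)
    (a : Fin m) (x : EuclideanSpace ℝ (Fin m)) :
    fderiv ℝ (partialDeriv u i idx) x (EuclideanSpace.single a 1) =
      partialDeriv u (i + 1) (Fin.cons a idx) x := by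
  have h : DifferentiableAt ℝ (iteratedFDeriv ℝ i u) x :=
    hu.differentiable_iteratedFDeriv (by exact_mod_cast WithTop.coe_lt_top _) x
  have h1 := (ContinuousMultilinearMap.apply ℝ (fun _ : Fin i => EuclideanSpace ℝ (Fin m)) ℝ
    fun a => EuclideanSpace.single (idx a) 1).hasFDerivAt.comp x h.hasFDerivAt
  have h2 : fderiv ℝ (partialDeriv u i idx) x = _ := h1.fderiv
  rw [h2, partialDeriv, iteratedFDeriv_succ_apply_left]
  rfl

theorem abs_partialDeriv_le (i : ℕ) (idx : Fin i → Fin m) (x : EuclideanSpace ℝ (Fin m)) :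
    |partialDeriv u i idx x| ≤ ‖iteratedFDeriv ℝ i u x‖ := by
  have := (iteratedFDeriv ℝ i u x).le_opNorm fun a => EuclideanSpace.single (idx a) 1
  simpa [partialDeriv] using this

theorem norm_iteratedFDeriv_le_sum (i : ℕ) (x : EuclideanSpace ℝ (Fin m)) :
    ‖iteratedFDeriv ℝ i u x‖ ≤ ∑ idx : Fin i → Fin m, |partialDeriv u i idx x| := by
  refine ContinuousMultilinearMap.opNorm_le_bound (by positivity) fun v => ?_
  have hv : v = fun a => ∑ b, v a b • EuclideanSpace.single b (1 : ℝ) := by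
    ext a c
    simp [Pi.single_apply]
  conv_lhs => rw [hv]
  rw [ContinuousMultilinearMap.map_sum, Finset.sum_mul]
  refine (norm_sum_le _ _).trans (Finset.sum_le_sum fun idx _ => ?_)
  rw [ContinuousMultilinearMap.map_smul_univ, norm_smul, mul_comm, norm_prod]
  refine mul_le_mul_of_nonneg_left ?_ (abs_nonneg _)
  exact Finset.prod_le_prod (fun _ _ => norm_nonneg _) fun a _ => PiLp.norm_apply_le (v a) _

/-- The sum of the weighted norms of all partial derivatives of order at most `j`. -/
noncomputable def weightedSobolevNorm (μ t : ℝ) (j : ℕ) (u : EuclideanSpace ℝ (Fin m) → ℝ) : ℝ :=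
  ∑ i ∈ range (j + 1), ∑ idx : Fin i → Fin m, weightedNorm μ t (partialDeriv u i idx)

theorem weightedSobolevNorm_nonneg (μ t : ℝ) (j : ℕ) : 0 ≤ weightedSobolevNorm μ t j u :=
  sum_nonneg fun _ _ => sum_nonneg fun _ _ => weightedNorm_nonneg _ _ _

theorem weightedNorm_partialDeriv_le (μ t : ℝ) {i j : ℕ} (hij : i ≤ j) (idx : Fin i → Fin m) :
    weightedNorm μ t (partialDeriv u i idx) ≤ weightedSobolevNorm μ t j u :=
  (single_le_sum (f := fun idx => weightedNorm μ t (partialDeriv u i idx))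
    (fun _ _ => weightedNorm_nonneg _ _ _) (mem_univ idx)).trans
    (single_le_sum (f := fun i => ∑ idx : Fin i → Fin m, weightedNorm μ t (partialDeriv u i idx))
      (fun _ _ => sum_nonneg fun _ _ => weightedNorm_nonneg _ _ _)
      (mem_range.2 (Nat.lt_succ_of_le hij)))

theorem sq_weightedSobolevNorm_le {μ s t s' : ℝ} (hs : 0 < s) (ht : 0 < t) (hs' : 0 < s')
    (ht2 : t ≤ 1 / 2) (hst : s + s' = 2 * t) (hu : ContDiff ℝ (⊤ : ℕ∞) u)
    (su : HasCompactSupport u) (j : ℕ) :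
    weightedSobolevNorm μ t (j + 1) u ^ 2 ≤
      ((∑ i ∈ range (j + 2), (m : ℝ) ^ i) ^ 2 * (2 * (1 / t + 2 * |μ|))) *
        (weightedSobolevNorm μ s j u * weightedSobolevNorm μ s' (j + 2) u) := by
  set X := weightedSobolevNorm μ s j u with X_def
  set Y := weightedSobolevNorm μ s' (j + 2) u with Y_def
  have X0 : 0 ≤ X := weightedSobolevNorm_nonneg _ _ _
  have Y0 : 0 ≤ Y := weightedSobolevNorm_nonneg _ _ _
  have h2 : 2 ≤ 1 / t := by rw [le_div_iff₀ ht]; linarith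
  have hμ := abs_nonneg μ
  have key : ∀ i ∈ range (j + 2), ∀ idx : Fin i → Fin m,
      weightedNorm μ t (partialDeriv u i idx) ≤ √(2 * (1 / t + 2 * |μ|) * (X * Y)) := by
    intro i hi idx
    refine Real.le_sqrt_of_sq_le ?_
    have hij : i ≤ j + 1 := Nat.lt_succ_iff.1 (mem_range.1 hi)
    cases i with
    | zero =>
      have h := sq_weightedNorm_le (μ := μ) hs ht hs' ht2 hst
        (contDiff_partialDeriv hu 0 idx).continuous (hasCompactSupport_partialDeriv su 0 idx)
      have hX := weightedNorm_partialDeriv_le (u := u) μ s (Nat.zero_le j) idx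
      have hY := weightedNorm_partialDeriv_le (u := u) μ s' (Nat.zero_le (j + 2)) idx
      calc _ ≤ _ := h
        _ ≤ X * Y := mul_le_mul hX hY (weightedNorm_nonneg _ _ _) X0
        _ ≤ _ := le_mul_of_one_le_left (by positivity) (by linarith)
    | succ i =>
      have h := sq_weightedNorm_fderiv_le (μ := μ) hs ht hs' ht2 hst
        (e := EuclideanSpace.single (idx 0) 1) (g := partialDeriv u (i + 1) idx) (by simp)
        (contDiff_partialDeriv hu i (Fin.tail idx))
        (hasCompactSupport_partialDeriv su i (Fin.tail idx))
        (fun x => by rw [fderiv_partialDeriv hu, Fin.cons_self_tail])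
        (contDiff_partialDeriv hu (i + 1) idx)
      have hfun : (fun x => fderiv ℝ (partialDeriv u (i + 1) idx) x
          (EuclideanSpace.single (idx 0) 1)) = partialDeriv u (i + 2) (Fin.cons (idx 0) idx) :=
        funext (fderiv_partialDeriv hu (i + 1) idx (idx 0))
      rw [hfun] at h
      have hX := weightedNorm_partialDeriv_le (u := u) μ s (by omega : i ≤ j) (Fin.tail idx)
      have hY := weightedNorm_partialDeriv_le (u := u) μ s' (by omega : i + 2 ≤ j + 2)
        (Fin.cons (idx 0) idx)
      have hZ := weightedNorm_partialDeriv_le (u := u) μ s' (by omega : i + 1 ≤ j + 2) idx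
      calc _ ≤ _ := h
        _ ≤ (1 / t + 2 * |μ|) * (X * (Y + Y)) := by
          have w1 := weightedNorm_nonneg μ s' (partialDeriv u (i + 2) (Fin.cons (idx 0) idx))
          have w2 := weightedNorm_nonneg μ s' (partialDeriv u (i + 1) idx)
          have w3 := weightedNorm_nonneg μ s (partialDeriv u i (Fin.tail idx))
          gcongr
          linarith
        _ = _ := by ring
  have hsum : weightedSobolevNorm μ t (j + 1) u ≤
      (∑ i ∈ range (j + 2), (m : ℝ) ^ i) * √(2 * (1 / t + 2 * |μ|) * (X * Y)) := by
    rw [weightedSobolevNorm, Finset.sum_mul]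
    refine sum_le_sum fun i hi => (sum_le_sum fun idx _ => key i hi idx).trans (le_of_eq ?_)
    simp
  refine (pow_le_pow_left₀ (weightedSobolevNorm_nonneg _ _ _) hsum 2).trans (le_of_eq ?_)
  rw [mul_pow, Real.sq_sqrt (by positivity), mul_assoc, mul_assoc, mul_assoc]

theorem weightedSobolevNorm_zero (μ t : ℝ) :
    weightedSobolevNorm μ t 0 u = weightedNorm μ t u := by
  have : ∀ idx, partialDeriv u 0 idx = u := fun idx => by
    ext x
    simp [partialDeriv]
  simp [weightedSobolevNorm, this]

theorem weightedSobolevNorm_le {μ t : ℝ} (ht : 0 < t) (hu : ContDiff ℝ (⊤ : ℕ∞) u)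
    (su : HasCompactSupport u) (j : ℕ) :
    weightedSobolevNorm μ t j u ≤ (∑ i ∈ range (j + 1), (m : ℝ) ^ i) *
      ∑ i ∈ range (j + 1), weightedNorm μ t fun x => ‖iteratedFDeriv ℝ i u x‖ := by
  rw [weightedSobolevNorm, Finset.sum_mul]
  refine sum_le_sum fun i hi => ?_
  have h1 : ∀ idx, weightedNorm μ t (partialDeriv u i idx) ≤
      ∑ i ∈ range (j + 1), weightedNorm μ t fun x => ‖iteratedFDeriv ℝ i u x‖ := fun idx =>
    (weightedNorm_mono ht (hu.continuous_iteratedFDeriv (by exact_mod_cast le_top)).norm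
      (su.iteratedFDeriv i).norm fun x => by
        rw [abs_norm]; exact abs_partialDeriv_le i idx x).trans
    (single_le_sum (f := fun i => weightedNorm μ t fun x => ‖iteratedFDeriv ℝ i u x‖)
      (fun _ _ => weightedNorm_nonneg _ _ _) hi)
  refine (sum_le_sum fun idx _ => h1 idx).trans (le_of_eq ?_)
  simp

end Components

theorem stmt18 (m : ℕ) (hm : 1 ≤ m) (μ : ℝ) (hμ : 2 ≤ μ)
    (l k r : ℕ) (hlk : l < k) (hkr : k ≤ r) (hk : 1 ≤ k) :
    ∃ C > 0, ∀ u : EuclideanSpace ℝ (Fin m) → ℝ,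
      ContDiff ℝ (⊤ : ℕ∞) u → HasCompactSupport u →
      (∫ x, ‖iteratedFDeriv ℝ l u x‖ ^ ((2 * (r : ℝ)) / (k : ℝ)) * (1 + ‖x‖ ^ 2) ^ μ) ^
          ((k : ℝ) / (2 * (r : ℝ))) ≤
        C * ((∫ x, |u x| ^ ((2 * ((r : ℝ) - (l : ℝ))) / ((k : ℝ) - (l : ℝ))) *
                (1 + ‖x‖ ^ 2) ^ μ) ^
              (((k : ℝ) - (l : ℝ)) / (2 * ((r : ℝ) - (l : ℝ))))) ^ (1 - (l : ℝ) / (r : ℝ)) *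
          (∑ i ∈ Finset.range (r + 1),
            (∫ x, ‖iteratedFDeriv ℝ i u x‖ ^ 2 * (1 + ‖x‖ ^ 2) ^ μ) ^ ((1 : ℝ) / 2)) ^
            ((l : ℝ) / (r : ℝ)) := by
  have hlk' : (l : ℝ) < k := by exact_mod_cast hlk
  have hkr' : (k : ℝ) ≤ r := by exact_mod_cast hkr
  have hl0 : (0 : ℝ) ≤ l := by positivity
  have hk0 : (0 : ℝ) < k := by linarith
  have hr0 : (0 : ℝ) < r := by linarith
  have hrl : (0 : ℝ) < r - l := by linarith
  have hkl : (0 : ℝ) < k - l := by linarith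
  have hlr : l ≤ r := by omega
  have hm' : Nonempty (Fin m) := ⟨⟨0, hm⟩⟩
  set A : ℝ := ((k : ℝ) - l) / (2 * (r - l)) with A_def
  have A0 : 0 < A := by positivity
  have A2 : A ≤ 1 / 2 := by
    rw [A_def, div_le_div_iff₀ (by positivity) two_pos]; linarith
  set t : ℕ → ℝ := fun j => A + (1 / 2 - A) / r * j with t_def
  have tA : ∀ j, A ≤ t j := fun j => by
    have : 0 ≤ 1 / 2 - A := by linarith
    have : 0 ≤ (1 / 2 - A) / r * j := by positivity
    simp only [t_def]; linarith
  have tpos : ∀ j, 0 < t j := fun j => A0.trans_le (tA j)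
  have t2 : ∀ j ≤ r, t j ≤ 1 / 2 := fun j hj => by
    have h1 : (j : ℝ) ≤ r := by exact_mod_cast hj
    have h2 : (1 / 2 - A) / r * j ≤ 1 / 2 - A := by
      rw [div_mul_eq_mul_div, div_le_iff₀ hr0]
      exact mul_le_mul_of_nonneg_left h1 (by linarith)
    simp only [t_def]; linarith
  have t0 : t 0 = A := by simp [t_def]
  have tl : t l = k / (2 * r) := by
    simp only [t_def, A_def]; field_simp; ring
  have tr : t r = 1 / 2 := by
    simp only [t_def]; field_simp; ring
  set T : ℝ := ∑ i ∈ range (r + 1), (m : ℝ) ^ i with T_def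
  have T0 : 0 < T := sum_pos (fun i _ => by positivity) ⟨0, by simp⟩
  obtain ⟨K, hK, hseq⟩ := exists_pow_le_of_sq_le_mul
    (C := T ^ 2 * (2 * (1 / A + 2 * |μ|))) (by positivity) hlr
  refine ⟨(Fintype.card (Fin l → Fin m) : ℝ) * (K ^ (1 / (r : ℝ)) * T ^ ((l : ℝ) / r)),
    by positivity, fun u hu su => ?_⟩
  set N : ℕ → ℝ := fun j => weightedSobolevNorm μ (t j) j u with N_def
  have N0 : ∀ j, 0 ≤ N j := fun j => weightedSobolevNorm_nonneg _ _ _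
  have hN := hseq N N0 fun j hj => by
    refine (sq_weightedSobolevNorm_le (μ := μ) (tpos j) (tpos (j + 1)) (tpos (j + 2))
      (t2 _ (by omega)) (by simp only [t_def]; push_cast; ring) hu su j).trans
      (mul_le_mul_of_nonneg_right ?_ (mul_nonneg (N0 j) (N0 (j + 2))))
    have h1 : ∑ i ∈ range (j + 2), (m : ℝ) ^ i ≤ T :=
      sum_le_sum_of_subset_of_nonneg (range_subset_range.2 (by omega)) fun _ _ _ => by positivity
    have h2 := tA (j + 1)
    have h3 := tpos (j + 1)
    gcongr
  have hroot : N l ≤ K ^ (1 / (r : ℝ)) * (N 0 ^ (1 - (l : ℝ) / r) * N r ^ ((l : ℝ) / r)) := by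
    have n0 := N0 0
    have nr := N0 r
    have h := Real.rpow_le_rpow (pow_nonneg (N0 l) r) hN (by positivity : 0 ≤ 1 / (r : ℝ))
    rw [Real.mul_rpow hK.le (by positivity), Real.mul_rpow (by positivity) (by positivity),
      ← Real.rpow_natCast_mul (N0 l), ← Real.rpow_natCast_mul n0, ← Real.rpow_natCast_mul nr,
      mul_one_div_cancel hr0.ne', Real.rpow_one, mul_one_div, mul_one_div, Nat.cast_sub hlr,
      sub_div, div_self hr0.ne'] at h
    exact h
  have hN0 : N 0 = (∫ x, |u x| ^ ((2 * ((r : ℝ) - l)) / ((k : ℝ) - l)) *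
      (1 + ‖x‖ ^ 2) ^ μ) ^ A := by
    simp only [N_def, t0, weightedSobolevNorm_zero, weightedNorm, A_def, one_div_div]
  have hNr : N r ≤ T * ∑ i ∈ Finset.range (r + 1),
      (∫ x, ‖iteratedFDeriv ℝ i u x‖ ^ 2 * (1 + ‖x‖ ^ 2) ^ μ) ^ ((1 : ℝ) / 2) := by
    have h := weightedSobolevNorm_le (μ := μ) (tpos r) hu su r
    rw [tr] at h
    simp only [weightedNorm, abs_norm, one_div_one_div, Real.rpow_two] at h
    simpa only [N_def, tr] using h
  have hL := weightedNorm_le_of_abs_le_sum (μ := μ) (tpos l) ((t2 l hlr).trans (by norm_num))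
    (f := fun x => ‖iteratedFDeriv ℝ l u x‖)
    (fun idx => (contDiff_partialDeriv hu l idx).continuous)
    (fun idx => hasCompactSupport_partialDeriv su l idx)
    (fun x => by rw [abs_norm]; exact norm_iteratedFDeriv_le_sum l x)
    (fun idx => weightedNorm_partialDeriv_le (u := u) μ (t l) le_rfl idx)
  simp only [weightedNorm, abs_norm, tl, one_div_div] at hL
  rw [← tl] at hL
  set S := ∑ i ∈ Finset.range (r + 1),
      (∫ x, ‖iteratedFDeriv ℝ i u x‖ ^ 2 * (1 + ‖x‖ ^ 2) ^ μ) ^ ((1 : ℝ) / 2)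
  have S0 : 0 ≤ S := sum_nonneg fun i _ =>
    Real.rpow_nonneg (integral_nonneg fun x => by positivity) _
  rw [← hN0, ← tl]
  have n0 := N0 0
  have nr := N0 r
  calc _ ≤ _ := hL
    _ ≤ Fintype.card (Fin l → Fin m) *
        (K ^ (1 / (r : ℝ)) * (N 0 ^ (1 - (l : ℝ) / r) * (T * S) ^ ((l : ℝ) / r))) := by
      refine mul_le_mul_of_nonneg_left (hroot.trans ?_) (by positivity)
      gcongr
    _ = _ := by rw [Real.mul_rpow T0.le S0]; ring
end
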